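/- Fix a ∈ (0,1). For every sufficiently large inverse temperature β there exists c = c(β) > 0 such that, for the Glauber dynamics of the SOS model on Λ = {1,…,L}² with zero boundary conditions, floor at 0 and ceiling at n⁺ with log L ≤ n⁺ ≤ L, started from the all-zero configuration: with Ω_a = {η ∈ Ω_{Λ,n⁺} : #{x ∈ Λ : η_x ≥ a·H(L)} > (9/10)·|Λ|} and τ_a = min{t : η(t) ∈ Ω_a}, one has lim_{L→∞} π_Λ^0(Ω_a) = 1 and lim_{L→∞} P( e^{c·L^a} ≤ τ_a ≤ e^{L^a/c} ) = 1. -/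

import Mathlib

open scoped Classical
open Filter

noncomputable section

namespace SOSPaper

set_option linter.all false

/-- Sites of the lattice `ℤ²`. -/
abbrev Site : Type := ℤ × ℤ

/-- Height configurations on `ℤ²`. -/
abbrev Config : Type := Site → ℤ

/-- Nearest-neighbour adjacency on `ℤ²`. -/
def SiteAdj (x y : Site) : Prop := (x.1 - y.1).natAbs + (x.2 - y.2).natAbs = 1

/-- The four nearest neighbours of a site. -/
def nbrs (x : Site) : Finset Site :=
  {(x.1 + 1, x.2), (x.1 - 1, x.2), (x.1, x.2 + 1), (x.1, x.2 - 1)}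

/-- The SOS Hamiltonian on `Λ` with boundary condition `ξ`:
`H_Λ^ξ(η) = (1/2) Σ_{x,y∈Λ adjacent} |η_x-η_y| + Σ_{x∈Λ, y∉Λ adjacent} |η_x-ξ_y|`. -/
def sosH (Λ : Finset Site) (ξ : Config) (η : Config) : ℝ :=
  (1 / 2) * ∑ x ∈ Λ, ∑ y ∈ (nbrs x).filter (fun y => y ∈ Λ), ((|η x - η y| : ℤ) : ℝ)
    + ∑ x ∈ Λ, ∑ y ∈ (nbrs x).filter (fun y => y ∉ Λ), ((|η x - ξ y| : ℤ) : ℝ)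

/-- Extension of `g : Λ → ℤ` by the boundary condition `ξ` off `Λ`. -/
def extendC (Λ : Finset Site) (ξ : Config) (g : {x // x ∈ Λ} → ℤ) : Config :=
  fun x => if h : x ∈ Λ then g ⟨x, h⟩ else ξ x

/-- Gibbs weight `exp(-β·H_Λ^ξ(η) + F(η))`, subject to the single-site constraint
`η_x ∈ K` for all `x ∈ Λ` (floor/ceiling constraints); `F` is an extra external field
(`F = 0` for the plain SOS model). -/
def gWeight (β : ℝ) (Λ : Finset Site) (ξ : Config) (K : Set ℤ) (F : Config → ℝ)
    (η : Config) : ℝ :=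
  if ∀ x ∈ Λ, η x ∈ K then Real.exp (-β * sosH Λ ξ η + F η) else 0

/-- The Gibbs probability of a set `A` of configurations: normalized sum of Gibbs
weights over all configurations agreeing with `ξ` off `Λ`. -/
def gProb (β : ℝ) (Λ : Finset Site) (ξ : Config) (K : Set ℤ) (F : Config → ℝ)
    (A : Set Config) : ℝ :=
  (∑' g : {x // x ∈ Λ} → ℤ, Set.indicator A (gWeight β Λ ξ K F) (extendC Λ ξ g))
    / ∑' g : {x // x ∈ Λ} → ℤ, gWeight β Λ ξ K F (extendC Λ ξ g)

/-- The box `Λ_L = {1,…,L}²`. -/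
def box (L : ℕ) : Finset Site := Finset.Icc ((1 : ℤ), (1 : ℤ)) ((L : ℤ), (L : ℤ))

/-- The equilibrium height `H(L) = ⌊log L / (4β)⌋`. -/
def eqHt (β : ℝ) (L : ℕ) : ℤ := ⌊Real.log L / (4 * β)⌋

/-- Heat-bath update probability at site `x` for new value `v`: the Gibbs conditional
probability of the value `v` at `x` given the heights at all other sites. -/
def heatBath (β : ℝ) (Λ : Finset Site) (ξ : Config) (K : Set ℤ) (F : Config → ℝ)
    (η : Config) (x : Site) (v : ℤ) : ℝ :=
  gWeight β Λ ξ K F (Function.update η x v)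
    / ∑' w : ℤ, gWeight β Λ ξ K F (Function.update η x w)

/-- One step of the Glauber (heat-bath) dynamics: pick a uniformly random site `x ∈ Λ`
and resample the height at `x` from the Gibbs conditional distribution. -/
def glauber (β : ℝ) (Λ : Finset Site) (ξ : Config) (K : Set ℤ) (F : Config → ℝ)
    (η σ : Config) : ℝ :=
  ((Λ.card : ℝ))⁻¹ *
    ∑ x ∈ Λ, (if σ = Function.update η x (σ x) then heatBath β Λ ξ K F η x (σ x) else 0)

/-- `t`-step transition probabilities of a Markov kernel `P`. -/
def chainLaw (P : Config → Config → ℝ) : ℕ → Config → Config → ℝ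
  | 0, η, σ => if σ = η then 1 else 0
  | (t + 1), η, σ => ∑' τ : Config, chainLaw P t η τ * P τ σ

/-- The law at time `t` of the chain started from `η`, evaluated on a set `A`. -/
def lawProb (P : Config → Config → ℝ) (t : ℕ) (η : Config) (A : Set Config) : ℝ :=
  ∑' σ : Config, Set.indicator A (chainLaw P t η) σ

/-- Total variation distance between two set functions. -/
def tvDist (μ ν : Set Config → ℝ) : ℝ := ⨆ A : Set Config, |μ A - ν A|

/-- The state space of the dynamics: configurations agreeing with `ξ` off `Λ` and
obeying the constraint `K` on `Λ`. -/
def stateSpace (Λ : Finset Site) (ξ : Config) (K : Set ℤ) : Set Config :=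
  {η | (∀ x ∈ Λ, η x ∈ K) ∧ ∀ x ∉ Λ, η x = ξ x}

/-- The mixing time of the Glauber dynamics: first time at which the total variation
distance to equilibrium is at most `1/(2e)`, uniformly in the initial configuration. -/
def mixingTime (β : ℝ) (Λ : Finset Site) (ξ : Config) (K : Set ℤ) (F : Config → ℝ) : ℕ :=
  sInf {t : ℕ | 0 < t ∧ ∀ η ∈ stateSpace Λ ξ K,
    tvDist (lawProb (glauber β Λ ξ K F) t η) (gProb β Λ ξ K F) ≤ (2 * Real.exp 1)⁻¹}

/-- Expectation with respect to the Gibbs measure. -/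
def gExp (β : ℝ) (Λ : Finset Site) (ξ : Config) (K : Set ℤ) (F : Config → ℝ)
    (f : Config → ℝ) : ℝ :=
  (∑' g : {x // x ∈ Λ} → ℤ, gWeight β Λ ξ K F (extendC Λ ξ g) * f (extendC Λ ξ g))
    / ∑' g : {x // x ∈ Λ} → ℤ, gWeight β Λ ξ K F (extendC Λ ξ g)

/-- Action of a Markov kernel on a function. -/
def applyK (P : Config → Config → ℝ) (f : Config → ℝ) (η : Config) : ℝ :=
  ∑' σ : Config, P η σ * f σ

/-- The Dirichlet form `π(f(I−P)f)` of the Glauber dynamics. -/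
def dirichlet (β : ℝ) (Λ : Finset Site) (ξ : Config) (K : Set ℤ) (F : Config → ℝ)
    (f : Config → ℝ) : ℝ :=
  gExp β Λ ξ K F (fun η => f η * (f η - applyK (glauber β Λ ξ K F) f η))

/-- The variance of `f` under the Gibbs measure. -/
def gVar (β : ℝ) (Λ : Finset Site) (ξ : Config) (K : Set ℤ) (F : Config → ℝ)
    (f : Config → ℝ) : ℝ :=
  gExp β Λ ξ K F (fun η => (f η - gExp β Λ ξ K F f) ^ 2)

/-- The spectral gap of the Glauber dynamics, via the variational characterization
`gap = inf_{f non-constant} π(f(I−P)f)/Var_π(f)`. -/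
def spectralGap (β : ℝ) (Λ : Finset Site) (ξ : Config) (K : Set ℤ) (F : Config → ℝ) : ℝ :=
  ⨅ f : {f : Config → ℝ //
      ¬ ∀ η ∈ stateSpace Λ ξ K, ∀ η' ∈ stateSpace Λ ξ K, f η = f η'},
    dirichlet β Λ ξ K F f.1 / gVar β Λ ξ K F f.1

/-- The relaxation time: inverse spectral gap. -/
def relaxTime (β : ℝ) (Λ : Finset Site) (ξ : Config) (K : Set ℤ) (F : Config → ℝ) : ℝ :=
  (spectralGap β Λ ξ K F)⁻¹

/-- The trajectory determined by the initial configuration `η₀` and the sequence of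
subsequent states `f`. -/
def trajOf (η₀ : Config) (f : ℕ → Config) : ℕ → Config
  | 0 => η₀
  | (t + 1) => f t

/-- The steps function obtained from finitely many steps, extended arbitrarily. -/
def extSteps (N : ℕ) (η₀ : Config) (f : Fin N → Config) : ℕ → Config :=
  fun t => if h : t < N then f ⟨t, h⟩ else η₀

/-- The probability that the trajectory of the chain started at `η₀` satisfies the
event `E` (an event depending only on the first `N` steps). -/
def pathProb (P : Config → Config → ℝ) (η₀ : Config) (N : ℕ)
    (E : (ℕ → Config) → Prop) : ℝ :=
  ∑' f : Fin N → Config,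
    if E (trajOf η₀ (extSteps N η₀ f)) then
      ∏ t ∈ Finset.range N,
        P (trajOf η₀ (extSteps N η₀ f) t) (trajOf η₀ (extSteps N η₀ f) (t + 1))
    else 0

/-- The set `Ω_a` of configurations having more than `(9/10)|Λ|` sites of height
at least `a·H(L)`. -/
def OmegaA (β : ℝ) (L : ℕ) (a : ℝ) : Set Config :=
  {η | (9 / 10 : ℝ) * ((box L).card : ℝ) <
        (((box L).filter (fun x => a * (eqHt β L : ℝ) ≤ (η x : ℝ))).card : ℝ)}

/-! basics -/
def nb (x : Site) (b : Bool) : Site := if b then (x.1, x.2 + 1) else (x.1 + 1, x.2)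
def eds (L : ℕ) : Finset (Site × Bool) :=
  (Finset.Icc ((0 : ℤ), (0 : ℤ)) ((L : ℤ), (L : ℤ))) ×ˢ Finset.univ
def en (L : ℕ) (η : Config) : ℤ := ∑ e ∈ eds L, |η e.1 - η (nb e.1 e.2)|
def w (β : ℝ) (L : ℕ) (η : Config) : ℝ := Real.exp (-β * (en L η : ℝ))
def St (V : Finset Site) (j n : ℤ) : Finset Config :=
  (Fintype.piFinset (fun _ : {x // x ∈ V} => Finset.Icc 0 n)).image (extendC V (fun _ => j))
def sw (β : ℝ) (L : ℕ) (T : Finset Config) : ℝ := ∑ η ∈ T, w β L η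
def bd (L : ℕ) (W : Finset Site) : Finset (Site × Bool) :=
  (eds L).filter (fun e => ¬ (e.1 ∈ W ↔ nb e.1 e.2 ∈ W))
def per (L : ℕ) (W : Finset Site) : ℕ := (bd L W).card

lemma mem_St {V : Finset Site} {j n : ℤ} {η : Config} :
    η ∈ St V j n ↔ (∀ x ∈ V, 0 ≤ η x ∧ η x ≤ n) ∧ ∀ x ∉ V, η x = j := by
  simp only [St, Finset.mem_image, Fintype.mem_piFinset, Finset.mem_Icc]
  constructor
  · rintro ⟨g, hg, rfl⟩
    refine ⟨fun x hx => ?_, fun x hx => ?_⟩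
    · simpa [extendC, hx] using hg ⟨x, hx⟩
    · simp [extendC, hx]
  · rintro ⟨h1, h2⟩
    refine ⟨fun x => η x, fun x => h1 x x.2, ?_⟩
    ext x
    by_cases hx : x ∈ V
    · simp [extendC, hx]
    · simp [extendC, hx, h2 x hx]

lemma w_pos (β : ℝ) (L : ℕ) (η : Config) : 0 < w β L η := Real.exp_pos _
lemma sw_nonneg (β : ℝ) (L : ℕ) (T : Finset Config) : 0 ≤ sw β L T :=
  Finset.sum_nonneg fun _ _ => (w_pos _ _ _).le
lemma sw_mono {β : ℝ} {L : ℕ} {T T' : Finset Config} (h : T ⊆ T') : sw β L T ≤ sw β L T' :=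
  Finset.sum_le_sum_of_subset_of_nonneg h fun _ _ _ => (w_pos _ _ _).le

lemma adj_iff {x y : Site} : SiteAdj x y ↔ ∃ b, y = nb x b ∨ x = nb y b := by
  obtain ⟨x1, x2⟩ := x; obtain ⟨y1, y2⟩ := y
  simp only [SiteAdj, nb, Bool.exists_bool]
  simp only [Bool.false_eq_true, if_false, if_true, Prod.mk.injEq]
  omega

lemma adj_nb (x : Site) (b : Bool) : SiteAdj x (nb x b) := adj_iff.2 ⟨b, Or.inl rfl⟩
lemma SiteAdj.symm {x y : Site} (h : SiteAdj x y) : SiteAdj y x := by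
  simp only [SiteAdj] at *; omega

lemma mem_box {L : ℕ} {x : Site} :
    x ∈ box L ↔ (1 ≤ x.1 ∧ 1 ≤ x.2) ∧ x.1 ≤ L ∧ x.2 ≤ L := by
  simp [box, Prod.le_def]
lemma mem_eds {L : ℕ} {e : Site × Bool} :
    e ∈ eds L ↔ (0 ≤ e.1.1 ∧ 0 ≤ e.1.2) ∧ e.1.1 ≤ L ∧ e.1.2 ≤ L := by
  simp [eds, Prod.le_def]
lemma mem_eds_of_box {L : ℕ} {x : Site} {b : Bool} (h : x ∈ box L ∨ nb x b ∈ box L) :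
    (x, b) ∈ eds L := by
  rw [mem_eds]; simp only [mem_box, nb] at h
  cases b <;> simp at h ⊢ <;> omega

lemma en_nonneg (L : ℕ) (η : Config) : 0 ≤ en L η := Finset.sum_nonneg fun _ _ => abs_nonneg _

lemma en_submod (L : ℕ) (a b : Config) : en L (a ⊓ b) + en L (a ⊔ b) ≤ en L a + en L b := by
  simp only [en, ← Finset.sum_add_distrib]
  refine Finset.sum_le_sum fun e _ => ?_
  simp only [Pi.inf_apply, Pi.sup_apply]
  generalize a e.1 = p; generalize b e.1 = q; generalize a (nb e.1 e.2) = r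
  generalize b (nb e.1 e.2) = s
  rcases le_total p q with h | h <;> rcases le_total r s with h' | h' <;>
  simp only [h, h', inf_of_le_left, inf_of_le_right, sup_of_le_left, sup_of_le_right] <;>
  simp only [abs_eq_max_neg] <;> omega

lemma w_mul_le {β : ℝ} (hβ : 0 ≤ β) {L : ℕ} {a b c d : Config} {k : ℤ}
    (h : en L c + en L d + k ≤ en L a + en L b) :
    w β L a * w β L b ≤ Real.exp (-β * k) * (w β L c * w β L d) := by
  simp only [w, ← Real.exp_add]
  apply Real.exp_le_exp.2
  have : ((en L c + en L d + k : ℤ) : ℝ) ≤ ((en L a + en L b : ℤ) : ℝ) := by exact_mod_cast h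
  push_cast at this
  nlinarith

lemma w_submod {β : ℝ} (hβ : 0 ≤ β) {L : ℕ} (a b : Config) :
    w β L a * w β L b ≤ w β L (a ⊓ b) * w β L (a ⊔ b) := by
  simpa using w_mul_le hβ (k := 0) (by simpa using en_submod L a b)

/-- Holley / FKG -/
lemma dom {β : ℝ} (hβ : 0 ≤ β) {L : ℕ} {S1 S2 : Finset Config} {f : Config → ℝ}
    (hi : ∀ a ∈ S1, ∀ b ∈ S2, a ⊓ b ∈ S1 ∧ a ⊔ b ∈ S2) (hf : ∀ a, 0 ≤ f a)
    (hm : ∀ a ∈ S1, ∀ b ∈ S2, a ≤ b → f a ≤ f b) :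
    (∑ η ∈ S1, w β L η * f η) * sw β L S2 ≤ sw β L S1 * ∑ η ∈ S2, w β L η * f η := by
  have hw := fun η => (w_pos β L η).le
  have key := four_functions_theorem (α := Config) (β := ℝ)
    (fun η => if η ∈ S1 then w β L η * f η else 0) (fun η => if η ∈ S2 then w β L η else 0)
    (fun η => if η ∈ S1 then w β L η else 0) (fun η => if η ∈ S2 then w β L η * f η else 0)
    (fun η => by dsimp; split_ifs <;> [exact mul_nonneg (hw _) (hf _); exact le_rfl])
    (fun η => by dsimp; split_ifs <;> [exact hw _; exact le_rfl])
    (fun η => by dsimp; split_ifs <;> [exact hw _; exact le_rfl])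
    (fun η => by dsimp; split_ifs <;> [exact mul_nonneg (hw _) (hf _); exact le_rfl])
    (fun a b => by
      by_cases h1 : a ∈ S1 <;> by_cases h2 : b ∈ S2
      · obtain ⟨h3, h4⟩ := hi a h1 b h2
        simp only [h1, h2, h3, h4, if_true]
        have h5 : f a ≤ f (a ⊔ b) := hm a h1 _ h4 le_sup_left
        calc w β L a * f a * w β L b = (w β L a * w β L b) * f a := by ring
          _ ≤ (w β L (a ⊓ b) * w β L (a ⊔ b)) * f (a ⊔ b) :=
            mul_le_mul (w_submod hβ a b) h5 (hf a) (mul_nonneg (hw _) (hw _))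
          _ = _ := by ring
      all_goals
        simp only [h1, h2, if_true, if_false, zero_mul, mul_zero]
        refine mul_nonneg ?_ ?_ <;> split_ifs <;>
        first | exact le_rfl | exact hw _ | exact mul_nonneg (hw _) (hf _))
    S1 S2
  have e1 : ∀ (S T : Finset Config) (g : Config → ℝ), (∀ η, 0 ≤ g η) →
      ∑ η ∈ T, (if η ∈ S then g η else 0) ≤ ∑ η ∈ S, g η := fun S T g hg => by
    rw [← Finset.sum_filter]
    exact Finset.sum_le_sum_of_subset_of_nonneg
      (fun x hx => (Finset.mem_filter.1 hx).2) (fun _ _ _ => hg _)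
  have e2 : ∀ (S : Finset Config) (g : Config → ℝ),
      ∑ η ∈ S, (if η ∈ S then g η else 0) = ∑ η ∈ S, g η := fun S g =>
    Finset.sum_congr rfl fun x hx => by simp [hx]
  rw [e2, e2] at key
  refine key.trans (mul_le_mul (e1 _ _ _ hw) (e1 _ _ (fun η => w β L η * f η)
    (fun η => mul_nonneg (hw _) (hf _))) ?_ (sw_nonneg _ _ _))
  exact Finset.sum_nonneg fun η _ => by
    split_ifs <;> [exact mul_nonneg (hw _) (hf _); exact le_rfl]

lemma sum_inj_le {α γ : Type*} {s : Finset α} {t : Finset γ} (i : α → γ)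
    (hi : ∀ a ∈ s, i a ∈ t) (hinj : Set.InjOn i s) {f : α → ℝ} {g : γ → ℝ}
    (hfg : ∀ a ∈ s, f a ≤ g (i a)) (hg : ∀ b ∈ t, 0 ≤ g b) : ∑ a ∈ s, f a ≤ ∑ b ∈ t, g b := by
  calc _ ≤ ∑ a ∈ s, g (i a) := Finset.sum_le_sum hfg
    _ = ∑ b ∈ s.image i, g b := (Finset.sum_image hinj).symm
    _ ≤ _ := Finset.sum_le_sum_of_subset_of_nonneg
      (Finset.image_subset_iff.2 hi) fun b hb _ => hg b hb

def glue (W : Finset Site) (g η : Config) : Config := fun x => if x ∈ W then g x else η x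

lemma swap {β : ℝ} (hβ : 0 ≤ β) {L : ℕ} {W : Finset Site} {p q n : ℤ} {D D' B : Finset Config}
    {u : Config → ℝ} {C : ℝ} (hu0 : ∀ η, 0 ≤ u η)
    (hE : ∀ η ∈ D, ∀ x y, SiteAdj x y → x ∈ W → y ∉ W → ∀ v : ℤ,
      |η x - p| + |v - η y| + 1 ≤ |η x - η y| + |v - q|)
    (hB : ∀ η ∈ D, glue W η (fun _ => p) ∈ B)
    (hG : ∀ η ∈ D, ∀ g ∈ St W q n, glue W g η ∈ D')
    (hu : ∀ η ∈ D, ∀ g ∈ St W q n, u η ≤ C * u (glue W g η)) (hC : 0 ≤ C) :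
    (∑ η ∈ D, w β L η * u η) * sw β L (St W q n) ≤
      Real.exp (-β * per L W) * sw β L B * (C * ∑ η ∈ D', w β L η * u η) := by
  have hen : ∀ η ∈ D, ∀ g ∈ St W q n,
      en L (glue W η (fun _ => p)) + en L (glue W g η) + (per L W : ℤ) ≤ en L η + en L g := by
    intro η hη g hg
    have : (per L W : ℤ) =
        ∑ e ∈ eds L, if ¬ (e.1 ∈ W ↔ nb e.1 e.2 ∈ W) then 1 else 0 := by
      rw [per, bd, Finset.card_filter]; push_cast; rfl
    rw [this]
    simp only [en, ← Finset.sum_add_distrib]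
    refine Finset.sum_le_sum fun e _ => ?_
    have hgo := (mem_St.1 hg).2
    have ha := adj_nb e.1 e.2
    by_cases h1 : e.1 ∈ W <;> by_cases h2 : nb e.1 e.2 ∈ W <;> simp only [glue, h1, h2] <;> simp
    · have := hE η hη _ _ ha h1 h2 (g e.1)
      rw [hgo _ h2]; linarith
    · have := hE η hη _ _ ha.symm h2 h1 (g (nb e.1 e.2))
      rw [hgo _ h1, abs_sub_comm p, abs_sub_comm (η e.1) (g _), abs_sub_comm (η e.1) (η _),
        abs_sub_comm q]; linarith
  calc _ = ∑ z ∈ D ×ˢ St W q n, (w β L z.1 * u z.1) * w β L z.2 := by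
        rw [sw, Finset.sum_mul_sum, Finset.sum_product]
    _ ≤ ∑ z ∈ B ×ˢ D', (Real.exp (-β * per L W) * w β L z.1) * (C * (w β L z.2 * u z.2)) := by
        refine sum_inj_le (fun z => (glue W z.1 (fun _ => p), glue W z.2 z.1)) ?_ ?_ ?_ ?_
        · rintro ⟨η, g⟩ h
          rw [Finset.mem_product] at h ⊢
          exact ⟨hB _ h.1, hG _ h.1 _ h.2⟩
        · rintro ⟨η, g⟩ h ⟨η', g'⟩ h' heq
          rw [Finset.mem_coe, Finset.mem_product] at h h'
          simp only [Prod.mk.injEq] at heq ⊢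
          constructor <;> funext x
          · by_cases hx : x ∈ W
            · simpa [glue, hx] using congrFun heq.1 x
            · simpa [glue, hx] using congrFun heq.2 x
          · by_cases hx : x ∈ W
            · simpa [glue, hx] using congrFun heq.2 x
            · exact ((mem_St.1 h.2).2 x hx).trans ((mem_St.1 h'.2).2 x hx).symm
        · rintro ⟨η, g⟩ h
          rw [Finset.mem_product] at h
          have h1 := w_mul_le hβ (hen η h.1 g h.2)
          have h2 := hu η h.1 g h.2
          calc w β L η * u η * w β L g = (w β L η * w β L g) * u η := by ring
            _ ≤ _ := mul_le_mul h1 h2 (hu0 _) (mul_nonneg (Real.exp_pos _).le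
              (mul_nonneg (w_pos _ _ _).le (w_pos _ _ _).le))
            _ = _ := by push_cast; ring
        · intro z _
          have h1 := (w_pos β L z.1).le
          have h2 := (w_pos β L z.2).le
          have h3 := hu0 z.2
          positivity
    _ = _ := by
        rw [Finset.sum_product, sw, Finset.mul_sum, Finset.mul_sum, Finset.sum_mul_sum]

lemma one_le_sw {β : ℝ} {L : ℕ} {V : Finset Site} {j n : ℤ} (h0 : 0 ≤ j) (h1 : j ≤ n) :
    1 ≤ sw β L (St V j n) := by
  have h : (fun _ => j : Config) ∈ St V j n := mem_St.2 ⟨fun _ _ => ⟨h0, h1⟩, fun _ _ => rfl⟩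
  have := Finset.single_le_sum (f := w β L) (fun η _ => (w_pos β L η).le) h
  simpa [w, en, sw] using this

/-! topology -/
def Reach (A : Set Site) : Site → Site → Prop :=
  Relation.ReflTransGen (fun a b => SiteAdj a b ∧ a ∈ A ∧ b ∈ A)
def IsConn (A : Set Site) : Prop := ∀ x ∈ A, ∀ y ∈ A, Reach A x y
structure Cc (L : ℕ) (W : Finset Site) : Prop where
  sub : W ⊆ box L
  ne : W.Nonempty
  c1 : IsConn (W : Set Site)
  c2 : IsConn ((W : Set Site)ᶜ)

lemma Reach.mono {A B : Set Site} (h : A ⊆ B) {x y : Site} (r : Reach A x y) : Reach B x y :=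
  Relation.ReflTransGen.mono (fun _ _ h' => ⟨h'.1, h h'.2.1, h h'.2.2⟩) _ _ r
lemma Reach.symm {A : Set Site} {x y : Site} (r : Reach A x y) : Reach A y x := by
  induction r with
  | refl => exact Relation.ReflTransGen.refl
  | tail _ h ih => exact Relation.ReflTransGen.head ⟨h.1.symm, h.2.2, h.2.1⟩ ih
lemma Reach.trans {A : Set Site} {x y z : Site} (r : Reach A x y) (s : Reach A y z) :
    Reach A x z := Relation.ReflTransGen.trans r s
lemma Reach.one {A : Set Site} {x y : Site} (h : SiteAdj x y) (hx : x ∈ A) (hy : y ∈ A) :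
    Reach A x y := Relation.ReflTransGen.single ⟨h, hx, hy⟩
lemma Reach.mem {A : Set Site} {x y : Site} (r : Reach A x y) (hx : x ∈ A) : y ∈ A := by
  induction r with
  | refl => exact hx
  | tail _ h _ => exact h.2.2
/-- a reachable set is itself connected -/
lemma Reach.self {A : Set Site} {x y : Site} (r : Reach A x y) : Reach {z | Reach A x z} x y := by
  induction r with
  | refl => exact Relation.ReflTransGen.refl
  | tail h h' ih => exact ih.trans (Reach.one h'.1 h (h.tail h'))
lemma isConn_reach (A : Set Site) (x : Site) : IsConn {z | Reach A x z} :=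
  fun _ hy _ hz => (Reach.self hy).symm.trans (Reach.self hz)
lemma reach_const {A : Set Site} {x y : Site} (r : Reach A x y) {P : Site → Prop}
    (h : ∀ a b, SiteAdj a b → a ∈ A → b ∈ A → P a → P b) (hx : P x) : P y := by
  induction r with
  | refl => exact hx
  | tail _ h' ih => exact h _ _ h'.1 h'.2.1 h'.2.2 ih

lemma ctr {L : ℕ} {V : Finset Site} (hV : Cc L V) {A : Set Site} (hA : A ⊆ V) {x : Site}
    (hx : x ∈ A) : ∃ W, Cc L W ∧ x ∈ W ∧ W ⊆ V ∧
      (∀ y z, SiteAdj y z → y ∈ W → z ∉ W → y ∈ A ∧ z ∉ A) ∧ ∀ y, Reach A x y → y ∈ W := by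
  set o : Site := (0, 0)
  have ho : o ∉ V := fun h => by have := mem_box.1 (hV.sub h); simp [o] at this
  have hoA : o ∈ Aᶜ := fun h => ho (hA h)
  set R : Set Site := {y | Reach Aᶜ o y}
  have hRA : ∀ y ∈ R, y ∉ A := fun y hy => Reach.mem hy hoA
  have hVR : ∀ y, y ∉ V → y ∈ R := fun y hy =>
    Reach.mono (A := (V : Set Site)ᶜ) (fun z hz h => hz (hA h)) (hV.c2 o (by simpa using ho) y (by simpa using hy))
  set F : Set Site := Rᶜ
  have hFV : ∀ y ∈ F, y ∈ V := fun y hy => by_contra fun h => hy (hVR y h)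
  have hAF : A ⊆ F := fun y hy h => hRA y h hy
  set W : Finset Site := V.filter (fun y => Reach F x y)
  have hW : ∀ y, y ∈ W ↔ Reach F x y := fun y => by
    simp only [W, Finset.mem_filter, and_iff_right_iff_imp]
    exact fun h => hFV y (h.mem (hAF hx))
  have hWs : (W : Set Site) = {y | Reach F x y} := by ext y; simp [hW]
  have hWF : ∀ y ∈ W, y ∈ F := fun y hy => ((hW y).1 hy).mem (hAF hx)
  have hb : ∀ y z, SiteAdj y z → y ∈ W → z ∉ F → y ∈ A := fun y z h hy hz => by
    by_contra hyA
    have hz' : z ∈ R := by simpa [F] using hz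
    exact hWF y hy (Reach.trans hz' (Reach.one h.symm (hRA z hz') hyA))
  have hout : ∀ y z, SiteAdj y z → y ∈ W → z ∉ W → z ∉ F := fun y z h hy hz hzF =>
    hz ((hW z).2 (((hW y).1 hy).trans (Reach.one h (hWF y hy) hzF)))
  have hWV : W ⊆ V := Finset.filter_subset _ _
  have hxW : x ∈ W := (hW x).2 Relation.ReflTransGen.refl
  have hRW : ∀ z ∈ R, Reach (W : Set Site)ᶜ o z := fun z hz => by
    refine Reach.mono ?_ (Reach.self hz)
    intro y hy hyW
    exact hWF y hyW hy
  have hc : ∀ (n : ℕ) (z : Site), (L + 1 - z.1).toNat = n → z ∉ W → Reach (W : Set Site)ᶜ o z := by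
    intro n
    induction n with
    | zero =>
      intro z hz hzW
      refine hRW z (hVR z fun h => ?_)
      have := mem_box.1 (hV.sub h)
      omega
    | succ n ih =>
      intro z hz hzW
      by_cases hzR : z ∈ R
      · exact hRW z hzR
      have hadj := adj_nb z false
      have h1 : nb z false ∉ W := fun h => hout _ _ hadj.symm h hzW hzR
      refine (ih _ ?_ h1).trans (Reach.one hadj.symm h1 hzW)
      simp only [nb]; simp; omega
  refine ⟨W, ⟨hWV.trans hV.sub, ⟨x, hxW⟩, hWs ▸ isConn_reach F x, fun y hy z hz => ?_⟩, hxW, hWV,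
    fun y z h hy hz => ⟨hb y z h hy (hout y z h hy hz), fun hzA => hout y z h hy hz (hAF hzA)⟩,
    fun y hy => (hW y).2 (hy.mono hAF)⟩
  exact (hc _ y rfl hy).symm.trans (hc _ z rfl hz)

/-! rectangles -/
lemma reach_line {A : Set Site} {p : ℤ → Site} (hp : ∀ k, SiteAdj (p k) (p (k + 1))) {a b : ℤ}
    (h : ∀ k, min a b ≤ k → k ≤ max a b → p k ∈ A) : Reach A (p a) (p b) := by
  have key : ∀ (n : ℕ) (a : ℤ), (∀ k, a ≤ k → k ≤ a + n → p k ∈ A) → Reach A (p a) (p (a + n)) := by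
    intro n
    induction n with
    | zero => intro a _; simp only [Nat.cast_zero, add_zero]; exact Relation.ReflTransGen.refl
    | succ n ih =>
      intro a h
      refine (ih a fun k h1 h2 => h k h1 (by push_cast; omega)).trans ?_
      have := Reach.one (hp (a + n)) (h _ (by omega) (by push_cast; omega)) (h _ (by omega) (by push_cast; omega))
      simpa [add_assoc] using this
  rcases le_total a b with hab | hab
  · have := key (b - a).toNat a fun k h1 h2 => h k (by omega) (by omega)
    rwa [Int.toNat_of_nonneg (by omega), add_sub_cancel] at this
  · have := key (a - b).toNat b fun k h1 h2 => h k (by omega) (by omega)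
    rw [Int.toNat_of_nonneg (by omega), add_sub_cancel] at this
    exact this.symm

lemma adj_h (y k : ℤ) : SiteAdj (k, y) (k + 1, y) := by simp [SiteAdj]
lemma adj_v (y k : ℤ) : SiteAdj (y, k) (y, k + 1) := by simp [SiteAdj]

def rect (a1 a2 b1 b2 : ℤ) : Finset Site := Finset.Icc a1 a2 ×ˢ Finset.Icc b1 b2
lemma mem_rect {a1 a2 b1 b2 : ℤ} {x : Site} :
    x ∈ rect a1 a2 b1 b2 ↔ (a1 ≤ x.1 ∧ x.1 ≤ a2) ∧ b1 ≤ x.2 ∧ x.2 ≤ b2 := by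
  simp [rect]

lemma cc_rect {L : ℕ} {a1 a2 b1 b2 : ℤ} (h1 : 1 ≤ a1) (h2 : a1 ≤ a2) (h3 : a2 ≤ L) (h4 : 1 ≤ b1)
    (h5 : b1 ≤ b2) (h6 : b2 ≤ L) : Cc L (rect a1 a2 b1 b2) := by
  have hR := fun (x : Site) => mem_rect (a1 := a1) (a2 := a2) (b1 := b1) (b2 := b2) (x := x)
  refine ⟨fun x hx => ?_, ⟨(a1, b1), by rw [hR]; simp; omega⟩, fun x hx y hy => ?_, ?_⟩
  · rw [hR] at hx; rw [mem_box]; omega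
  · have hx' := (hR x).1 hx; have hy' := (hR y).1 hy
    have r1 := reach_line (A := (rect a1 a2 b1 b2 : Set Site)) (p := fun k => (k, x.2)) (adj_h x.2)
      (a := x.1) (b := y.1) fun k _ _ => by simp only [Finset.mem_coe, hR]; omega
    have r2 := reach_line (A := (rect a1 a2 b1 b2 : Set Site)) (p := fun k => (y.1, k)) (adj_v y.1)
      (a := x.2) (b := y.2) fun k _ _ => by simp only [Finset.mem_coe, hR]; omega
    exact r1.trans r2
  · have key : ∀ z, z ∉ rect a1 a2 b1 b2 → Reach (rect a1 a2 b1 b2 : Set Site)ᶜ z (a2 + 1, b2 + 1) := by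
      intro z hz
      rw [hR] at hz
      by_cases hc : z.1 < a1 ∨ a2 < z.1
      · have r1 := reach_line (A := (rect a1 a2 b1 b2 : Set Site)ᶜ) (p := fun k => (z.1, k))
          (adj_v z.1) (a := z.2) (b := b2 + 1) fun k _ _ => by
            simp only [Set.mem_compl_iff, Finset.mem_coe, hR]; omega
        have r2 := reach_line (A := (rect a1 a2 b1 b2 : Set Site)ᶜ) (p := fun k => (k, b2 + 1))
          (adj_h _) (a := z.1) (b := a2 + 1) fun k _ _ => by
            simp only [Set.mem_compl_iff, Finset.mem_coe, hR]; omega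
        exact r1.trans r2
      · have r1 := reach_line (A := (rect a1 a2 b1 b2 : Set Site)ᶜ) (p := fun k => (k, z.2))
          (adj_h z.2) (a := z.1) (b := a2 + 1) fun k _ _ => by
            simp only [Set.mem_compl_iff, Finset.mem_coe, hR]; omega
        have r2 := reach_line (A := (rect a1 a2 b1 b2 : Set Site)ᶜ) (p := fun k => (a2 + 1, k))
          (adj_v _) (a := z.2) (b := b2 + 1) fun k _ _ => by
            simp only [Set.mem_compl_iff, Finset.mem_coe, hR]; omega
        exact r1.trans r2
    exact fun x hx y hy => (key x hx).trans (key y hy).symm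

lemma card_rect {a1 a2 b1 b2 : ℤ} : (rect a1 a2 b1 b2).card = (a2 + 1 - a1).toNat * (b2 + 1 - b1).toNat := by
  simp [rect]

lemma per_rect_le {L : ℕ} {a1 a2 b1 b2 : ℤ} :
    per L (rect a1 a2 b1 b2) ≤ 2 * (a2 + 1 - a1).toNat + 2 * (b2 + 1 - b1).toNat := by
  have : bd L (rect a1 a2 b1 b2) ⊆ ((({a1 - 1, a2} : Finset ℤ) ×ˢ Finset.Icc b1 b2) ×ˢ {false}) ∪
      ((Finset.Icc a1 a2 ×ˢ ({b1 - 1, b2} : Finset ℤ)) ×ˢ {true}) := by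
    rintro ⟨x, b⟩ he
    simp only [bd, Finset.mem_filter, mem_rect] at he
    cases b <;> simp [nb] at he ⊢ <;> omega
  refine (Finset.card_le_card this).trans ((Finset.card_union_le _ _).trans ?_)
  simp only [Finset.card_product, Finset.card_singleton, Int.card_Icc, mul_one]
  have c2 : ∀ a b : ℤ, ({a, b} : Finset ℤ).card ≤ 2 := fun a b => Finset.card_le_two
  nlinarith [c2 (a1 - 1) a2, c2 (b1 - 1) b2, Nat.zero_le (a2 + 1 - a1).toNat, Nat.zero_le (b2 + 1 - b1).toNat]

/-! perimeter -/
def cols (W : Finset Site) : Finset ℤ := W.image Prod.fst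
def rows (W : Finset Site) : Finset ℤ := W.image Prod.snd

lemma exists_top (W : Finset Site) (b : Bool) {x : Site} (hx : x ∈ W) :
    (∃ y ∈ W, nb y b ∉ W ∧ (if b then y.1 = x.1 else y.2 = x.2)) ∧
    ∃ y, y ∉ W ∧ nb y b ∈ W ∧ (if b then y.1 = x.1 else y.2 = x.2) := by
  set T := W.filter (fun y => if b then y.1 = x.1 else y.2 = x.2)
  have hT : T.Nonempty := ⟨x, by simp [T, hx]⟩
  obtain ⟨y, hy, hmax⟩ := T.exists_max_image (fun y => y.1 + y.2) hT
  obtain ⟨z, hz, hmin⟩ := T.exists_min_image (fun y => y.1 + y.2) hT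
  simp only [T, Finset.mem_filter] at hy hz hmax hmin
  refine ⟨⟨y, hy.1, fun h => ?_, hy.2⟩, ⟨if b then (z.1, z.2 - 1) else (z.1 - 1, z.2), fun h => ?_, ?_, ?_⟩⟩
  · have := hmax _ ⟨h, by cases b <;> simp_all [nb]⟩
    cases b <;> simp [nb] at this
  · have := hmin _ ⟨h, by cases b <;> simp_all⟩
    cases b <;> simp at this
  · cases b <;> simp [nb, hz.1]
  · cases b <;> simp_all

lemma per_ge {L : ℕ} {W : Finset Site} (hW : W ⊆ box L) :
    2 * (cols W).card + 2 * (rows W).card ≤ per L W := by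
  have h0 : ∀ (i : Bool) (b : Bool), (if b then cols W else rows W).card ≤
      ((bd L W).filter (fun e => e.2 = b ∧ (e.1 ∈ W ↔ i = true))).card := by
    intro i b
    refine (Finset.card_le_card ?_).trans (Finset.card_image_le (f := fun e => if b then e.1.1 else e.1.2))
    intro c hc
    have : ∃ x ∈ W, (if b then x.1 else x.2) = c := by
      cases b <;> simpa [cols, rows, -Prod.exists] using hc
    obtain ⟨x, hx, rfl⟩ := this
    obtain ⟨⟨y, hy, hy', hyx⟩, ⟨z, hz, hz', hzx⟩⟩ := exists_top W b hx
    rw [Finset.mem_image]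
    cases i
    · refine ⟨(z, b), ?_, by cases b <;> simpa using hzx⟩
      simp only [bd, Finset.mem_filter]
      exact ⟨⟨mem_eds_of_box (Or.inr (hW hz')), by simp [hz, hz']⟩, by trivial, by simp [hz]⟩
    · refine ⟨(y, b), ?_, by cases b <;> simpa using hyx⟩
      simp only [bd, Finset.mem_filter]
      exact ⟨⟨mem_eds_of_box (Or.inl (hW hy)), by simp [hy, hy']⟩, by trivial, by simp [hy]⟩
  have h1 : per L W = ∑ z : Bool × Bool,
      ((bd L W).filter (fun e => e.2 = z.2 ∧ (e.1 ∈ W ↔ z.1 = true))).card := by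
    rw [per, Finset.card_eq_sum_card_fiberwise (f := fun e => (decide (e.1 ∈ W), e.2))
      (t := Finset.univ) (fun _ _ => Finset.mem_coe.2 (Finset.mem_univ _))]
    refine Finset.sum_congr rfl fun z _ => ?_
    congr 1
    ext e
    simp only [Finset.mem_filter, Prod.ext_iff]
    rcases z with ⟨i, b⟩
    cases i <;> simp <;> tauto
  rw [h1, Fintype.sum_prod_type]
  simp only [Fintype.sum_bool]
  have a1 := h0 true true; have a2 := h0 true false; have a3 := h0 false true; have a4 := h0 false false
  simp only [if_true, Bool.false_eq_true, if_false] at a1 a2 a3 a4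
  simp only [Bool.false_eq_true] at *
  linarith

lemma card_le_cols_rows (W : Finset Site) : W.card ≤ (cols W).card * (rows W).card := by
  rw [← Finset.card_product]
  exact Finset.card_le_card fun x hx => Finset.mem_product.2
    ⟨Finset.mem_image_of_mem _ hx, Finset.mem_image_of_mem _ hx⟩

lemma two_card_le {L : ℕ} {W : Finset Site} (hW : W ⊆ box L) {l : ℕ} (hl : (cols W).card ≤ l) :
    2 * W.card ≤ l * per L W := by
  have h1 := per_ge hW
  have h2 := card_le_cols_rows W
  calc 2 * W.card ≤ 2 * ((cols W).card * (rows W).card) := by omega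
    _ ≤ 2 * (l * (rows W).card) := by gcongr
    _ = l * (2 * (rows W).card) := by ring
    _ ≤ l * per L W := by gcongr; omega

lemma per_ge_six {L : ℕ} {W : Finset Site} (hW : W ⊆ box L) {x : Site} (hx : x ∈ W) (h : W ≠ {x}) :
    6 ≤ per L W := by
  have h1 := per_ge hW
  have h3 : 0 < (cols W).card := Finset.card_pos.2 ⟨_, Finset.mem_image_of_mem _ hx⟩
  have h4 : 0 < (rows W).card := Finset.card_pos.2 ⟨_, Finset.mem_image_of_mem _ hx⟩
  by_contra hc
  have h5 : (cols W).card = 1 := by omega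
  have h6 : (rows W).card = 1 := by omega
  have h2 := card_le_cols_rows W
  rw [h5, h6] at h2
  exact h (Finset.eq_singleton_iff_unique_mem.2 ⟨hx, fun y hy =>
    Finset.card_le_one.1 (by omega) y hy x hx⟩)

lemma per_ge_four {L : ℕ} {W : Finset Site} (hW : Cc L W) : 4 ≤ per L W := by
  obtain ⟨x, hx⟩ := hW.ne
  have h1 := per_ge hW.sub
  have h3 : 0 < (cols W).card := Finset.card_pos.2 ⟨_, Finset.mem_image_of_mem _ hx⟩
  have h4 : 0 < (rows W).card := Finset.card_pos.2 ⟨_, Finset.mem_image_of_mem _ hx⟩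
  omega

/-! boundary connectivity and counting -/
lemma parity {L : ℕ} {g : Site × Bool → ZMod 2}
    (hp : ∀ x : Site, g (x, false) + g (nb x false, true) + g (nb x true, false) + g (x, true) = 0)
    (h0 : ∀ e, (L : ℤ) < e.1.1 → g e = 0) :
    ∃ U : Site → ZMod 2, (∀ x b, g (x, b) = U x + U (nb x b)) ∧ ∀ x : Site, (L : ℤ) < x.1 → U x = 0 := by
  have two : ∀ a : ZMod 2, a + a = 0 := by decide
  set U : Site → ZMod 2 := fun x => ∑ k ∈ Finset.Icc x.1 (L : ℤ), g ((k, x.2), false)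
  have hU0 : ∀ x : Site, (L : ℤ) < x.1 → U x = 0 := fun x hx => by
    simp only [U]; rw [Finset.Icc_eq_empty (by omega)]; rfl
  have hs : ∀ x : Site, U x = g (x, false) + U (nb x false) := fun x => by
    rcases lt_or_ge (L : ℤ) x.1 with h | h
    · rw [hU0 x h, hU0 (nb x false) (by simp [nb]; omega), h0 _ h, add_zero]
    · simp only [U, nb]
      have : Finset.Icc x.1 (L : ℤ) = insert x.1 (Finset.Icc (x.1 + 1) L) := by
        ext k; simp; omega
      rw [this, Finset.sum_insert (by simp)]; simp
  have hv : ∀ (n : ℕ) (x : Site), (L + 1 - x.1).toNat = n → g (x, true) = U x + U (nb x true) := by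
    intro n
    induction n with
    | zero =>
      intro x hx
      rw [hU0 x (by omega), hU0 (nb x true) (by simp [nb]; omega), h0 _ (by simp; omega), add_zero]
    | succ n ih =>
      intro x hx
      have h1 := ih (nb x false) (by simp [nb]; omega)
      have h2 := hs x
      have h3 := hs (nb x true)
      have h4 := hp x
      have h5 : nb (nb x true) false = nb (nb x false) true := by simp [nb]
      rw [h2, h3, h5]
      rw [h1] at h4
      generalize g (x, false) = a at *; generalize g (nb x true, false) = b at *
      generalize g (x, true) = c at *; generalize U (nb x false) = d at *
      generalize U (nb (nb x false) true) = e at *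
      clear * - h4
      revert a b c d e; decide
  refine ⟨U, fun x b => ?_, hU0⟩
  cases b
  · rw [hs x, add_assoc, two, add_zero]
  · exact hv _ x rfl

def mid (e : Site × Bool) : Site := if e.2 then (2 * e.1.1, 2 * e.1.2 + 1) else (2 * e.1.1 + 1, 2 * e.1.2)
lemma mid_inj : Function.Injective mid := by
  rintro ⟨⟨a, b⟩, i⟩ ⟨⟨c, d⟩, j⟩ h
  cases i <;> cases j <;> simp [mid] at h ⊢ <;> omega
def Dm : Finset Site := Finset.Icc (-2, -2) (2, 2)

lemma mem_bd {L : ℕ} {W : Finset Site} (hW : W ⊆ box L) {x : Site} {b : Bool} :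
    (x, b) ∈ bd L W ↔ ¬ (x ∈ W ↔ nb x b ∈ W) := by
  simp only [bd, Finset.mem_filter, and_iff_right_iff_imp]
  intro h
  apply mem_eds_of_box
  by_contra hc
  push Not at hc
  exact h ⟨fun h => (hc.1 (hW h)).elim, fun h => (hc.2 (hW h)).elim⟩

lemma plaq (x : Site) (e : Site × Bool) (he : e = (x, false) ∨ e = (nb x false, true) ∨
    e = (nb x true, false) ∨ e = (x, true)) :
    ∃ c : Site, c = x ∧ (2 * c.1 ≤ (mid e).1 ∧ (mid e).1 ≤ 2 * c.1 + 2) ∧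
      2 * c.2 ≤ (mid e).2 ∧ (mid e).2 ≤ 2 * c.2 + 2 := by
  refine ⟨x, rfl, ?_⟩
  rcases he with rfl | rfl | rfl | rfl <;> simp [mid, nb] <;> omega
lemma plaq_near {x : Site} {e e' : Site × Bool}
    (h : ∃ c : Site, c = x ∧ (2 * c.1 ≤ (mid e).1 ∧ (mid e).1 ≤ 2 * c.1 + 2) ∧
      2 * c.2 ≤ (mid e).2 ∧ (mid e).2 ≤ 2 * c.2 + 2)
    (h' : ∃ c : Site, c = x ∧ (2 * c.1 ≤ (mid e').1 ∧ (mid e').1 ≤ 2 * c.1 + 2) ∧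
      2 * c.2 ≤ (mid e').2 ∧ (mid e').2 ≤ 2 * c.2 + 2) : mid e' - mid e ∈ Dm := by
  obtain ⟨c, rfl, h⟩ := h
  obtain ⟨c, rfl, h'⟩ := h'
  simp only [Dm, Finset.mem_Icc, Prod.le_def, Prod.fst_sub, Prod.snd_sub]
  omega

lemma bd_conn {L : ℕ} {W : Finset Site} (hW : Cc L W) {γ : Finset (Site × Bool)} (hγ : γ ⊆ bd L W)
    (hne : γ.Nonempty) (hcl : ∀ e ∈ γ, ∀ e' ∈ bd L W, mid e' - mid e ∈ Dm → e' ∈ γ) : γ = bd L W := by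
  set f : Site → ZMod 2 := fun x => if x ∈ W then 1 else 0
  set g : Site × Bool → ZMod 2 := fun e => if e ∈ γ then 1 else 0
  have hbd := fun x b => mem_bd hW.sub (x := x) (b := b)
  have hg : ∀ x b, g (x, b) = 0 ∨ g (x, b) = f x + f (nb x b) := fun x b => by
    by_cases h : (x, b) ∈ γ
    · right
      have := (hbd x b).1 (hγ h)
      simp only [g, f, h, if_true]
      by_cases h1 : x ∈ W <;> by_cases h2 : nb x b ∈ W <;> simp [h1, h2] at this ⊢
    · left; simp [g, h]
  have hP : ∀ x b y b', (x, b) ∈ γ → mid (y, b') - mid (x, b) ∈ Dm → g (y, b') = f y + f (nb y b') := by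
    intro x b y b' h hm
    rcases hg y b' with h1 | h1
    · have h2 : (y, b') ∉ γ := fun h => by simp [g, h] at h1
      have h3 : (y, b') ∉ bd L W := fun h3 => h2 (hcl _ h _ h3 hm)
      rw [hbd, not_not] at h3
      rw [h1]; simp only [f]
      by_cases h4 : y ∈ W
      · simp [h4, h3.1 h4]; decide
      · have h5 : nb y b' ∉ W := fun h => h4 (h3.2 h)
        simp [h4, h5]
    · exact h1
  have four : ∀ a b c d : ZMod 2, (a + b) + (b + d) + (c + d) + (a + c) = 0 := by decide
  obtain ⟨U, hU, hU0⟩ := parity (L := L) (g := g) (fun x => by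
    have hx : nb (nb x false) true = nb (nb x true) false := by simp [nb]
    by_cases hex : (x, false) ∈ γ ∨ (nb x false, true) ∈ γ ∨ (nb x true, false) ∈ γ ∨ (x, true) ∈ γ
    · have : ∀ y b', (y, b') = (x, false) ∨ (y, b') = (nb x false, true) ∨
          (y, b') = (nb x true, false) ∨ (y, b') = (x, true) → g (y, b') = f y + f (nb y b') := by
        intro y b' hy
        have hy2 := plaq x (y, b') hy
        rcases hex with h | h | h | h
        · exact hP _ _ _ _ h (plaq_near (plaq x _ (by simp)) hy2)
        · exact hP _ _ _ _ h (plaq_near (plaq x (nb x false, true) (by simp)) hy2)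
        · exact hP _ _ _ _ h (plaq_near (plaq x (nb x true, false) (by simp)) hy2)
        · exact hP _ _ _ _ h (plaq_near (plaq x _ (by simp)) hy2)
      rw [this x false (by simp), this (nb x false) true (by simp), this (nb x true) false (by simp),
        this x true (by simp), hx]
      exact four _ _ _ _
    · push Not at hex
      simp [g, hex]) (fun e he => by
    have : e ∉ γ := fun h => by
      have := mem_eds.1 (Finset.mem_filter.1 (hγ h)).1
      omega
    simp [g, this])
  have two : ∀ a b : ZMod 2, a + b = 0 → a = b := by decide
  have hcW : ∀ A : Set Site, (A = (W : Set Site) ∨ A = (W : Set Site)ᶜ) → ∀ x y, Reach A x y → U x = U y := by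
    intro A hA x y h
    refine reach_const h (P := fun z => U x = U z) (fun a b hab ha hb h' => h'.trans ?_) rfl
    have hab' : (a ∈ W ↔ b ∈ W) := by
      rcases hA with rfl | rfl
      · exact ⟨fun _ => hb, fun _ => ha⟩
      · exact ⟨fun h => (ha h).elim, fun h => (hb h).elim⟩
    obtain ⟨i, rfl | rfl⟩ := adj_iff.1 hab
    · refine two _ _ ?_
      rw [← hU]; simp only [g]; rw [if_neg]
      exact fun h => (hbd a i).1 (hγ h) hab'
    · refine (two _ _ ?_).symm
      rw [← hU]; simp only [g]; rw [if_neg]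
      exact fun h => (hbd b i).1 (hγ h) hab'.symm
  have hUc : ∀ x ∉ W, U x = 0 := fun x hx => by
    have ho : ((L + 1 : ℤ), (0 : ℤ)) ∉ W := fun h => by have := mem_box.1 (hW.sub h); simp at this
    rw [hcW _ (Or.inr rfl) x _ (hW.c2 x (by simpa using hx) _ (by simpa using ho))]
    exact hU0 _ (by simp)
  refine Finset.Subset.antisymm hγ ?_
  rintro ⟨y, i⟩ hy
  obtain ⟨⟨z, j⟩, hz⟩ := hne
  have hz' := (hbd z j).1 (hγ hz)
  have hy' := (hbd y i).1 hy
  have e1 : ∃ z' ∈ W, U z' ≠ 0 := by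
    have h1 : U z + U (nb z j) = 1 := by rw [← hU]; simp [g, hz]
    by_cases h : z ∈ W
    · refine ⟨z, h, fun h0 => ?_⟩
      rw [h0, hUc _ (fun h' => hz' ⟨fun _ => h', fun _ => h⟩)] at h1; simp at h1
    · refine ⟨nb z j, by tauto, fun h0 => ?_⟩
      rw [h0, hUc _ h] at h1; simp at h1
  obtain ⟨z', hz'W, hz0⟩ := e1
  have e2 : ∀ x ∈ W, U x ≠ 0 := fun x hx => by
    rwa [hcW _ (Or.inl rfl) x z' (hW.c1 x hx z' hz'W)]
  have h1 := hU y i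
  by_contra hc
  have h2 : U y + U (nb y i) = 0 := by rw [← h1]; simp [g, hc]
  by_cases h : y ∈ W
  · rw [hUc (nb y i) (fun h' => hy' ⟨fun _ => h', fun _ => h⟩), add_zero] at h2
    exact e2 y h h2
  · rw [hUc y h, zero_add] at h2
    exact e2 _ (by tauto) h2

abbrev Dt : Type := {d : Site // d ∈ Dm}
def vis : Site → List Dt → Finset Site
  | v, [] => {v}
  | v, d :: l => insert v (vis (v + d.1) l)
lemma mem_vis (v : Site) (l : List Dt) : v ∈ vis v l := by cases l <;> simp [vis]
lemma vis_ins (d : Dt) : ∀ (l : List Dt) (v p : Site), p ∈ vis v l →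
    ∃ l', l'.length = l.length + 2 ∧ vis v l' = insert (p + d.1) (vis v l) := by
  have hneg : -d.1 ∈ Dm := by
    have := d.2
    simp only [Dm, Finset.mem_Icc, Prod.le_def] at this ⊢
    simp at this ⊢; omega
  have base : ∀ l v, ∃ l', l'.length = l.length + 2 ∧ vis v l' = insert (v + d.1) (vis v l) := fun l v =>
    ⟨d :: ⟨-d.1, hneg⟩ :: l, by simp, by
      simp only [vis, add_neg_cancel_right]
      rw [Finset.insert_comm, Finset.insert_eq_self.2 (mem_vis v l)]⟩
  intro l
  induction l with
  | nil => intro v p hp; simp only [vis, Finset.mem_singleton] at hp; subst hp; exact base _ _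
  | cons a l ih =>
    intro v p hp
    simp only [vis, Finset.mem_insert] at hp
    rcases hp with rfl | hp
    · exact base _ _
    · obtain ⟨l', h1, h2⟩ := ih _ p hp
      exact ⟨a :: l', by simp [h1], by simp only [vis, h2, Finset.insert_comm]⟩

lemma cover {L : ℕ} {W : Finset Site} (hW : Cc L W) {e : Site × Bool} (he : e ∈ bd L W) :
    ∃ l : List Dt, l.length = 2 * per L W - 2 ∧ vis (mid e) l = (bd L W).image mid := by
  have key : ∀ k, k + 1 ≤ per L W → ∃ l : List Dt, l.length = 2 * k ∧ (vis (mid e) l).card = k + 1 ∧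
      vis (mid e) l ⊆ (bd L W).image mid := by
    intro k
    induction k with
    | zero => exact fun _ => ⟨[], rfl, by simp [vis], by simpa [vis, -Prod.exists] using ⟨e, he, rfl⟩⟩
    | succ k ih =>
      intro hk
      obtain ⟨l, h1, h2, h3⟩ := ih (by omega)
      set γ := (bd L W).filter (fun e' => mid e' ∈ vis (mid e) l) with hγ
      by_cases hcl : ∀ a ∈ γ, ∀ a' ∈ bd L W, mid a' - mid a ∈ Dm → a' ∈ γ
      · have := bd_conn hW (Finset.filter_subset _ _) ⟨e, by simp [he, mem_vis]⟩ hcl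
        have h4 : (bd L W).image mid ⊆ vis (mid e) l := by
          rw [← this]; intro z hz
          obtain ⟨a, ha, rfl⟩ := Finset.mem_image.1 hz
          exact (Finset.mem_filter.1 ha).2
        have h5 := Finset.card_le_card h4
        rw [Finset.card_image_of_injective _ mid_inj] at h5
        simp only [per] at hk; omega
      · push Not at hcl
        obtain ⟨a, ha, a', ha', hd, hn⟩ := hcl
        obtain ⟨l', h4, h5⟩ := vis_ins ⟨_, hd⟩ l (mid e) (mid a) (Finset.mem_filter.1 ha).2
        simp only [add_sub_cancel] at h5
        refine ⟨l', by omega, ?_, ?_⟩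
        · rw [h5, Finset.card_insert_of_notMem, h2]
          exact fun h => hn (Finset.mem_filter.2 ⟨ha', h⟩)
        · rw [h5]
          exact Finset.insert_subset (Finset.mem_image_of_mem _ ha') h3
  have hpos : 0 < per L W := Finset.card_pos.2 ⟨e, he⟩
  obtain ⟨l, h1, h2, h3⟩ := key (per L W - 1) (by omega)
  refine ⟨l, by omega, Finset.eq_of_subset_of_card_le h3 ?_⟩
  rw [Finset.card_image_of_injective _ mid_inj, h2]
  simp only [per] at *; omega

def Cn (L : ℕ) (x : Site) : Finset (Finset Site) := (box L).powerset.filter (fun W => Cc L W ∧ x ∈ W)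
lemma mem_Cn {L : ℕ} {x : Site} {W : Finset Site} : W ∈ Cn L x ↔ Cc L W ∧ x ∈ W := by
  simp only [Cn, Finset.mem_filter, Finset.mem_powerset, and_iff_right_iff_imp]
  exact fun h => h.1.sub

lemma exists_start {L : ℕ} {W : Finset Site} (hW : Cc L W) {x : Site} (hx : x ∈ W) :
    ∃ i : ℕ, i < per L W ∧ ((x.1 + i, x.2), false) ∈ bd L W := by
  have hex : ∃ i : ℕ, (x.1 + i + 1, x.2) ∉ W := by
    refine ⟨L, fun h => ?_⟩
    have h1 := mem_box.1 (hW.sub h); have h2 := mem_box.1 (hW.sub hx)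
    simp at h1; omega
  set i := Nat.find hex
  have hi : (x.1 + i + 1, x.2) ∉ W := Nat.find_spec hex
  have hlt : ∀ k : ℕ, k ≤ i → (x.1 + k, x.2) ∈ W := by
    intro k hk
    cases k with
    | zero => simpa using hx
    | succ k =>
      have := not_not.1 (Nat.find_min hex (m := k) (by omega))
      push_cast; rwa [← add_assoc]
  refine ⟨i, ?_, ?_⟩
  · have h1 : i + 1 ≤ (cols W).card := by
      calc i + 1 = ((Finset.range (i + 1)).image (fun k : ℕ => x.1 + (k : ℤ))).card := by
            rw [Finset.card_image_of_injective _ (fun a b h => by simpa using h), Finset.card_range]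
        _ ≤ _ := Finset.card_le_card fun c hc => by
            obtain ⟨k, hk, rfl⟩ := Finset.mem_image.1 hc
            exact Finset.mem_image.2 ⟨_, hlt k (by simpa [Nat.lt_succ_iff] using hk), rfl⟩
    have := per_ge hW.sub
    omega
  · rw [mem_bd hW.sub]
    have := hlt i le_rfl
    simp only [nb, Bool.false_eq_true, if_false]
    tauto

lemma bd_determines {L : ℕ} {W W' : Finset Site} (hW : Cc L W) (hW' : Cc L W') {x : Site} (hx : x ∈ W)
    (hx' : x ∈ W') (h : bd L W = bd L W') : W ⊆ W' := fun y hy =>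
  reach_const (hW.c1 x hx y hy) (P := fun z => z ∈ W') (fun a b hab ha hb ha' => by
    obtain ⟨i, rfl | rfl⟩ := adj_iff.1 hab
    · have := mem_bd hW.sub (x := a) (b := i); rw [h, mem_bd hW'.sub] at this
      simp only [Finset.mem_coe] at ha hb; tauto
    · have := mem_bd hW.sub (x := b) (b := i); rw [h, mem_bd hW'.sub] at this
      simp only [Finset.mem_coe] at ha hb; tauto) hx'

lemma count {L : ℕ} (x : Site) (b : ℕ) : ((Cn L x).filter (fun W => per L W = b)).card ≤ 1250 ^ b := by
  have h : ∀ W : {W // W ∈ (Cn L x).filter (fun W => per L W = b)}, ∃ z : Fin b × List.Vector Dt (2 * b - 2),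
      vis (mid ((x.1 + (z.1 : ℕ), x.2), false)) z.2.1 = (bd L W.1).image mid := by
    rintro ⟨W, hW⟩
    rw [Finset.mem_filter, mem_Cn] at hW
    obtain ⟨i, hi, hb⟩ := exists_start hW.1.1 hW.1.2
    obtain ⟨l, h1, h2⟩ := cover hW.1.1 hb
    exact ⟨(⟨i, hW.2 ▸ hi⟩, ⟨l, by rw [h1, hW.2]⟩), h2⟩
  choose z hz using h
  have hinj : Function.Injective z := by
    rintro ⟨W, hW⟩ ⟨W', hW'⟩ h
    have h1 := hz ⟨W, hW⟩; rw [h, hz ⟨W', hW'⟩] at h1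
    have h2 := Finset.image_injective mid_inj h1
    rw [Finset.mem_filter, mem_Cn] at hW hW'
    exact Subtype.ext (Finset.Subset.antisymm (bd_determines hW.1.1 hW'.1.1 hW.1.2 hW'.1.2 h2.symm)
      (bd_determines hW'.1.1 hW.1.1 hW'.1.2 hW.1.2 h2))
  have h1 := Fintype.card_le_of_injective z hinj
  rw [Fintype.card_coe, Fintype.card_prod, Fintype.card_fin, card_vector] at h1
  have h3 : Fintype.card Dt = 25 := by rw [Fintype.card_coe]; decide
  rw [h3] at h1
  calc _ ≤ b * 25 ^ (2 * b - 2) := h1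
    _ ≤ 2 ^ b * 25 ^ (2 * b) := Nat.mul_le_mul Nat.lt_two_pow_self.le (Nat.pow_le_pow_right (by norm_num) (by omega))
    _ = 1250 ^ b := by rw [pow_mul, ← mul_pow]; norm_num

lemma sum_cn {L : ℕ} (x : Site) (b0 : ℕ) {q : ℝ} (hq0 : 0 ≤ q) (hq : 1250 * q ≤ 1 / 2)
    {T : Finset (Finset Site)} (hT : ∀ W ∈ T, W ∈ Cn L x ∧ b0 ≤ per L W) :
    ∑ W ∈ T, q ^ per L W ≤ 2 * (1250 * q) ^ b0 := by
  obtain ⟨B, hB⟩ : ∃ B, ∀ W ∈ T, per L W < b0 + B := by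
    refine ⟨T.sup (per L) + 1, fun W hW => ?_⟩
    have := Finset.le_sup (f := per L) hW
    omega
  rw [← Finset.sum_fiberwise_of_maps_to (t := Finset.Ico b0 (b0 + B)) (g := per L)
    (fun W hW => Finset.mem_Ico.2 ⟨(hT W hW).2, hB W hW⟩)]
  calc _ ≤ ∑ b ∈ Finset.Ico b0 (b0 + B), (1250 * q) ^ b := by
        refine Finset.sum_le_sum fun b _ => ?_
        rw [Finset.sum_congr rfl (fun W hW => by rw [(Finset.mem_filter.1 hW).2]), Finset.sum_const,
          nsmul_eq_mul, mul_pow]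
        refine mul_le_mul_of_nonneg_right ?_ (by positivity)
        have h1 : (T.filter (fun W => per L W = b)).card ≤ 1250 ^ b := (Finset.card_le_card fun W hW => by
          rw [Finset.mem_filter] at hW ⊢; exact ⟨(hT W hW.1).1, hW.2⟩).trans (count x b)
        exact_mod_cast h1
    _ ≤ _ := by
        rw [Finset.sum_Ico_eq_sum_range, add_tsub_cancel_left]
        simp only [pow_add, ← Finset.mul_sum]
        rw [mul_comm 2]
        refine mul_le_mul_of_nonneg_left ?_ (by positivity)
        calc _ ≤ ∑ i ∈ Finset.range B, (1 / 2 : ℝ) ^ i :=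
              Finset.sum_le_sum fun i _ => pow_le_pow_left₀ (by positivity) hq i
          _ ≤ 2 := by
            rw [geom_sum_eq (by norm_num)]
            have : (0 : ℝ) ≤ (1 / 2) ^ B := by positivity
            rw [div_le_iff_of_neg (by norm_num)]; linarith

/-! equilibrium estimates -/
lemma sum_cover {ι : Type*} {F : Finset Config} {T : Finset ι} {D : ι → Finset Config} {f : Config → ℝ}
    (hf : ∀ η, 0 ≤ f η) (h : ∀ η ∈ F, ∃ W ∈ T, η ∈ D W) : ∑ η ∈ F, f η ≤ ∑ W ∈ T, ∑ η ∈ D W, f η := by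
  rcases F.eq_empty_or_nonempty with rfl | ⟨η0, h0⟩
  · simpa using Finset.sum_nonneg fun W _ => Finset.sum_nonneg fun η _ => hf η
  have : ∀ η, ∃ W, η ∈ F → W ∈ T ∧ η ∈ D W := fun η => by
    by_cases hη : η ∈ F
    · obtain ⟨W, h1, h2⟩ := h η hη; exact ⟨W, fun _ => ⟨h1, h2⟩⟩
    · obtain ⟨W, h1, h2⟩ := h η0 h0; exact ⟨W, fun h => (hη h).elim⟩
  choose i hi using this
  rw [Finset.sum_sigma']
  refine sum_inj_le (fun η => ⟨i η, η⟩) (fun η hη => Finset.mem_sigma.2 (hi η hη)) ?_ (fun _ _ => le_rfl)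
    (fun _ _ => hf _)
  intro a _ b _ hab
  simp only [Sigma.mk.injEq, heq_eq_eq] at hab
  exact hab.2

lemma en_ge {L : ℕ} {V : Finset Site} (hV : V ⊆ box L) {j : ℤ} {η : Config} (hη : ∀ x ∉ V, η x = j)
    (x : Site) : |η x - j| ≤ en L η := by
  by_cases hx : x ∈ V
  swap
  · rw [hη x hx]; simpa using en_nonneg L η
  have hxb := mem_box.1 (hV hx)
  have key : ∀ (n : ℕ) (a : ℤ), (L + 1 - a).toNat = n →
      |η (a, x.2) - j| ≤ ∑ k ∈ Finset.Icc a (L : ℤ), |η (k, x.2) - η (k + 1, x.2)| := by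
    intro n
    induction n with
    | zero =>
      intro a ha
      rw [hη _ (fun h => by have := mem_box.1 (hV h); simp at this; omega)]
      simpa using Finset.sum_nonneg fun _ _ => abs_nonneg _
    | succ n ih =>
      intro a ha
      have : Finset.Icc a (L : ℤ) = insert a (Finset.Icc (a + 1) L) := by ext k; simp; omega
      rw [this, Finset.sum_insert (by simp)]
      have h1 := ih (a + 1) (by omega)
      have h2 := abs_sub_le (η (a, x.2)) (η (a + 1, x.2)) j
      linarith
  refine (key _ x.1 rfl).trans ?_
  have him := Finset.sum_image (s := Finset.Icc x.1 (L : ℤ)) (g := fun k : ℤ => (((k, x.2), false) : Site × Bool))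
    (f := fun e => |η e.1 - η (nb e.1 e.2)|) (fun a _ b _ h => by simpa using h)
  simp only [nb, Bool.false_eq_true, if_false] at him
  rw [← him]
  have : ∀ e : Site × Bool, (|η e.1 - η (nb e.1 e.2)| : ℤ) = |η e.1 - η (if e.2 = true then (e.1.1, e.1.2 + 1) else (e.1.1 + 1, e.1.2))| :=
    fun e => rfl
  simp only [← this]
  refine Finset.sum_le_sum_of_subset_of_nonneg ?_ fun _ _ _ => abs_nonneg _
  intro e he
  obtain ⟨k, hk, rfl⟩ := Finset.mem_image.1 he
  rw [Finset.mem_Icc] at hk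
  rw [mem_eds]; simp; omega

def Big (β : ℝ) (L K N : ℕ) : Prop :=
  K ≤ N ∧ ((N : ℝ) + 1) ^ (L ^ 2) * Real.exp (-β * ((N : ℝ) - K)) ≤ 1 / 4

lemma card_box (L : ℕ) : (box L).card = L ^ 2 := by
  have : box L = Finset.Icc (1 : ℤ) L ×ˢ Finset.Icc (1 : ℤ) L := by ext x; simp [mem_box]; omega
  rw [this]; simp [sq]

lemma card_St_le (V : Finset Site) (j : ℤ) (n : ℕ) : (St V j n).card ≤ (n + 1) ^ V.card := by
  refine Finset.card_image_le.trans ?_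
  simp [Fintype.card_piFinset]

lemma max_small {β : ℝ} (hβ : 0 ≤ β) {L K N : ℕ} (hN : Big β L K N) {V : Finset Site} (hV : V ⊆ box L)
    {j : ℤ} (h0 : 0 ≤ j) (hj : j ≤ K) :
    sw β L ((St V j N).filter (fun η : Config => ∃ x ∈ V, η x = (N : ℤ))) ≤ 1 / 4 * sw β L (St V j N) := by
  have hKN : (K : ℤ) ≤ N := by exact_mod_cast hN.1
  have h1 := one_le_sw (β := β) (L := L) (V := V) h0 (hj.trans hKN)
  suffices h : sw β L ((St V j N).filter (fun η : Config => ∃ x ∈ V, η x = (N : ℤ))) ≤ 1 / 4 by linarith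
  refine le_trans ?_ hN.2
  calc _ ≤ ∑ η ∈ (St V j N).filter (fun η : Config => ∃ x ∈ V, η x = (N : ℤ)), Real.exp (-β * ((N : ℝ) - K)) := by
        refine Finset.sum_le_sum fun η hη => ?_
        rw [Finset.mem_filter] at hη
        obtain ⟨hη, x, hx, hxN⟩ := hη
        have h2 := en_ge hV (mem_St.1 hη).2 x
        have h3 : (N : ℤ) - K ≤ en L η := by
          have := le_abs_self (η x - j); omega
        have h4 : ((N : ℝ) - K) ≤ (en L η : ℝ) := by exact_mod_cast h3
        exact Real.exp_le_exp.2 (by nlinarith)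
    _ ≤ _ := by
        rw [Finset.sum_const, nsmul_eq_mul]
        refine mul_le_mul_of_nonneg_right ?_ (Real.exp_pos _).le
        have h2 : ((St V j N).filter (fun η : Config => ∃ x ∈ V, η x = (N : ℤ))).card ≤ (N + 1) ^ (L ^ 2) :=
          (Finset.card_filter_le _ _).trans ((card_St_le V j N).trans
            (Nat.pow_le_pow_right (by omega) (card_box L ▸ Finset.card_le_card hV)))
        exact_mod_cast h2

lemma w_shift (β : ℝ) (L : ℕ) (η : Config) (c : ℤ) : w β L (fun x => η x + c) = w β L η := by
  simp [w, en]

lemma sw_shift {β : ℝ} {L : ℕ} {S T : Finset Config} (c : ℤ) (h : ∀ η ∈ S, (fun x => η x + c) ∈ T) :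
    sw β L S ≤ sw β L T := by
  refine sum_inj_le (f := w β L) (g := w β L) (fun η x => η x + c) h ?_ ?_ (fun _ _ => (w_pos _ _ _).le)
  · intro a _ b _ hab
    funext x
    have := congrFun hab x
    simpa using this
  · intro η _
    rw [w_shift]

lemma zup {β : ℝ} (hβ : 0 ≤ β) {L K N : ℕ} (hN : Big β L K N) {V : Finset Site} (hV : V ⊆ box L)
    {j : ℤ} (h0 : 0 ≤ j) (hj : j ≤ K) : sw β L (St V j N) ≤ 4 / 3 * sw β L (St V (j + 1) N) := by
  have h1 := max_small hβ hN hV h0 hj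
  have h2 : sw β L ((St V j N).filter (fun η : Config => ¬ ∃ x ∈ V, η x = (N : ℤ))) ≤ sw β L (St V (j + 1) N) := by
    refine sw_shift 1 fun η hη => ?_
    rw [Finset.mem_filter, mem_St] at hη
    refine mem_St.2 ⟨fun x hx => ?_, fun x hx => by simp [hη.1.2 x hx]⟩
    have := hη.1.1 x hx
    have h3 : η x ≠ (N : ℤ) := fun h => hη.2 ⟨x, hx, h⟩
    omega
  have h3 : sw β L (St V j N) = _ := (Finset.sum_filter_add_sum_filter_not _ (fun η : Config => ∃ x ∈ V, η x = (N : ℤ)) _).symm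
  simp only [sw] at *
  linarith

lemma q_le {β : ℝ} (hβ : 60 ≤ β) : Real.exp (-β) ≤ (1 / 2) ^ 60 := by
  have h1 : Real.exp (-β) ≤ Real.exp (-(60 : ℕ)) := Real.exp_le_exp.2 (by push_cast; linarith)
  refine h1.trans ?_
  rw [Real.exp_neg, ← Real.exp_one_pow, ← inv_pow]
  refine pow_le_pow_left₀ (by positivity) ?_ _
  rw [one_div]
  exact inv_anti₀ (by norm_num) (by linarith [Real.add_one_le_exp (1 : ℝ)])

lemma pz {β : ℝ} (hβ : 60 ≤ β) {L K N : ℕ} (hN : Big β L K N) : ∀ j : ℕ, j ≤ K → ∀ V, Cc L V → ∀ x ∈ V,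
    sw β L ((St V j N).filter (fun η : Config => η x = 0)) ≤ 2 * Real.exp (-4 * β * j) * sw β L (St V j N) := by
  intro j
  have hβ0 : 0 ≤ β := by linarith
  set q := Real.exp (-β) with hq
  have hq0 : 0 < q := Real.exp_pos _
  have hql := q_le hβ
  have hex : ∀ k : ℕ, Real.exp (-β * k) = q ^ k := fun k => by
    rw [hq, ← Real.exp_nat_mul]; congr 1; ring
  have hex4 : ∀ k : ℕ, Real.exp (-4 * β * k) = q ^ (4 * k) := fun k => by
    rw [← hex]; congr 1; push_cast; ring
  simp only [hex4]
  induction j with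
  | zero =>
    intro _ V hV x hx
    have := sw_mono (β := β) (L := L) (Finset.filter_subset (fun η : Config => η x = 0) (St V ((0 : ℕ) : ℤ) N))
    have h2 := sw_nonneg β L (St V ((0 : ℕ) : ℤ) N)
    simp; simp at this h2; linarith
  | succ j ih =>
    intro hj V hV x hx
    set Z := sw β L (St V ((j + 1 : ℕ) : ℤ) N)
    have hZ0 : 0 ≤ Z := sw_nonneg _ _ _
    set T := (Cn L x).filter (fun W => W ⊆ V)
    set D : Finset Site → Finset Config := fun W => (St V ((j + 1 : ℕ) : ℤ) N).filter (fun η => η x = 0 ∧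
      ∀ y z, SiteAdj y z → y ∈ W → z ∉ W → η y ≤ j ∧ j + 1 ≤ η z)
    have hcov := sum_cover (f := w β L) (fun η => (w_pos _ _ η).le)
      (F := (St V ((j + 1 : ℕ) : ℤ) N).filter (fun η : Config => η x = 0)) (T := T) (D := D) (by
        intro η hη
        rw [Finset.mem_filter] at hη
        obtain ⟨W, hW, hxW, hWV, hb, -⟩ := ctr hV (A := {y | y ∈ V ∧ η y ≤ j}) (fun y hy => hy.1)
          (x := x) ⟨hx, by rw [hη.2]; omega⟩
        refine ⟨W, Finset.mem_filter.2 ⟨mem_Cn.2 ⟨hW, hxW⟩, hWV⟩, Finset.mem_filter.2 ⟨hη.1, hη.2,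
          fun y z h1 h2 h3 => ?_⟩⟩
        obtain ⟨h4, h5⟩ := hb y z h1 h2 h3
        refine ⟨h4.2, ?_⟩
        by_cases hz : z ∈ V
        · have : ¬ η z ≤ j := fun h => h5 ⟨hz, h⟩
          omega
        · rw [(mem_St.1 hη.1).2 z hz]; push_cast; omega)
    have hterm : ∀ W ∈ T, sw β L (D W) ≤ (if W = {x} then q ^ (4 * (j + 1)) else 8 / 3 * q ^ (4 * j) * q ^ per L W) * Z := by
      intro W hW
      obtain ⟨hW, hWV⟩ := Finset.mem_filter.1 hW
      obtain ⟨hWc, hxW⟩ := mem_Cn.1 hW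
      have hs := swap hβ0 (L := L) (W := W) (p := j) (q := ((j + 1 : ℕ) : ℤ)) (n := N) (D := D W)
        (D' := St V ((j + 1 : ℕ) : ℤ) N) (B := (St W (j : ℤ) N).filter (fun η : Config => η x = 0)) (u := fun _ => 1) (C := 1)
        (fun _ => zero_le_one) (by
          intro η hη y z h1 h2 h3 v
          have := (Finset.mem_filter.1 hη).2.2 y z h1 h2 h3
          push_cast
          simp only [abs_eq_max_neg]; omega) (by
          intro η hη
          rw [Finset.mem_filter] at hη
          refine Finset.mem_filter.2 ⟨mem_St.2 ⟨fun y hy => ?_, fun y hy => by simp [glue, hy]⟩, by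
            simp [glue, hxW, hη.2.1]⟩
          simpa [glue, hy] using (mem_St.1 hη.1).1 y (hWV hy)) (by
          intro η hη g hg
          rw [Finset.mem_filter] at hη
          refine mem_St.2 ⟨fun y hy => ?_, fun y hy => ?_⟩
          · by_cases hyW : y ∈ W
            · simpa [glue, hyW] using (mem_St.1 hg).1 y hyW
            · simpa [glue, hyW] using (mem_St.1 hη.1).1 y hy
          · have hyW : y ∉ W := fun h => hy (hWV h)
            simpa [glue, hyW] using (mem_St.1 hη.1).2 y hy) (fun _ _ _ _ => by simp) zero_le_one
      simp only [mul_one, one_mul] at hs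
      rw [hex] at hs
      have hKN : (K : ℤ) ≤ N := by exact_mod_cast hN.1
      have hZW : 1 ≤ sw β L (St W ((j + 1 : ℕ) : ℤ) N) := one_le_sw (by positivity) (by omega)
      set ZW := sw β L (St W ((j + 1 : ℕ) : ℤ) N)
      have hmain : ∀ c : ℝ, 0 ≤ c → sw β L ((St W (j : ℤ) N).filter (fun η : Config => η x = 0)) ≤ c * ZW →
          sw β L (D W) ≤ q ^ per L W * c * Z := by
        intro c hc h
        refine le_of_mul_le_mul_right (a := ZW) ?_ (by linarith)
        refine hs.trans ?_
        calc q ^ per L W * sw β L ((St W (j : ℤ) N).filter (fun η : Config => η x = 0)) * Z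
            ≤ q ^ per L W * (c * ZW) * Z := by gcongr
          _ = _ := by ring
      have hz := zup hβ0 hN hWc.sub (j := j) (by positivity) (by omega)
      have hcast : ((j : ℤ) + 1) = ((j + 1 : ℕ) : ℤ) := by push_cast; ring
      rw [hcast] at hz
      split_ifs with hWx
      · have hp4 := per_ge_four hWc
        have hB : sw β L ((St W (j : ℤ) N).filter (fun η : Config => η x = 0)) ≤ q ^ (4 * j) * ZW := by
          refine le_trans ?_ (le_mul_of_one_le_right (by positivity) hZW)
          have hsub : (St W (j : ℤ) N).filter (fun η : Config => η x = 0) ⊆ {Function.update (fun _ => (j : ℤ)) x 0} := by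
            intro η hη
            rw [Finset.mem_filter] at hη
            rw [Finset.mem_singleton]; ext y
            by_cases hy : y = x
            · subst hy; simp [hη.2]
            · rw [Function.update_of_ne hy, (mem_St.1 hη.1).2 y (by rw [hWx]; simpa using hy)]
          refine (sw_mono hsub).trans ?_
          rw [sw, Finset.sum_singleton, ← hex]
          refine Real.exp_le_exp.2 ?_
          have hen : ((4 * j : ℕ) : ℤ) ≤ en L (Function.update (fun _ => (j : ℤ)) x 0) := by
            calc ((4 * j : ℕ) : ℤ) ≤ ∑ e ∈ bd L W, (j : ℤ) := by
                  rw [Finset.sum_const, nsmul_eq_mul]; push_cast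
                  have : ((4 : ℕ) : ℤ) ≤ per L W := by exact_mod_cast hp4
                  simp only [per] at this; push_cast at this; nlinarith
              _ ≤ ∑ e ∈ bd L W, |Function.update (fun _ => (j : ℤ)) x 0 e.1 - Function.update (fun _ => (j : ℤ)) x 0 (nb e.1 e.2)| := by
                  refine Finset.sum_le_sum fun e he => ?_
                  have he := (Finset.mem_filter.1 he).2
                  rw [hWx, Finset.mem_singleton, Finset.mem_singleton] at he
                  by_cases h1 : e.1 = x
                  · have h2 : nb e.1 e.2 ≠ x := fun h => he ⟨fun _ => h, fun _ => h1⟩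
                    rw [Function.update_of_ne h2, h1, Function.update_self]; simp
                  · have h2 : nb e.1 e.2 = x := by tauto
                    rw [Function.update_of_ne h1, h2, Function.update_self]; simp
              _ ≤ _ := Finset.sum_le_sum_of_subset_of_nonneg (Finset.filter_subset _ _) fun _ _ _ => abs_nonneg _
          have : ((4 * j : ℕ) : ℝ) ≤ (en L (Function.update (fun _ => (j : ℤ)) x 0) : ℝ) := by exact_mod_cast hen
          nlinarith
        refine (hmain _ (by positivity) hB).trans (mul_le_mul_of_nonneg_right ?_ hZ0)
        calc q ^ per L W * q ^ (4 * j) ≤ q ^ 4 * q ^ (4 * j) := by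
              gcongr ?_ * _
              exact pow_le_pow_of_le_one hq0.le (hql.trans (by norm_num)) hp4
          _ = _ := by rw [← pow_add]; ring_nf
      · have hB := ih (by omega) W hWc x hxW
        have hB' : sw β L ((St W (j : ℤ) N).filter (fun η : Config => η x = 0)) ≤ (8 / 3 * q ^ (4 * j)) * ZW := by
          refine hB.trans ?_
          calc 2 * q ^ (4 * j) * sw β L (St W (j : ℤ) N) ≤ 2 * q ^ (4 * j) * (4 / 3 * ZW) := by gcongr
            _ = _ := by ring
        refine (hmain _ (by positivity) hB').trans (mul_le_mul_of_nonneg_right ?_ hZ0)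
        exact (mul_comm _ _).le
    refine (hcov.trans (Finset.sum_le_sum hterm)).trans ?_
    rw [← Finset.sum_mul]
    refine mul_le_mul_of_nonneg_right ?_ hZ0
    rw [Finset.sum_ite, ← Finset.mul_sum]
    have h1 : ∑ W ∈ T.filter (fun W => W = {x}), q ^ (4 * (j + 1)) ≤ q ^ (4 * (j + 1)) := by
      rw [Finset.sum_const, nsmul_eq_mul]
      refine mul_le_of_le_one_left (by positivity) ?_
      have : (T.filter (fun W => W = {x})).card ≤ 1 := by
        rw [Finset.card_le_one]
        intro a ha b hb
        rw [(Finset.mem_filter.1 ha).2, (Finset.mem_filter.1 hb).2]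
      exact_mod_cast this
    have h2 := sum_cn (L := L) x 6 hq0.le (by linarith [show (1250 : ℝ) * (1 / 2) ^ 60 ≤ 1 / 2 by norm_num])
      (T := T.filter (fun W => ¬ W = {x})) (fun W hW => by
        rw [Finset.mem_filter] at hW
        have h3 := (Finset.mem_filter.1 hW.1).1
        have h4 := mem_Cn.1 h3
        exact ⟨h3, per_ge_six h4.1.sub h4.2 hW.2⟩)
    have h3 : 8 / 3 * q ^ (4 * j) * (2 * (1250 * q) ^ 6) ≤ q ^ (4 * (j + 1)) := by
      have : 8 / 3 * q ^ (4 * j) * (2 * (1250 * q) ^ 6) = q ^ (4 * (j + 1)) * (16 / 3 * 1250 ^ 6 * q ^ 2) := by ring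
      rw [this]
      refine mul_le_of_le_one_right (by positivity) ?_
      calc 16 / 3 * 1250 ^ 6 * q ^ 2 ≤ 16 / 3 * 1250 ^ 6 * ((1 / 2) ^ 60) ^ 2 := by gcongr
        _ ≤ 1 := by norm_num
    have h4 := mul_le_mul_of_nonneg_left h2 (show 0 ≤ 8 / 3 * q ^ (4 * j) by positivity)
    linarith

lemma sw_filter (β : ℝ) (L : ℕ) (S : Finset Config) (P : Config → Prop) [DecidablePred P] :
    sw β L (S.filter P) = ∑ η ∈ S, w β L η * (if P η then 1 else 0) := by
  rw [sw, Finset.sum_filter]; exact Finset.sum_congr rfl fun _ _ => by split_ifs <;> simp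

lemma sw_add_not (β : ℝ) (L : ℕ) (S : Finset Config) (P : Config → Prop) [DecidablePred P] :
    sw β L (S.filter P) + sw β L (S.filter (fun η => ¬ P η)) = sw β L S :=
  Finset.sum_filter_add_sum_filter_not _ _ _

lemma ZR {β : ℝ} (hβ : 60 ≤ β) {L K N : ℕ} (hN : Big β L K N) {j : ℕ} (hj : j + 1 ≤ K) {W : Finset Site}
    (hW : Cc L W) : sw β L (St W ((j + 1 : ℕ) : ℤ) N) ≤
      Real.exp (4 * Real.exp (-4 * β * ((j + 1 : ℕ) : ℝ)) * W.card) * sw β L (St W (j : ℤ) N) := by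
  set S := St W ((j + 1 : ℕ) : ℤ) N with hS
  set e := 2 * Real.exp (-4 * β * ((j + 1 : ℕ) : ℝ)) with he
  have he0 : 0 ≤ e := by positivity
  have he1 : e ≤ 1 / 2 := by
    have h1 : Real.exp (-4 * β * ((j + 1 : ℕ) : ℝ)) ≤ Real.exp (-β) := Real.exp_le_exp.2 (by
      push_cast; nlinarith [(Nat.cast_nonneg j : (0 : ℝ) ≤ j)])
    have := q_le hβ
    have h3 : (1 / 2 : ℝ) ^ 60 ≤ 1 / 4 := by norm_num
    linarith
  have hKN : (K : ℤ) ≤ N := by exact_mod_cast hN.1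
  have hZ : 1 ≤ sw β L S := one_le_sw (by positivity) (by omega)
  have key : ∀ U : Finset Site, U ⊆ W → (1 - e) ^ U.card * sw β L S ≤
      sw β L (S.filter (fun η => ∀ y ∈ U, 1 ≤ η y)) := by
    intro U
    induction U using Finset.induction_on with
    | empty => intro _; simp
    | insert x U hx ih =>
      intro hU
      rw [Finset.insert_subset_iff] at hU
      have h1 := ih hU.2
      set SU := S.filter (fun η => ∀ y ∈ U, 1 ≤ η y)
      have hd := dom (β := β) (by linarith) (L := L) (S1 := S) (S2 := SU) (f := fun η => if 1 ≤ η x then 1 else 0)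
        (by
          intro a ha b hb
          simp only [SU, Finset.mem_filter, hS, mem_St] at *
          refine ⟨⟨fun y hy => ?_, fun y hy => ?_⟩, ⟨fun y hy => ?_, fun y hy => ?_⟩, fun y hy => ?_⟩
          · have := ha.1 y hy; have := hb.1.1 y hy; simp only [Pi.inf_apply]; omega
          · simp [ha.2 y hy, hb.1.2 y hy]
          · have := ha.1 y hy; have := hb.1.1 y hy; simp only [Pi.sup_apply]; omega
          · simp [ha.2 y hy, hb.1.2 y hy]
          · have := hb.2 y hy; simp only [Pi.sup_apply]; omega)
        (fun a => by positivity) (fun a _ b _ hab => by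
          have h9 : a x ≤ b x := hab x
          split_ifs <;> first | (exfalso; omega) | norm_num)
      rw [← sw_filter, ← sw_filter, Finset.filter_filter] at hd
      have h2 : (1 - e) * sw β L S ≤ sw β L (S.filter (fun η => 1 ≤ η x)) := by
        have h3 := pz hβ hN (j + 1) hj W hW x hU.1
        have h4 := sw_add_not β L S (fun η => 1 ≤ η x)
        have h5 : S.filter (fun η => ¬ 1 ≤ η x) = S.filter (fun η => η x = 0) := by
          refine Finset.filter_congr fun η hη => ?_
          have := (mem_St.1 hη).1 x hU.1; omega
        rw [h5] at h4
        rw [← hS, ← he] at h3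
        linarith
      have h6 : sw β L (S.filter (fun η => (∀ y ∈ U, 1 ≤ η y) ∧ 1 ≤ η x)) ≤
          sw β L (S.filter (fun η => ∀ y ∈ insert x U, 1 ≤ η y)) := by
        refine sw_mono fun η hη => ?_
        simp only [Finset.mem_filter, Finset.forall_mem_insert] at hη ⊢
        tauto
      rw [Finset.card_insert_of_notMem hx, pow_succ]
      refine le_of_mul_le_mul_left (a := sw β L S) ?_ (by linarith)
      refine le_trans ?_ (hd.trans (mul_le_mul_of_nonneg_left (le_of_eq_of_le (by congr!) h6) (sw_nonneg _ _ _)))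
      calc _ = ((1 - e) * sw β L S) * ((1 - e) ^ U.card * sw β L S) := by ring
        _ ≤ _ := mul_le_mul h2 (h1.trans_eq (by congr!)) (mul_nonneg (pow_nonneg (by linarith) _) (by linarith)) (sw_nonneg _ _ _)
  have h1 := key W subset_rfl
  have h2 : sw β L (S.filter (fun η => ∀ y ∈ W, 1 ≤ η y)) ≤ sw β L (St W (j : ℤ) N) := by
    refine sw_shift (-1) fun η hη => ?_
    rw [Finset.mem_filter, hS, mem_St] at hη
    refine mem_St.2 ⟨fun x hx => ?_, fun x hx => ?_⟩
    · have := hη.1.1 x hx; have := hη.2 x hx; omega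
    · have := hη.1.2 x hx; push_cast at this; omega
  have h3 : Real.exp (-(2 * e)) ≤ 1 - e := by
    have h4 := Real.add_one_le_exp (2 * e)
    rw [Real.exp_neg]
    refine (inv_anti₀ (by linarith) h4).trans ?_
    rw [inv_le_iff_one_le_mul₀ (by linarith)]
    nlinarith
  have h4 : Real.exp (-(4 * Real.exp (-4 * β * ((j + 1 : ℕ) : ℝ)) * W.card)) ≤ (1 - e) ^ W.card := by
    refine le_trans (le_of_eq ?_) (pow_le_pow_left₀ (Real.exp_pos _).le h3 _)
    rw [← Real.exp_nat_mul]; congr 1; rw [he]; ring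
  rw [Real.exp_neg] at h4
  have h5 := (mul_le_mul_of_nonneg_right h4 (sw_nonneg β L S)).trans (h1.trans h2)
  rwa [inv_mul_le_iff₀ (Real.exp_pos _)] at h5

lemma cols_mono {W V : Finset Site} (h : W ⊆ V) : (cols W).card ≤ (cols V).card :=
  Finset.card_le_card (Finset.image_subset_image h)

/-- ratio over a contour with at most `l` columns -/
lemma ZR' {β : ℝ} (hβ : 60 ≤ β) {L K N : ℕ} (hN : Big β L K N) {j l : ℕ} (hj : j + 1 ≤ K) {W : Finset Site}
    (hW : Cc L W) (hl : 2 * Real.exp (-4 * β * ((j + 1 : ℕ) : ℝ)) * l ≤ 1) (hc : (cols W).card ≤ l) :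
    sw β L (St W ((j + 1 : ℕ) : ℤ) N) ≤ Real.exp (per L W) * sw β L (St W (j : ℤ) N) := by
  refine (ZR hβ hN hj hW).trans (mul_le_mul_of_nonneg_right (Real.exp_le_exp.2 ?_) (sw_nonneg _ _ _))
  have h1 : (2 : ℝ) * W.card ≤ l * per L W := by exact_mod_cast two_card_le hW.sub hc
  have h2 := (Real.exp_pos (-4 * β * ((j + 1 : ℕ) : ℝ))).le
  have h3 : (0 : ℝ) ≤ per L W := by positivity
  nlinarith [mul_le_mul_of_nonneg_left h1 h2, mul_le_mul_of_nonneg_right hl h3]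

lemma qe_le {β : ℝ} (hβ : 60 ≤ β) : 2 * (1250 * Real.exp (1 - β)) ^ 4 ≤ Real.exp (-(3 * β)) ∧
    1250 * Real.exp (1 - β) ≤ 1 / 2 := by
  have h1 : Real.exp (1 - β) = Real.exp 1 * Real.exp (-β) := by rw [← Real.exp_add]; ring_nf
  have h2 : Real.exp (-(3 * β)) = Real.exp (-β) ^ 3 := by rw [← Real.exp_nat_mul]; congr 1; push_cast; ring
  rw [h1, h2]
  have h3 := q_le hβ
  have h4 := Real.exp_pos (-β)
  have h5 : Real.exp 1 ≤ 3 := by linarith [Real.exp_one_lt_d9]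
  have h6 := Real.exp_pos 1
  constructor
  · calc 2 * (1250 * (Real.exp 1 * Real.exp (-β))) ^ 4 ≤ 2 * (1250 * (3 * Real.exp (-β))) ^ 4 := by gcongr
      _ = Real.exp (-β) ^ 3 * (2 * 3750 ^ 4 * Real.exp (-β)) := by ring
      _ ≤ Real.exp (-β) ^ 3 * (2 * 3750 ^ 4 * (1 / 2) ^ 60) := by gcongr
      _ ≤ Real.exp (-β) ^ 3 * 1 := by gcongr; norm_num
      _ = _ := mul_one _
  · calc 1250 * (Real.exp 1 * Real.exp (-β)) ≤ 1250 * (3 * (1 / 2) ^ 60) := by gcongr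
      _ ≤ _ := by norm_num

lemma up_tail {β : ℝ} (hβ : 60 ≤ β) {L K N l : ℕ} (hN : Big β L K N) : ∀ m j : ℕ, j + m ≤ K →
    2 * Real.exp (-4 * β * ((j + 1 : ℕ) : ℝ)) * l ≤ 1 → ∀ V, Cc L V → (cols V).card ≤ l → ∀ x ∈ V,
    sw β L ((St V j N).filter (fun η : Config => (j + m : ℕ) ≤ η x)) ≤
      Real.exp (-(3 * β)) ^ m * sw β L (St V j N) := by
  intro m
  induction m with
  | zero => intro j _ _ V _ _ x _; simpa using sw_mono (Finset.filter_subset _ _)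
  | succ m ih =>
    intro j hj hl V hV hc x hx
    have hβ0 : 0 ≤ β := by linarith
    set Z := sw β L (St V (j : ℤ) N) with hZ
    have hZ0 : 0 ≤ Z := sw_nonneg _ _ _
    set T := (Cn L x).filter (fun W => W ⊆ V) with hT
    set D : Finset Site → Finset Config := fun W => (St V (j : ℤ) N).filter (fun η : Config =>
      ((j + (m + 1) : ℕ) : ℤ) ≤ η x ∧
      ∀ y z, SiteAdj y z → y ∈ W → z ∉ W → (j : ℤ) + 1 ≤ η y ∧ η z ≤ j) with hD
    have hcov := sum_cover (f := w β L) (fun η => (w_pos _ _ η).le)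
      (F := (St V (j : ℤ) N).filter (fun η : Config => ((j + (m + 1) : ℕ) : ℤ) ≤ η x)) (T := T) (D := D) (by
        intro η hη
        rw [Finset.mem_filter] at hη
        obtain ⟨W, hW, hxW, hWV, hb, -⟩ := ctr hV (A := {y | y ∈ V ∧ (j : ℤ) + 1 ≤ η y}) (fun y hy => hy.1)
          (x := x) ⟨hx, by have := hη.2; push_cast at this; omega⟩
        refine ⟨W, Finset.mem_filter.2 ⟨mem_Cn.2 ⟨hW, hxW⟩, hWV⟩, Finset.mem_filter.2 ⟨hη.1, hη.2,
          fun y z h1 h2 h3 => ?_⟩⟩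
        obtain ⟨h4, h5⟩ := hb y z h1 h2 h3
        refine ⟨h4.2, ?_⟩
        by_cases hz : z ∈ V
        · have : ¬ (j : ℤ) + 1 ≤ η z := fun h => h5 ⟨hz, h⟩
          omega
        · rw [(mem_St.1 hη.1).2 z hz])
    have hterm : ∀ W ∈ T, sw β L (D W) ≤ (Real.exp (-(3 * β)) ^ m * Real.exp (1 - β) ^ per L W) * Z := by
      intro W hW
      obtain ⟨hW, hWV⟩ := Finset.mem_filter.1 hW
      obtain ⟨hWc, hxW⟩ := mem_Cn.1 hW
      have hcW := (cols_mono hWV).trans hc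
      have hs := swap hβ0 (L := L) (W := W) (p := ((j + 1 : ℕ) : ℤ)) (q := (j : ℤ)) (n := N) (D := D W)
        (D' := St V (j : ℤ) N) (B := (St W ((j + 1 : ℕ) : ℤ) N).filter (fun η : Config => ((j + 1 + m : ℕ) : ℤ) ≤ η x))
        (u := fun _ => 1) (C := 1)
        (fun _ => zero_le_one) (by
          intro η hη y z h1 h2 h3 v
          have := (Finset.mem_filter.1 hη).2.2 y z h1 h2 h3
          push_cast
          simp only [abs_eq_max_neg]; omega) (by
          intro η hη
          rw [Finset.mem_filter] at hη
          refine Finset.mem_filter.2 ⟨mem_St.2 ⟨fun y hy => ?_, fun y hy => by simp [glue, hy]⟩, ?_⟩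
          · simpa [glue, hy] using (mem_St.1 hη.1).1 y (hWV hy)
          · have := hη.2.1
            simp only [glue, hxW, if_true]; push_cast at this ⊢; omega) (by
          intro η hη g hg
          rw [Finset.mem_filter] at hη
          refine mem_St.2 ⟨fun y hy => ?_, fun y hy => ?_⟩
          · by_cases hyW : y ∈ W
            · simpa [glue, hyW] using (mem_St.1 hg).1 y hyW
            · simpa [glue, hyW] using (mem_St.1 hη.1).1 y hy
          · have hyW : y ∉ W := fun h => hy (hWV h)
            simpa [glue, hyW] using (mem_St.1 hη.1).2 y hy) (fun _ _ _ _ => by simp) zero_le_one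
      simp only [mul_one, one_mul] at hs
      have hKN : (K : ℤ) ≤ N := by exact_mod_cast hN.1
      have hZW : 1 ≤ sw β L (St W (j : ℤ) N) := one_le_sw (by positivity) (by omega)
      have hl' : 2 * Real.exp (-4 * β * ((j + 1 + 1 : ℕ) : ℝ)) * l ≤ 1 := by
        refine le_trans ?_ hl
        gcongr ?_ * _
        gcongr 2 * ?_
        refine Real.exp_le_exp.2 ?_
        push_cast; nlinarith
      have hB := ih (j + 1) (by omega) hl' W hWc hcW x hxW
      have hR := ZR' hβ hN (by omega) hWc hl hcW
      refine le_of_mul_le_mul_right (a := sw β L (St W (j : ℤ) N)) ?_ (by linarith)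
      refine hs.trans ?_
      calc _ ≤ Real.exp (-β * per L W) * (Real.exp (-(3 * β)) ^ m * (Real.exp (per L W) * sw β L (St W (j : ℤ) N))) * Z := by
            refine mul_le_mul_of_nonneg_right (mul_le_mul_of_nonneg_left (hB.trans ?_) (Real.exp_pos _).le) hZ0
            exact mul_le_mul_of_nonneg_left hR (by positivity)
        _ = Real.exp (-(3 * β)) ^ m * (Real.exp (-β * per L W) * Real.exp (per L W)) * Z * sw β L (St W (j : ℤ) N) := by ring
        _ = _ := by
            rw [← Real.exp_add, ← Real.exp_nat_mul (1 - β)]; ring_nf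
    refine (hcov.trans (Finset.sum_le_sum hterm)).trans ?_
    rw [← Finset.sum_mul, ← Finset.mul_sum, pow_succ]
    refine mul_le_mul_of_nonneg_right (mul_le_mul_of_nonneg_left ?_ (by positivity)) hZ0
    refine (sum_cn (L := L) x 4 (Real.exp_pos _).le (qe_le hβ).2 (T := T) (fun W hW => ?_)).trans (qe_le hβ).1
    have h3 := (Finset.mem_filter.1 hW).1
    exact ⟨h3, per_ge_four (mem_Cn.1 h3).1⟩

lemma en_mod {L : ℕ} {A : Finset Site} {σ η : Config} {k : ℤ} (hk : 0 ≤ k) (h : ∀ x ∉ A, σ x = η x)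
    (h' : ∀ x ∈ A, |σ x - η x| ≤ k) : en L σ ≤ en L η + 4 * k * A.card := by
  have h1 : ∀ x, |σ x - η x| ≤ if x ∈ A then k else 0 := fun x => by
    split_ifs with hx
    · exact h' x hx
    · simp [h x hx]
  have h2 : en L σ ≤ ∑ e ∈ eds L, (|η e.1 - η (nb e.1 e.2)| + (if e.1 ∈ A then k else 0) +
      (if nb e.1 e.2 ∈ A then k else 0)) := by
    refine Finset.sum_le_sum fun e _ => ?_
    have h3 := h1 e.1; have h4 := h1 (nb e.1 e.2)
    revert h3 h4
    generalize (if e.1 ∈ A then k else 0) = p; generalize (if nb e.1 e.2 ∈ A then k else 0) = q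
    intro h3 h4
    simp only [abs_eq_max_neg] at *; omega
  rw [Finset.sum_add_distrib, Finset.sum_add_distrib] at h2
  have h5 : ∀ i : Site → Bool → Site, (∀ b, Function.Injective fun x => i x b) →
      ∑ e ∈ eds L, (if i e.1 e.2 ∈ A then k else 0) ≤ 2 * k * A.card := by
    intro i hi
    rw [← Finset.sum_filter, Finset.sum_const, nsmul_eq_mul]
    have : ((eds L).filter (fun e => i e.1 e.2 ∈ A)).card ≤ (A ×ˢ (Finset.univ : Finset Bool)).card := by
      refine Finset.card_le_card_of_injOn (fun e => (i e.1 e.2, e.2)) (fun e he => ?_) ?_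
      · simpa using (Finset.mem_filter.1 he).2
      · rintro ⟨a, b⟩ _ ⟨c, d⟩ _ hab
        simp only [Prod.mk.injEq] at hab
        obtain ⟨h6, rfl⟩ := hab
        rw [hi b h6]
    rw [Finset.card_product] at this
    simp at this
    have h7 : (((eds L).filter (fun e => i e.1 e.2 ∈ A)).card : ℤ) ≤ A.card * 2 := by exact_mod_cast this
    nlinarith
  have h6 := h5 (fun x _ => x) (fun _ => Function.injective_id)
  have h7 := h5 nb (fun b x y hxy => by
    obtain ⟨x1, x2⟩ := x; obtain ⟨y1, y2⟩ := y
    simp only [nb] at hxy; split_ifs at hxy <;> simp at hxy <;> simp [hxy])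
  simp only [en] at *
  linarith

lemma E1 {β : ℝ} (hβ : 0 ≤ β) {L : ℕ} {V : Finset Site} {n : ℤ} {j : ℕ} :
    ∑ η ∈ (St V 0 n).filter (fun η => ∀ x ∈ V, η x < n),
      w β L η * (Real.exp (-4 * β * ((j : ℝ) + 1)) + 1) ^ (V.filter (fun x => η x = j)).card
      ≤ Real.exp (β * per L V) * sw β L (St V 0 n) := by
  simp only [Finset.mul_sum, ← Finset.sum_pow_mul_eq_add_pow, one_pow, mul_one]
  rw [Finset.sum_sigma', sw, Finset.mul_sum]
  refine sum_inj_le (fun p x => if x ∈ V ∧ x ∉ p.2 then p.1 x + 1 else 0) ?_ ?_ ?_ (fun _ _ => by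
    have := (w_pos β L ‹_›).le; positivity)
  · rintro ⟨η, A⟩ h
    simp only [Finset.mem_sigma, Finset.mem_filter, Finset.mem_powerset, mem_St] at h
    refine mem_St.2 ⟨fun x hx => ?_, fun x hx => by simp [hx]⟩
    have h1 := h.1.1.1 x hx; have h2 := h.1.2 x hx
    dsimp only
    split_ifs <;> omega
  · rintro ⟨η, A⟩ h ⟨η', A'⟩ h' hab
    simp only [Finset.coe_sigma, Set.mem_sigma_iff, Finset.mem_coe, Finset.mem_filter, Finset.mem_powerset, mem_St] at h h'
    have hpt := fun x => congrFun hab x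
    dsimp only at hpt
    have hA : A = A' := by
      ext x
      have hx := hpt x
      have e1 : x ∈ A → x ∈ V := fun hh => (Finset.mem_filter.1 (h.2 hh)).1
      have e2 : x ∈ A' → x ∈ V := fun hh => (Finset.mem_filter.1 (h'.2 hh)).1
      by_cases hV : x ∈ V
      · have h3 := h.1.1.1 x hV; have h4 := h'.1.1.1 x hV
        by_cases ha : x ∈ A <;> by_cases hb : x ∈ A' <;> simp [ha, hb, hV] at hx ⊢ <;> omega
      · tauto
    subst hA
    have : η = η' := by
      ext x
      have hx := hpt x
      by_cases hV : x ∈ V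
      · by_cases ha : x ∈ A
        · rw [(Finset.mem_filter.1 (h.2 ha)).2, (Finset.mem_filter.1 (h'.2 ha)).2]
        · simpa [ha, hV] using hx
      · rw [h.1.1.2 x hV, h'.1.1.2 x hV]
    rw [this]
  · rintro ⟨η, A⟩ h
    simp only [Finset.mem_sigma, Finset.mem_filter, Finset.mem_powerset, mem_St] at h
    dsimp only
    set σ : Config := fun x => if x ∈ V ∧ x ∉ A then η x + 1 else 0 with hσ
    set η' : Config := fun x => if x ∈ V then η x + 1 else 0 with hη'
    have h1 : en L σ ≤ en L η' + 4 * ((j : ℤ) + 1) * A.card := by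
      refine en_mod (by positivity) (fun x hx => ?_) (fun x hx => ?_)
      · simp [hσ, hη', hx]
      · have := Finset.mem_filter.1 (h.2 hx)
        simp only [hσ, hη', hx, this.1, this.2, not_true, and_false, if_false, if_true, zero_sub, abs_neg]
        rw [abs_of_nonneg (by positivity)]
    have h2 : en L η' ≤ en L η + per L V := by
      rw [en, en, per, bd, Finset.card_filter, Nat.cast_sum, ← Finset.sum_add_distrib]
      refine Finset.sum_le_sum fun e _ => ?_
      have a1 := h.1.1.2 e.1; have a2 := h.1.1.2 (nb e.1 e.2)
      simp only [hη', abs_eq_max_neg]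
      by_cases b1 : e.1 ∈ V <;> by_cases b2 : nb e.1 e.2 ∈ V <;> simp [b1, b2] at a1 a2 ⊢ <;> omega
    have h3 : (en L σ : ℝ) ≤ en L η + per L V + 4 * ((j : ℝ) + 1) * A.card := by exact_mod_cast (by push_cast; linarith)
    rw [w, w, ← Real.exp_nat_mul, ← Real.exp_add, ← Real.exp_add]
    refine Real.exp_le_exp.2 ?_
    nlinarith [mul_le_mul_of_nonneg_left h3 hβ]

lemma E1_tail {β : ℝ} (hβ : 0 ≤ β) {L : ℕ} {V : Finset Site} {n : ℤ} {j : ℕ} (y : ℝ) :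
    sw β L ((St V 0 n).filter (fun η => (∀ x ∈ V, η x < n) ∧ y ≤ (V.filter (fun x => η x = j)).card)) ≤
      Real.exp (β * per L V - y * Real.exp (-4 * β * ((j : ℝ) + 1)) / 2) * sw β L (St V 0 n) := by
  set t := Real.exp (-4 * β * ((j : ℝ) + 1)) with ht
  have ht0 : 0 < t := Real.exp_pos _
  have ht1 : t ≤ 1 := Real.exp_le_one_iff.2 (by nlinarith [(Nat.cast_nonneg j : (0 : ℝ) ≤ j)])
  have hE := E1 hβ (L := L) (V := V) (n := n) (j := j)
  rw [← ht] at hE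
  have h1 : Real.exp (y * t / 2) * sw β L ((St V 0 n).filter (fun η => (∀ x ∈ V, η x < n) ∧
      y ≤ (V.filter (fun x => η x = j)).card)) ≤ Real.exp (β * per L V) * sw β L (St V 0 n) := by
    refine le_trans ?_ hE
    rw [sw, Finset.mul_sum]
    refine (Finset.sum_le_sum (g := fun η => w β L η * (t + 1) ^ (V.filter (fun x => η x = j)).card) fun η hη => ?_).trans
      (Finset.sum_le_sum_of_subset_of_nonneg ?_ fun _ _ _ => ?_)
    · rw [mul_comm]
      refine mul_le_mul_of_nonneg_left ?_ (w_pos _ _ _).le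
      have h2 : Real.exp (t / 2) ≤ t + 1 := by
        have h3 := Real.abs_exp_sub_one_le (x := t / 2) (by rw [abs_of_pos (by linarith)]; linarith)
        rw [abs_of_pos (by linarith : 0 < t / 2)] at h3
        linarith [le_abs_self (Real.exp (t / 2) - 1)]
      refine le_trans ?_ (pow_le_pow_left₀ (Real.exp_pos _).le h2 _)
      rw [← Real.exp_nat_mul]
      refine Real.exp_le_exp.2 ?_
      have := (Finset.mem_filter.1 hη).2.2
      nlinarith
    · intro η hη
      rw [Finset.mem_filter] at hη ⊢
      exact ⟨hη.1, hη.2.1⟩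
    · exact mul_nonneg (w_pos _ _ _).le (by positivity)
  rw [Real.exp_sub, div_mul_eq_mul_div, le_div_iff₀ (Real.exp_pos _)]
  linarith

/-! dynamics -/
def up (η : Config) (x : Site) (v : ℤ) : Config := Function.update η x v
def zx (β : ℝ) (L n : ℕ) (x : Site) (η : Config) : ℝ := ∑ v ∈ Finset.Icc (0 : ℤ) n, w β L (up η x v)
def Tx (β : ℝ) (L n : ℕ) (x : Site) (f : Config → ℝ) (η : Config) : ℝ :=
  (∑ v ∈ Finset.Icc (0 : ℤ) n, w β L (up η x v) * f (up η x v)) / zx β L n x η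
def Pk (β : ℝ) (L n : ℕ) (V : Finset Site) (f : Config → ℝ) (η : Config) : ℝ :=
  ((L : ℝ) ^ 2)⁻¹ * (((L : ℝ) ^ 2 - V.card) * f η + ∑ x ∈ V, Tx β L n x f η)

lemma up_self (η : Config) (x : Site) : up η x (η x) = η := Function.update_eq_self _ _
lemma up_up (η : Config) (x : Site) (u v : ℤ) : up (up η x u) x v = up η x v := Function.update_idem _ _ _
lemma up_at (η : Config) (x : Site) (v : ℤ) : up η x v x = v := Function.update_self _ _ _
lemma up_ne (η : Config) {x y : Site} (v : ℤ) (h : y ≠ x) : up η x v y = η y := Function.update_of_ne h _ _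

lemma zx_pos (β : ℝ) (L n : ℕ) (x : Site) (η : Config) : 0 < zx β L n x η :=
  Finset.sum_pos (fun _ _ => w_pos _ _ _) ⟨0, by simp⟩

lemma Tx_add (β : ℝ) (L n : ℕ) (x : Site) (f g : Config → ℝ) (a b : ℝ) (η : Config) :
    Tx β L n x (fun η => a * f η + b * g η) η = a * Tx β L n x f η + b * Tx β L n x g η := by
  simp only [Tx, mul_add, Finset.sum_add_distrib, add_div, ← mul_div_assoc, Finset.mul_sum]
  congr 2 <;> exact Finset.sum_congr rfl fun _ _ => by ring

lemma Tx_const (β : ℝ) (L n : ℕ) (x : Site) (c : ℝ) (η : Config) : Tx β L n x (fun _ => c) η = c := by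
  rw [Tx, ← Finset.sum_mul, ← zx, mul_div_assoc, mul_comm, div_mul_cancel₀ _ (zx_pos _ _ _ _ _).ne']

lemma Tx_le {β : ℝ} {L n : ℕ} {x : Site} {f g : Config → ℝ} {η : Config}
    (h : ∀ v : ℤ, 0 ≤ v → v ≤ n → f (up η x v) ≤ g (up η x v)) : Tx β L n x f η ≤ Tx β L n x g η := by
  refine div_le_div_of_nonneg_right (Finset.sum_le_sum fun v hv => ?_) (zx_pos _ _ _ _ _).le
  rw [Finset.mem_Icc] at hv
  exact mul_le_mul_of_nonneg_left (h v hv.1 hv.2) (w_pos _ _ _).le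

lemma Pk_add (β : ℝ) (L n : ℕ) (V : Finset Site) (f g : Config → ℝ) (a b : ℝ) :
    Pk β L n V (fun η => a * f η + b * g η) = fun η => a * Pk β L n V f η + b * Pk β L n V g η := by
  funext η
  simp only [Pk, Tx_add, Finset.sum_add_distrib, ← Finset.mul_sum]; ring

lemma Pk_const (β : ℝ) {L n : ℕ} (hL : 0 < L) (V : Finset Site) (c : ℝ) :
    Pk β L n V (fun _ => c) = fun _ => c := by
  funext η
  have : (L : ℝ) ≠ 0 := by positivity
  simp only [Pk, Tx_const, Finset.sum_const, nsmul_eq_mul]; field_simp; ring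

lemma Pk_iter_add (β : ℝ) (L n : ℕ) (V : Finset Site) (f g : Config → ℝ) (a b : ℝ) (t : ℕ) :
    (Pk β L n V)^[t] (fun η => a * f η + b * g η) =
      fun η => a * (Pk β L n V)^[t] f η + b * (Pk β L n V)^[t] g η := by
  induction t with
  | zero => rfl
  | succ t ih => simp only [Function.iterate_succ', Function.comp, ih, Pk_add]

lemma Pk_iter_const (β : ℝ) {L n : ℕ} (hL : 0 < L) (V : Finset Site) (c : ℝ) (t : ℕ) :
    (Pk β L n V)^[t] (fun _ => c) = fun _ => c := by
  induction t with
  | zero => rfl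
  | succ t ih => rw [Function.iterate_succ', Function.comp, ih, Pk_const β hL]

lemma card_le_sq {L : ℕ} {V : Finset Site} (hV : V ⊆ box L) : (V.card : ℝ) ≤ (L : ℝ) ^ 2 := by
  exact_mod_cast card_box L ▸ Finset.card_le_card hV

/-- one step comparison of arbitrary functions -/
lemma Pk_le {β : ℝ} {L n : ℕ} {V : Finset Site} (hV : V ⊆ box L) {f g : Config → ℝ} {η : Config} (h0 : f η ≤ g η)
    (h : ∀ x ∈ V, ∀ v : ℤ, 0 ≤ v → v ≤ n → f (up η x v) ≤ g (up η x v)) : Pk β L n V f η ≤ Pk β L n V g η := by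
  refine mul_le_mul_of_nonneg_left (add_le_add (mul_le_mul_of_nonneg_left h0 ?_)
    (Finset.sum_le_sum fun x hx => Tx_le (h x hx))) (by positivity)
  linarith [card_le_sq hV]

lemma up_mem {V : Finset Site} {j : ℤ} {n : ℕ} {η : Config} (hη : η ∈ St V j n) {x : Site} (hx : x ∈ V) {v : ℤ}
    (h0 : 0 ≤ v) (h1 : v ≤ n) : up η x v ∈ St V j n := by
  rw [mem_St] at *
  refine ⟨fun y hy => ?_, fun y hy => ?_⟩
  · by_cases h : y = x
    · rw [h, up_at]; exact ⟨h0, h1⟩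
    · rw [up_ne _ _ h]; exact hη.1 y hy
  · rw [up_ne _ _ (fun h => hy (by rw [h]; exact hx))]; exact hη.2 y hy

lemma Pk_iter_le {β : ℝ} {L n : ℕ} {V : Finset Site} (hV : V ⊆ box L) {f g : Config → ℝ} {j : ℤ}
    (h : ∀ η ∈ St V j n, f η ≤ g η) (t : ℕ) : ∀ η ∈ St V j n, (Pk β L n V)^[t] f η ≤ (Pk β L n V)^[t] g η := by
  induction t with
  | zero => exact h
  | succ t ih =>
    intro η hη
    simp only [Function.iterate_succ', Function.comp]
    exact Pk_le hV (ih η hη) fun x hx v h0 h1 => ih _ (up_mem hη hx h0 h1)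

lemma sum_up (η : Config) (x : Site) (n : ℕ) (F : Config → ℝ) :
    ∑ σ ∈ (Finset.Icc (0 : ℤ) n).image (up η x), F σ = ∑ v ∈ Finset.Icc (0 : ℤ) n, F (up η x v) :=
  Finset.sum_image fun a _ b _ h => by simpa [up_at] using congrFun h x

lemma Tx_mono {β : ℝ} (hβ : 0 ≤ β) {L n n' : ℕ} (hn : n ≤ n') {x : Site} {f : Config → ℝ} (hf : Monotone f)
    (hf0 : ∀ η, 0 ≤ f η) {η η' : Config} (h : η ≤ η') : Tx β L n x f η ≤ Tx β L n' x f η' := by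
  have key := dom hβ (L := L) (f := f) (S1 := (Finset.Icc (0 : ℤ) n).image (up η x))
    (S2 := (Finset.Icc (0 : ℤ) n').image (up η' x)) (by
      intro a ha b hb
      obtain ⟨v, hv, rfl⟩ := Finset.mem_image.1 ha
      obtain ⟨u, hu, rfl⟩ := Finset.mem_image.1 hb
      rw [Finset.mem_Icc] at hv hu
      refine ⟨Finset.mem_image.2 ⟨v ⊓ u, Finset.mem_Icc.2 (by omega), ?_⟩,
        Finset.mem_image.2 ⟨v ⊔ u, Finset.mem_Icc.2 (by omega), ?_⟩⟩
      · funext y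
        by_cases hy : y = x
        · subst hy; simp [up_at]
        · simpa [up_ne, hy] using h y
      · funext y
        by_cases hy : y = x
        · subst hy; simp [up_at]
        · simpa [up_ne, hy] using h y) hf0 (fun a _ b _ hab => hf hab)
  rw [sum_up, sum_up, sw, sw, sum_up, sum_up] at key
  rw [Tx, Tx, div_le_div_iff₀ (zx_pos _ _ _ _ _) (zx_pos _ _ _ _ _)]
  simp only [zx]; linarith

lemma Pk_mono {β : ℝ} (hβ : 0 ≤ β) {L n : ℕ} {V : Finset Site} (hV : V ⊆ box L) {f : Config → ℝ} (hf : Monotone f)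
    (hf0 : ∀ η, 0 ≤ f η) (t : ℕ) : Monotone ((Pk β L n V)^[t] f) ∧ ∀ η, 0 ≤ (Pk β L n V)^[t] f η := by
  have hc := card_le_sq hV
  induction t with
  | zero => exact ⟨hf, hf0⟩
  | succ t ih =>
    simp only [Function.iterate_succ', Function.comp]
    refine ⟨fun η η' h => ?_, fun η => ?_⟩
    · refine mul_le_mul_of_nonneg_left (add_le_add (mul_le_mul_of_nonneg_left (ih.1 h) (by linarith))
        (Finset.sum_le_sum fun x hx => Tx_mono hβ le_rfl ih.1 ih.2 h)) (by positivity)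
    · refine mul_nonneg (by positivity) (add_nonneg (mul_nonneg (by linarith) (ih.2 η))
        (Finset.sum_nonneg fun x _ => div_nonneg (Finset.sum_nonneg fun v _ => ?_) (zx_pos _ _ _ _ _).le))
      exact mul_nonneg (w_pos _ _ _).le (ih.2 _)

lemma Pk_comp {β : ℝ} (hβ : 0 ≤ β) {L n n' : ℕ} (hn : n ≤ n') {Q V : Finset Site} (hQ : Q ⊆ V) (hV : V ⊆ box L)
    {f : Config → ℝ} (hf : Monotone f) (hf0 : ∀ η, 0 ≤ f η) (t : ℕ) :
    ∀ η ∈ St Q 0 n, (Pk β L n Q)^[t] f η ≤ (Pk β L n' V)^[t] f η := by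
  induction t with
  | zero => exact fun _ _ => le_rfl
  | succ t ih =>
    intro η hη
    simp only [Function.iterate_succ', Function.comp]
    set F := (Pk β L n' V)^[t] f
    set G := (Pk β L n Q)^[t] f
    obtain ⟨hF, hF0⟩ : Monotone F ∧ ∀ η, 0 ≤ F η := Pk_mono hβ hV hf hf0 t
    have hc := card_le_sq hV
    have h1 : ∑ x ∈ Q, Tx β L n x G η ≤ ∑ x ∈ Q, Tx β L n' x F η := Finset.sum_le_sum fun x hx =>
      (Tx_le fun v h0 h1 => ih _ (up_mem hη hx h0 h1)).trans (Tx_mono hβ hn hF hF0 le_rfl)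
    have h2 : ((V \ Q).card : ℝ) * G η ≤ ∑ x ∈ V \ Q, Tx β L n' x F η := by
      rw [← nsmul_eq_mul, ← Finset.sum_const]
      refine Finset.sum_le_sum fun x hx => ?_
      rw [← Tx_const β L n' x (G η) η]
      refine Tx_le fun v h0 _ => (ih η hη).trans (hF fun y => ?_)
      by_cases hy : y = x
      · subst hy; rw [up_at, (mem_St.1 hη).2 y (Finset.mem_sdiff.1 hx).2]; exact h0
      · rw [up_ne _ _ hy]
    have h3 := Finset.sum_sdiff hQ (f := fun x => Tx β L n' x F η)
    have h4 : ((V \ Q).card : ℝ) = V.card - Q.card := by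
      rw [Finset.card_sdiff_of_subset hQ, Nat.cast_sub (Finset.card_le_card hQ)]
    rw [h4] at h2
    refine mul_le_mul_of_nonneg_left ?_ (by positivity)
    have h5 := mul_le_mul_of_nonneg_left (ih η hη) (show 0 ≤ (L : ℝ) ^ 2 - V.card by linarith)
    linarith

/-- involution -/
lemma fib {V : Finset Site} {j : ℤ} {n : ℕ} {x : Site} (hx : x ∈ V) (H : Config → ℤ → ℝ) :
    ∑ η ∈ St V j n, ∑ v ∈ Finset.Icc (0 : ℤ) n, H η v =
      ∑ η ∈ St V j n, ∑ v ∈ Finset.Icc (0 : ℤ) n, H (up η x v) (η x) := by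
  rw [← Finset.sum_product', ← Finset.sum_product']
  have hm : ∀ p ∈ St V j n ×ˢ Finset.Icc (0 : ℤ) n, (up p.1 x p.2, p.1 x) ∈ St V j n ×ˢ Finset.Icc (0 : ℤ) n := by
    intro p hp
    rw [Finset.mem_product, Finset.mem_Icc] at hp ⊢
    exact ⟨up_mem hp.1 hx hp.2.1 hp.2.2, (mem_St.1 hp.1).1 x hx⟩
  have hi : ∀ p : Config × ℤ, (up (up p.1 x p.2) x (p.1 x), up p.1 x p.2 x) = p := fun p => by
    rw [up_up, up_self, up_at]
  exact Finset.sum_bij' (fun p _ => (up p.1 x p.2, p.1 x)) (fun p _ => (up p.1 x p.2, p.1 x)) hm hm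
    (fun p _ => hi p) (fun p _ => hi p) (fun p _ => by simp only [up_up, up_self, up_at])

lemma zx_up (β : ℝ) (L n : ℕ) (x : Site) (η : Config) (v : ℤ) : zx β L n x (up η x v) = zx β L n x η := by
  simp only [zx, up_up]

lemma Tx_rev {β : ℝ} {L : ℕ} {V : Finset Site} {j : ℤ} {n : ℕ} {x : Site} (hx : x ∈ V) (f g : Config → ℝ) :
    ∑ η ∈ St V j n, w β L η * (g η * Tx β L n x f η) = ∑ η ∈ St V j n, w β L η * (Tx β L n x g η * f η) := by
  have h := fib (V := V) (j := j) (n := n) hx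
    (fun η v => w β L η * g η * (w β L (up η x v) * f (up η x v)) / zx β L n x η)
  simp only [zx_up, up_up, up_self] at h
  have e1 : ∀ η, w β L η * (g η * Tx β L n x f η) =
      ∑ v ∈ Finset.Icc (0 : ℤ) n, w β L η * g η * (w β L (up η x v) * f (up η x v)) / zx β L n x η := fun η => by
    rw [← Finset.sum_div, ← Finset.mul_sum, Tx]; ring
  have e2 : ∀ η, w β L η * (Tx β L n x g η * f η) =
      ∑ v ∈ Finset.Icc (0 : ℤ) n, w β L (up η x v) * g (up η x v) * (w β L η * f η) / zx β L n x η := fun η => by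
    rw [← Finset.sum_div, ← Finset.sum_mul, Tx]; ring
  simp only [e1, e2, h]

lemma Pk_rev {β : ℝ} {L : ℕ} {V : Finset Site} {j : ℤ} {n : ℕ} (f g : Config → ℝ) :
    ∑ η ∈ St V j n, w β L η * (g η * Pk β L n V f η) = ∑ η ∈ St V j n, w β L η * (Pk β L n V g η * f η) := by
  have h : ∑ x ∈ V, ∑ η ∈ St V j n, w β L η * (g η * Tx β L n x f η) =
      ∑ x ∈ V, ∑ η ∈ St V j n, w β L η * (Tx β L n x g η * f η) := Finset.sum_congr rfl fun x hx => Tx_rev hx f g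
  rw [Finset.sum_comm, Finset.sum_comm (s := V)] at h
  have e1 : ∀ η, w β L η * (g η * Pk β L n V f η) = ((L : ℝ) ^ 2)⁻¹ * (((L : ℝ) ^ 2 - V.card) * (w β L η * (g η * f η)) +
      ∑ x ∈ V, w β L η * (g η * Tx β L n x f η)) := fun η => by
    simp only [← Finset.mul_sum, Pk]; ring
  have e2 : ∀ η, w β L η * (Pk β L n V g η * f η) = ((L : ℝ) ^ 2)⁻¹ * (((L : ℝ) ^ 2 - V.card) * (w β L η * (g η * f η)) +
      ∑ x ∈ V, w β L η * (Tx β L n x g η * f η)) := fun η => by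
    simp only [← Finset.mul_sum, ← Finset.sum_mul, Pk]; ring
  rw [Finset.sum_congr rfl fun η _ => e1 η, Finset.sum_congr rfl fun η _ => e2 η, ← Finset.mul_sum, ← Finset.mul_sum,
    Finset.sum_add_distrib, Finset.sum_add_distrib, h]

lemma Pk_iter_rev {β : ℝ} {L : ℕ} {V : Finset Site} {j : ℤ} {n : ℕ} (t : ℕ) (f g : Config → ℝ) :
    ∑ η ∈ St V j n, w β L η * (g η * (Pk β L n V)^[t] f η) =
      ∑ η ∈ St V j n, w β L η * ((Pk β L n V)^[t] g η * f η) := by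
  induction t generalizing f g with
  | zero => rfl
  | succ t ih =>
    have h1 := ih (Pk β L n V f) g
    rw [Pk_rev] at h1
    rw [Function.iterate_succ, Function.comp, h1, ← Function.comp_apply (f := Pk β L n V), ← Function.iterate_succ',
      Function.iterate_succ, Function.comp]

lemma zero_mem_St (V : Finset Site) (n : ℕ) : (0 : Config) ∈ St V 0 n :=
  mem_St.2 ⟨fun _ _ => by simp, fun _ _ => rfl⟩

lemma w_zero (β : ℝ) (L : ℕ) : w β L 0 = 1 := by simp [w, en]

/-- law at time t as a function -/
def gam (β : ℝ) (L n : ℕ) (V : Finset Site) (t : ℕ) : Config → ℝ := (Pk β L n V)^[t] (fun η => if η = 0 then 1 else 0)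

lemma gam_sum (β : ℝ) (L n : ℕ) (V : Finset Site) (t : ℕ) (f : Config → ℝ) :
    (Pk β L n V)^[t] f 0 = ∑ η ∈ St V 0 n, w β L η * (gam β L n V t η * f η) := by
  rw [gam, ← Pk_iter_rev]
  simp [zero_mem_St, w_zero]

lemma Pk_iter_stat {β : ℝ} {L n : ℕ} (hL : 0 < L) {V : Finset Site} {j : ℤ} (t : ℕ) (f : Config → ℝ) :
    ∑ η ∈ St V j n, w β L η * (Pk β L n V)^[t] f η = ∑ η ∈ St V j n, w β L η * f η := by
  have := Pk_iter_rev (β := β) (L := L) (V := V) (j := j) (n := n) t f (fun _ => 1)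
  simpa [Pk_iter_const β hL] using this

lemma zero_le_St {V : Finset Site} {n : ℕ} {η : Config} (h : η ∈ St V 0 n) : 0 ≤ η := fun x => by
  by_cases hx : x ∈ V
  · exact ((mem_St.1 h).1 x hx).1
  · exact ((mem_St.1 h).2 x hx).ge

lemma law_le_eq {β : ℝ} (hβ : 0 ≤ β) {L n : ℕ} (hL : 0 < L) {V : Finset Site} (hV : V ⊆ box L) {f : Config → ℝ}
    (hf : Monotone f) (hf0 : ∀ η, 0 ≤ f η) (t : ℕ) :
    (Pk β L n V)^[t] f 0 * sw β L (St V 0 n) ≤ ∑ η ∈ St V 0 n, w β L η * f η := by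
  rw [← Pk_iter_stat hL t, sw, mul_comm, Finset.sum_mul]
  exact Finset.sum_le_sum fun η hη => mul_le_mul_of_nonneg_left
    ((Pk_mono hβ hV hf hf0 t).1 (zero_le_St hη)) (w_pos _ _ _).le

lemma Pk_pair (β : ℝ) {L n : ℕ} {V : Finset Site} (hV : V ⊆ box L) (t : ℕ) {f : Config → ℝ}
    (hf : ∀ η, 0 ≤ f η) : ∀ η ∈ St V 0 n, 0 ≤ (Pk β L n V)^[t] f η := by
  intro η hη
  have h := Pk_iter_le (β := β) (n := n) hV (f := fun _ => 0) (g := f) (j := 0) (fun η _ => hf η) t η hη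
  rcases Nat.eq_zero_or_pos L with rfl | hL
  · have : V = ∅ := Finset.subset_empty.1 (hV.trans (by simp [box]))
    have hz : ∀ t, (Pk β 0 n V)^[t] (fun _ => (0 : ℝ)) = fun _ => 0 := fun t => by
      induction t with
      | zero => rfl
      | succ t ih => rw [Function.iterate_succ', Function.comp, ih]; funext η; simp [Pk, Tx_const]
    rwa [hz] at h
  · rwa [Pk_iter_const β hL] at h

section
attribute [local irreducible] w St

/-! lower bound on the hitting time -/
def Ah (L j : ℕ) (η : Config) : Set Site := {z | z ∈ box L ∧ (j : ℤ) + 1 ≤ η z}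
def clu (L j : ℕ) (η : Config) (x : Site) : Finset Site := (box L).filter (fun y => Reach (Ah L j η) x y)
def Dl (L j r N : ℕ) : Finset Config :=
  (St (box L) 0 N).filter (fun η => ∀ x ∈ box L, (cols (clu L j η x)).card ≤ r)
def EW (j : ℕ) (W : Finset Site) (η : Config) : Prop :=
  ∀ y z, SiteAdj y z → y ∈ W → z ∉ W → (j : ℤ) + 1 ≤ η y ∧ η z ≤ j
def Nh (L j : ℕ) (η : Config) : ℕ := ((box L).filter (fun x => (j : ℤ) + 1 ≤ η x)).card

lemma glue_Dl {L j r N : ℕ} {η g : Config} {W : Finset Site} (hW : Cc L W) (hη : η ∈ Dl L j r N) (hE : EW j W η)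
    (hc : (cols W).card ≤ r) (hg : g ∈ St W (j : ℤ) N) : glue W g η ∈ Dl L j r N := by
  rw [Dl, Finset.mem_filter, mem_St] at *
  refine ⟨⟨fun x hx => ?_, fun x hx => ?_⟩, fun x hx => ?_⟩
  · by_cases h : x ∈ W
    · simpa [glue, h] using hg.1 x h
    · simpa [glue, h] using hη.1.1 x hx
  · have h : x ∉ W := fun h => hx (hW.sub h)
    simpa [glue, h] using hη.1.2 x hx
  · by_cases h : x ∈ W
    · refine (cols_mono fun y hy => ?_).trans hc
      refine reach_const (Finset.mem_filter.1 hy).2 (P := fun y => y ∈ W) (fun a b hab _ hb ha => ?_) h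
      by_contra hbW
      have h1 := (hE a b hab ha hbW).2
      have h2 := hb.2
      simp only [glue, hbW, if_false] at h2
      omega
    · refine (cols_mono (V := clu L j η x) fun y hy => ?_).trans (hη.2 x hx)
      rw [clu, Finset.mem_filter] at hy ⊢
      refine ⟨hy.1, (reach_const hy.2 (P := fun y => y ∉ W ∧ Reach (Ah L j η) x y) (fun a b hab ha hb h3 => ?_)
        ⟨h, Relation.ReflTransGen.refl⟩).2⟩
      have h2 : (j : ℤ) + 1 ≤ η a := by simpa [glue, h3.1] using ha.2
      have hbW : b ∉ W := fun hbW => by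
        have := (hE b a hab.symm hbW h3.1).2
        omega
      exact ⟨hbW, h3.2.trans (Reach.one hab ⟨ha.1, h2⟩ ⟨hb.1, by simpa [glue, hbW] using hb.2⟩)⟩

lemma tilt_fin {β A X Z B C : ℝ} {k : ℕ} (hZ : 1 ≤ Z) (hB0 : 0 ≤ B) (hB : B ≤ Real.exp k * Z) (hX : 0 ≤ X)
    (hC : C ≤ Real.exp k) (hs : A * Z ≤ Real.exp (-β * k) * B * (C * X)) : A ≤ Real.exp (2 - β) ^ k * X := by
  have h1 := mul_le_mul_of_nonneg_right hC hX
  have e := Real.exp_pos (k : ℝ)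
  refine le_of_mul_le_mul_right (hs.trans (?_ : _ ≤ Real.exp (-β * k) * (Real.exp k * Z) * (Real.exp k * X) ) |>.trans (le_of_eq ?_))
    (by linarith : (0 : ℝ) < Z)
  · refine (mul_le_mul_of_nonneg_left h1 (mul_nonneg (Real.exp_pos _).le hB0)).trans
      (mul_le_mul_of_nonneg_right (mul_le_mul_of_nonneg_left hB (Real.exp_pos _).le) (by positivity))
  · have : Real.exp (2 - β) ^ k = Real.exp (-β * k) * Real.exp k * Real.exp k := by
      rw [← Real.exp_add, ← Real.exp_add, ← Real.exp_nat_mul]; congr 1; ring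
    rw [this]; ring

lemma tilt_arith {θ r p c : ℝ} (h0 : 0 ≤ θ) (hθ : θ * r ≤ 2) (h3 : 0 ≤ p) (h1 : 2 * c ≤ r * p) : θ * c ≤ p := by
  nlinarith [mul_le_mul_of_nonneg_left h1 h0, mul_le_mul_of_nonneg_right hθ h3]

set_option maxHeartbeats 800000 in
lemma tilt_term {β : ℝ} (hβ : 60 ≤ β) {L K N j r : ℕ} (hN : Big β L K N) (hj : j + 1 ≤ K)
    (hr : 2 * Real.exp (-4 * β * ((j + 1 : ℕ) : ℝ)) * r ≤ 1) {θ : ℝ} (h0 : 0 ≤ θ) (hθ : θ * r ≤ 2)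
    {W : Finset Site} (hW : Cc L W) (hc : (cols W).card ≤ r) :
    ∑ η ∈ (Dl L j r N).filter (EW j W), w β L η * Real.exp (θ * Nh L j η) ≤
      Real.exp (2 - β) ^ per L W * ∑ η ∈ Dl L j r N, w β L η * Real.exp (θ * Nh L j η) := by
  have hs := swap (by linarith : (0 : ℝ) ≤ β) (L := L) (W := W) (p := ((j + 1 : ℕ) : ℤ)) (q := (j : ℤ)) (n := N)
    (D := (Dl L j r N).filter (EW j W)) (D' := Dl L j r N) (B := St W ((j + 1 : ℕ) : ℤ) N)
    (u := fun η => Real.exp (θ * Nh L j η)) (C := Real.exp (θ * W.card)) (fun _ => (Real.exp_pos _).le) (by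
      intro η hη y z h1 h2 h3 v
      have := (Finset.mem_filter.1 hη).2 y z h1 h2 h3
      push_cast
      simp only [abs_eq_max_neg]; omega) (by
      intro η hη
      have h1 := (mem_St.1 (Finset.mem_filter.1 (Finset.mem_filter.1 hη).1).1)
      refine mem_St.2 ⟨fun y hy => ?_, fun y hy => by simp [glue, hy]⟩
      simpa [glue, hy] using h1.1 y (hW.sub hy)) (by
      intro η hη g hg
      rw [Finset.mem_filter] at hη
      exact glue_Dl hW hη.1 hη.2 hc hg) (by
      intro η hη g hg
      rw [← Real.exp_add]
      refine Real.exp_le_exp.2 ?_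
      rw [← mul_add]
      refine mul_le_mul_of_nonneg_left ?_ h0
      have : Nh L j η ≤ W.card + Nh L j (glue W g η) := by
        rw [Nh, Nh]
        refine (Finset.card_le_card ?_).trans (Finset.card_union_le _ _)
        intro x hx
        rw [Finset.mem_filter] at hx
        rw [Finset.mem_union, Finset.mem_filter]
        by_cases h : x ∈ W
        · exact Or.inl h
        · refine Or.inr ⟨hx.1, ?_⟩
          simpa [glue, h] using hx.2
      exact_mod_cast this) (Real.exp_pos _).le
  have hKN : (K : ℤ) ≤ N := by exact_mod_cast hN.1
  have hZW : 1 ≤ sw β L (St W (j : ℤ) N) := one_le_sw (by positivity) (by omega)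
  have hR := ZR' hβ hN hj hW hr hc
  have hX : 0 ≤ ∑ η ∈ Dl L j r N, w β L η * Real.exp (θ * Nh L j η) :=
    Finset.sum_nonneg fun η _ => mul_nonneg (w_pos _ _ _).le (Real.exp_pos _).le
  have hC : Real.exp (θ * W.card) ≤ Real.exp (per L W) := Real.exp_le_exp.2 (by
    have h1 : (2 : ℝ) * W.card ≤ r * per L W := by exact_mod_cast two_card_le hW.sub hc
    exact tilt_arith h0 hθ (Nat.cast_nonneg _) h1)
  exact tilt_fin hZW (sw_nonneg _ _ _) hR hX hC hs

lemma ctr_exists {L j r N : ℕ} (hL : 0 < L) {η : Config} (hη : η ∈ Dl L j r N) {x : Site} (hx : x ∈ Ah L j η) :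
    ∃ W ∈ (Cn L x).filter (fun W => (cols W).card ≤ r), EW j W η ∧ (cols (clu L j η x)).card ≤ (cols W).card := by
  have hbox : Cc L (box L) := by
    have : box L = rect 1 L 1 L := by ext x; rw [mem_box, mem_rect]; omega
    rw [this]; exact cc_rect (by omega) (by omega) (by omega) (by omega) (by omega) (by omega)
  have hsub : {z | Reach (Ah L j η) x z} ⊆ (Ah L j η) := fun z hz => Reach.mem hz hx
  obtain ⟨W, h1, h2, h3, h4, h5⟩ := ctr hbox (A := {z | Reach (Ah L j η) x z}) (fun z hz => (hsub hz).1)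
    (x := x) Relation.ReflTransGen.refl
  have h6 : clu L j η x ⊆ W := fun y hy => h5 y (Reach.self (Finset.mem_filter.1 hy).2)
  have h7 : cols W ⊆ cols (clu L j η x) := by
    intro c hc
    obtain ⟨y, hy, rfl⟩ := Finset.mem_image.1 hc
    obtain ⟨⟨z, hz, hz1, hz2⟩, -⟩ := exists_top W true hy
    have h8 := (h4 z _ (adj_nb z true) hz hz1).1
    rw [← (show z.1 = y.1 by simpa using hz2)]
    exact Finset.mem_image_of_mem _ (Finset.mem_filter.2 ⟨h3 hz, h8⟩)
  rw [Dl, Finset.mem_filter] at hη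
  refine ⟨W, Finset.mem_filter.2 ⟨mem_Cn.2 ⟨h1, h2⟩, (Finset.card_le_card h7).trans (hη.2 x hx.1)⟩,
    fun y z hyz hy hz => ?_, cols_mono h6⟩
  obtain ⟨h8, h9⟩ := h4 y z hyz hy hz
  refine ⟨(hsub h8).2, ?_⟩
  by_cases hzb : z ∈ box L
  · by_contra hc
    exact h9 (Relation.ReflTransGen.tail h8 ⟨hyz, hsub h8, hzb, by omega⟩)
  · rw [(mem_St.1 hη.1).2 z hzb]; positivity

lemma q2_le {β : ℝ} (hβ : 60 ≤ β) : 1250 * Real.exp (2 - β) ≤ Real.exp (-1) / 10 := by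
  have h1 : Real.exp (2 - β) = Real.exp 1 * Real.exp 1 * Real.exp 1 * Real.exp (-1) * Real.exp (-β) := by
    rw [← Real.exp_add, ← Real.exp_add, ← Real.exp_add, ← Real.exp_add]; ring_nf
  have h3 := q_le hβ
  have h4 := Real.exp_pos (-β)
  have h5 : Real.exp 1 ≤ 3 := by linarith [Real.exp_one_lt_d9]
  have h6 := Real.exp_pos 1
  rw [h1]
  calc 1250 * (Real.exp 1 * Real.exp 1 * Real.exp 1 * Real.exp (-1) * Real.exp (-β))
      ≤ 1250 * (3 * 3 * 3 * Real.exp (-1) * (1 / 2) ^ 60) := by gcongr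
    _ = Real.exp (-1) * (1250 * 27 * (1 / 2) ^ 60) := by ring
    _ ≤ Real.exp (-1) * (1 / 10) := by gcongr; norm_num
    _ = _ := by ring

lemma q2_half {β : ℝ} (hβ : 60 ≤ β) : 1250 * Real.exp (2 - β) ≤ 1 / 10 := by
  have := q2_le hβ
  have : Real.exp (-1) ≤ 1 := Real.exp_le_one_iff.2 (by norm_num)
  linarith

/-- equilibrium in D: few high points -/
lemma Dl_few {β : ℝ} (hβ : 60 ≤ β) {L K N j r : ℕ} (hN : Big β L K N) (hj : j + 1 ≤ K) (hL : 0 < L)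
    (hr : 2 * Real.exp (-4 * β * ((j + 1 : ℕ) : ℝ)) * r ≤ 1) {θ : ℝ} (h0 : 0 ≤ θ) (hθ : θ * r ≤ 2) :
    sw β L ((Dl L j r N).filter (fun η => (9 / 10 : ℝ) * L ^ 2 < Nh L j η)) ≤
      Real.exp (-(θ * L ^ 2 / 2)) * sw β L (Dl L j r N) := by
  set M1 := ∑ η ∈ Dl L j r N, w β L η * Real.exp (θ * Nh L j η) with hM1
  have hM0 : 0 ≤ M1 := Finset.sum_nonneg fun η _ => mul_nonneg (w_pos _ _ _).le (Real.exp_pos _).le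
  have hpt : ∀ x ∈ box L, ∑ η ∈ (Dl L j r N).filter (fun η => (j : ℤ) + 1 ≤ η x), w β L η * Real.exp (θ * Nh L j η) ≤
      1 / 10 * M1 := by
    intro x hx
    have hcov := sum_cover (f := fun η => w β L η * Real.exp (θ * Nh L j η))
      (fun η => mul_nonneg (w_pos _ _ _).le (Real.exp_pos _).le)
      (F := (Dl L j r N).filter (fun η => (j : ℤ) + 1 ≤ η x)) (T := (Cn L x).filter (fun W => (cols W).card ≤ r))
      (D := fun W => (Dl L j r N).filter (EW j W)) (by
        intro η hη
        rw [Finset.mem_filter] at hη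
        obtain ⟨W, h1, h2, -⟩ := ctr_exists hL hη.1 (x := x) ⟨hx, hη.2⟩
        exact ⟨W, h1, Finset.mem_filter.2 ⟨hη.1, h2⟩⟩)
    refine hcov.trans ((Finset.sum_le_sum fun W hW => ?_).trans (?_ : ∑ W ∈ (Cn L x).filter (fun W => (cols W).card ≤ r),
      Real.exp (2 - β) ^ per L W * M1 ≤ _))
    · rw [Finset.mem_filter, mem_Cn] at hW
      exact tilt_term hβ hN hj hr h0 hθ hW.1.1 hW.2
    · rw [← Finset.sum_mul]
      refine mul_le_mul_of_nonneg_right ?_ hM0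
      have hq := q2_half hβ
      refine (sum_cn (L := L) x 4 (Real.exp_pos _).le (by linarith) (fun W hW => ?_)).trans ?_
      · have h3 := (Finset.mem_filter.1 hW).1
        exact ⟨h3, per_ge_four (mem_Cn.1 h3).1⟩
      · calc 2 * (1250 * Real.exp (2 - β)) ^ 4 ≤ 2 * (1 / 10) ^ 4 := by gcongr
          _ ≤ _ := by norm_num
  have hsum : ∑ η ∈ Dl L j r N, w β L η * Real.exp (θ * Nh L j η) * Nh L j η ≤ 1 / 10 * L ^ 2 * M1 := by
    calc _ = ∑ x ∈ box L, ∑ η ∈ (Dl L j r N).filter (fun η => (j : ℤ) + 1 ≤ η x), w β L η * Real.exp (θ * Nh L j η) := by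
          simp only [Finset.sum_filter]
          rw [Finset.sum_comm]
          refine Finset.sum_congr rfl fun η _ => ?_
          rw [← Finset.sum_filter, Finset.sum_const, nsmul_eq_mul, mul_comm, Nh]
      _ ≤ ∑ x ∈ box L, 1 / 10 * M1 := Finset.sum_le_sum hpt
      _ = _ := by rw [Finset.sum_const, card_box, nsmul_eq_mul]; push_cast; ring
  set s := θ * (1 / 10 * (L : ℝ) ^ 2) with hs
  have hJ : Real.exp (-s) * M1 ≤ sw β L (Dl L j r N) := by
    have h1 : ∑ η ∈ Dl L j r N, Real.exp (-s) * (w β L η * Real.exp (θ * Nh L j η) * (1 + s) -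
        θ * (w β L η * Real.exp (θ * Nh L j η) * Nh L j η)) ≤ sw β L (Dl L j r N) := by
      refine Finset.sum_le_sum fun η _ => ?_
      have h2 := Real.add_one_le_exp (s - θ * Nh L j η)
      have h3 : Real.exp (-s) * Real.exp (θ * Nh L j η) * Real.exp (s - θ * Nh L j η) = 1 := by
        rw [← Real.exp_add, ← Real.exp_add]; simp
      have h4 := mul_le_mul_of_nonneg_left h2 (mul_nonneg (Real.exp_pos (-s)).le (Real.exp_pos (θ * Nh L j η)).le)
      rw [h3] at h4
      nlinarith [mul_le_mul_of_nonneg_left h4 (w_pos β L η).le]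
    rw [← Finset.mul_sum, Finset.sum_sub_distrib, ← Finset.sum_mul, ← Finset.mul_sum, ← hM1] at h1
    refine le_trans (mul_le_mul_of_nonneg_left ?_ (Real.exp_pos _).le) h1
    have := mul_le_mul_of_nonneg_left hsum h0
    rw [hs]; linarith
  have hm : Real.exp (θ * (9 / 10 * (L : ℝ) ^ 2)) * sw β L ((Dl L j r N).filter (fun η => (9 / 10 : ℝ) * L ^ 2 < Nh L j η)) ≤ M1 := by
    rw [sw, Finset.mul_sum]
    refine (Finset.sum_le_sum (g := fun η => w β L η * Real.exp (θ * Nh L j η)) fun η hη => ?_).trans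
      (Finset.sum_le_sum_of_subset_of_nonneg (Finset.filter_subset _ _) fun _ _ _ => mul_nonneg (w_pos _ _ _).le (Real.exp_pos _).le)
    rw [mul_comm]
    exact mul_le_mul_of_nonneg_left (Real.exp_le_exp.2 (mul_le_mul_of_nonneg_left (Finset.mem_filter.1 hη).2.le h0))
      (w_pos _ _ _).le
  have hf := (mul_le_mul_of_nonneg_left hm (Real.exp_pos (-s)).le).trans hJ
  rw [← mul_assoc, ← Real.exp_add] at hf
  set X := sw β L ((Dl L j r N).filter (fun η => (9 / 10 : ℝ) * L ^ 2 < Nh L j η))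
  have hX : 0 ≤ X := sw_nonneg _ _ _
  rw [Real.exp_neg, ← div_eq_inv_mul, le_div_iff₀ (Real.exp_pos _), mul_comm]
  refine le_trans (mul_le_mul_of_nonneg_right (Real.exp_le_exp.2 ?_) hX) hf
  rw [hs]
  nlinarith [mul_nonneg h0 (sq_nonneg (L : ℝ))]

lemma clu_split {L j : ℕ} {η : Config} {x x' z : Site} {v : ℤ} (h : Reach (Ah L j (up η x v)) x' z) :
    Reach (Ah L j η) x' z ∨ z = x ∨ ∃ y ∈ nbrs x, Reach (Ah L j η) y z := by
  refine reach_const h (P := fun z => Reach (Ah L j η) x' z ∨ z = x ∨ ∃ y ∈ nbrs x, Reach (Ah L j η) y z)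
    (fun a b hab ha hb hP => ?_) (Or.inl Relation.ReflTransGen.refl)
  by_cases hbx : b = x
  · exact Or.inr (Or.inl hbx)
  by_cases hax : a = x
  · refine Or.inr (Or.inr ⟨b, ?_, Relation.ReflTransGen.refl⟩)
    subst hax
    obtain ⟨a1, a2⟩ := a; obtain ⟨b1, b2⟩ := b
    simp only [SiteAdj, nbrs, Finset.mem_insert, Finset.mem_singleton, Prod.mk.injEq] at *
    omega
  · have hs : Reach (Ah L j η) a b := Reach.one hab ⟨ha.1, by simpa [up_ne _ _ hax] using ha.2⟩
      ⟨hb.1, by simpa [up_ne _ _ hbx] using hb.2⟩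
    rcases hP with h1 | h1 | ⟨y, hy, h1⟩
    · exact Or.inl (h1.trans hs)
    · exact (hax h1).elim
    · exact Or.inr (Or.inr ⟨y, hy, h1.trans hs⟩)

lemma escape {L j r N : ℕ} (hr6 : 6 ≤ r) {η : Config} (hη : η ∈ Dl L j r N) {x : Site} (hx : x ∈ box L) {v : ℤ}
    (h0 : 0 ≤ v) (h1 : v ≤ N) (hn : up η x v ∉ Dl L j r N) :
    ∃ y ∈ Ah L j η, r ≤ 5 * (cols (clu L j η y)).card := by
  have hS := up_mem (Finset.mem_filter.1 hη).1 hx h0 h1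
  rw [Dl, Finset.mem_filter] at hn
  have hn2 : ∃ x' ∈ box L, r < (cols (clu L j (up η x v) x')).card := by
    by_contra hc; push Not at hc; exact hn ⟨hS, hc⟩
  obtain ⟨x', hx', hlt⟩ := hn2
  by_contra hcon
  push Not at hcon
  have hc : ∀ y, 5 * (cols (clu L j η y)).card < r := by
    intro y
    by_cases hy : y ∈ Ah L j η
    · exact hcon y hy
    · have : clu L j η y ⊆ {y} := by
        intro z hz
        have h2 := (Finset.mem_filter.1 hz).2
        rcases Relation.ReflTransGen.cases_head h2 with h3 | ⟨c, h3, -⟩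
        · simp [h3]
        · exact (hy h3.2.1).elim
      have := (cols_mono this).trans (Finset.card_image_le.trans (Finset.card_singleton y).le)
      omega
  have hsub : cols (clu L j (up η x v) x') ⊆ insert x.1 (cols (clu L j η x') ∪
      (nbrs x).biUnion (fun y => cols (clu L j η y))) := by
    intro c hc
    obtain ⟨z, hz, rfl⟩ := Finset.mem_image.1 hc
    rw [clu, Finset.mem_filter] at hz
    rw [Finset.mem_insert, Finset.mem_union, Finset.mem_biUnion]
    rcases clu_split hz.2 with h2 | h2 | ⟨y, hy, h2⟩
    · exact Or.inr (Or.inl (Finset.mem_image_of_mem _ (Finset.mem_filter.2 ⟨hz.1, h2⟩)))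
    · exact Or.inl (by rw [h2])
    · exact Or.inr (Or.inr ⟨y, hy, Finset.mem_image_of_mem _ (Finset.mem_filter.2 ⟨hz.1, h2⟩)⟩)
  have h2 := (Finset.card_le_card hsub).trans ((Finset.card_insert_le _ _).trans
    (Nat.add_le_add_right ((Finset.card_union_le _ _).trans (Nat.add_le_add_left Finset.card_biUnion_le _)) 1))
  have h3 : ∑ y ∈ nbrs x, 5 * (cols (clu L j η y)).card ≤ (nbrs x).card * r := by
    rw [← smul_eq_mul, ← Finset.sum_const]; exact Finset.sum_le_sum fun y _ => (hc y).le
  have h4 : (nbrs x).card ≤ 4 := Finset.card_le_four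
  rw [← Finset.mul_sum] at h3
  have h5 := hc x'
  have h6 : (nbrs x).card * r ≤ 4 * r := Nat.mul_le_mul_right _ h4
  omega

lemma leak {β : ℝ} {L N : ℕ} (hL : 0 < L) {D S : Finset Config} (hS : S = St (box L) 0 (N : ℤ)) (hDS : D ⊆ S)
    {f : Config → ℝ} (hf0 : ∀ η, 0 ≤ f η) (hf1 : ∀ η ∈ S, f η ≤ 1) {esc : ℝ}
    (hesc : esc = sw β L (D.filter (fun η => ∃ x ∈ box L, ∃ v : ℤ, 0 ≤ v ∧ v ≤ N ∧ up η x v ∉ D))) (t : ℕ) :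
    ∑ η ∈ D, w β L η * (Pk β L N (box L))^[t] f η ≤ ∑ η ∈ D, w β L η * f η + t * esc := by
  subst hS
  set S := St (box L) 0 (N : ℤ) with hS
  set d : Config → ℝ := fun η => if η ∈ D then 1 else 0 with hd
  have hd0 : ∀ η, 0 ≤ d η := fun η => by simp only [hd]; positivity
  have hsd : ∀ g : Config → ℝ, ∑ η ∈ S, w β L η * (d η * g η) = ∑ η ∈ D, w β L η * g η := fun g => by
    simp only [hd, ite_mul, one_mul, zero_mul, mul_ite, mul_zero]
    rw [← Finset.sum_filter, Finset.filter_mem_eq_inter, Finset.inter_eq_right.2 hDS]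
  induction t with
  | zero => simp
  | succ t ih =>
    generalize hF : (Pk β L N (box L))^[t] f = F at ih
    have hF0 : ∀ η ∈ S, 0 ≤ F η := fun η hη => by rw [← hF]; exact Pk_pair β (subset_refl _) t hf0 η hη
    have hF1 : ∀ η ∈ S, F η ≤ 1 := fun η hη => by
      have := Pk_iter_le (β := β) (n := N) (subset_refl (box L)) (f := f) (g := fun _ => 1) (j := 0) hf1 t η hη
      rw [Pk_iter_const β hL, hF] at this; exact this
    have hdc : Pk β L N (box L) (fun η => 1 - d η) = fun η => 1 - Pk β L N (box L) d η := by
      have := Pk_add β L N (box L) (fun _ => 1) d 1 (-1)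
      simp only [Pk_const β hL] at this
      simpa [sub_eq_add_neg] using this
    have hPd1 : ∀ η ∈ S, Pk β L N (box L) d η ≤ 1 ∧ 0 ≤ Pk β L N (box L) d η := fun η hη => by
      have h1 := Pk_iter_le (β := β) (n := N) (subset_refl (box L)) (f := d) (g := fun _ => 1) (j := 0)
        (fun η _ => by simp only [hd]; split_ifs <;> norm_num) 1 η hη
      rw [Pk_iter_const β hL] at h1
      exact ⟨h1, Pk_pair β (subset_refl _) 1 hd0 η hη⟩
    rw [Function.iterate_succ_apply', hF, ← hsd, Pk_rev]
    have h1 : ∑ η ∈ S, w β L η * (Pk β L N (box L) d η * F η) ≤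
        ∑ η ∈ S, w β L η * (d η * F η) + ∑ η ∈ S, w β L η * (Pk β L N (box L) d η * (1 - d η)) := by
      rw [← Finset.sum_add_distrib]
      refine Finset.sum_le_sum fun η hη => ?_
      rw [← mul_add]
      refine mul_le_mul_of_nonneg_left ?_ (w_pos _ _ _).le
      have a1 := hPd1 η hη; have a2 := hF0 η hη; have a3 := hF1 η hη
      simp only [hd] at *
      split_ifs <;> nlinarith
    have h2 : ∑ η ∈ S, w β L η * (Pk β L N (box L) d η * (1 - d η)) ≤ esc := by
      rw [← Pk_rev (g := d) (f := fun η => 1 - d η), hsd, hesc, sw_filter]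
      refine Finset.sum_le_sum fun η hη => mul_le_mul_of_nonneg_left ?_ (w_pos _ _ _).le
      split_ifs with hc
      · rw [hdc]; linarith [(hPd1 η (hDS hη)).2]
      · push Not at hc
        have := Pk_le (β := β) (n := N) (subset_refl (box L)) (f := fun η => 1 - d η) (g := fun _ => 0) (η := η)
          (by simp [hd, hη]) (fun x hx v h3 h4 => by simp [hd, hc x hx v h3 h4])
        rwa [Pk_const β hL] at this
    rw [hsd] at h1
    push_cast
    linarith

lemma hit_small {β : ℝ} (hβ : 60 ≤ β) {L K N j r : ℕ} (hN : Big β L K N) (hj : j + 1 ≤ K) (hL : 0 < L)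
    (hr : 2 * Real.exp (-4 * β * ((j + 1 : ℕ) : ℝ)) * r ≤ 1) (hr6 : 6 ≤ r) (t : ℕ) :
    (Pk β L N (box L))^[t] (fun η => if (9 / 10 : ℝ) * L ^ 2 < Nh L j η then 1 else 0) 0 ≤
      Real.exp (-(L ^ 2 / r)) + t * (2 * L ^ 2 * Real.exp (-(r / 5))) := by
  have hβ0 : 0 ≤ β := by linarith
  have hr0 : (0 : ℝ) < r := by positivity
  set D := Dl L j r N with hD
  set S := St (box L) 0 (N : ℤ) with hS
  have hDS : D ⊆ S := Finset.filter_subset _ _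
  set f : Config → ℝ := fun η => if (9 / 10 : ℝ) * L ^ 2 < Nh L j η then 1 else 0 with hf
  have hf0 : ∀ η, 0 ≤ f η := fun η => by simp only [hf]; positivity
  have hf1 : ∀ η ∈ S, f η ≤ 1 := fun η _ => by simp only [hf]; split_ifs <;> norm_num
  have hfm : Monotone f := by
    intro a b hab
    have : Nh L j a ≤ Nh L j b := Finset.card_le_card (Finset.monotone_filter_right _ fun x _ hx => le_trans hx (hab x))
    have h2 : (Nh L j a : ℝ) ≤ Nh L j b := by exact_mod_cast this
    simp only [hf]
    split_ifs with h3 h4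
    · exact le_rfl
    · exact (h4 (h3.trans_le h2)).elim
    · norm_num
    · exact le_rfl
  have hP := fun t => Pk_mono (n := N) hβ0 (subset_refl (box L)) hfm hf0 t
  set esc := sw β L (D.filter (fun η => ∃ x ∈ box L, ∃ v : ℤ, 0 ≤ v ∧ v ≤ N ∧ up η x v ∉ D)) with hesc
  have hB := leak (β := β) hL hS hDS hf0 hf1 hesc
  have hZ : 1 ≤ sw β L D := by
    have h0D : (0 : Config) ∈ D := by
      rw [hD, Dl, Finset.mem_filter]
      refine ⟨zero_mem_St _ _, fun x _ => ?_⟩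
      have : clu L j 0 x ⊆ {x} := by
        intro z hz
        have h2 := (Finset.mem_filter.1 hz).2
        rcases Relation.ReflTransGen.cases_head h2 with h3 | ⟨c, h3, -⟩
        · simp [h3]
        · have := h3.2.1.2; simp at this; omega
      have := (cols_mono this).trans (Finset.card_image_le.trans (Finset.card_singleton x).le)
      omega
    have := Finset.single_le_sum (f := w β L) (fun η _ => (w_pos β L η).le) h0D
    rwa [w_zero] at this
  have hE : esc ≤ 2 * L ^ 2 * Real.exp (-(r / 5)) * sw β L D := by
    set T : Site → Finset (Finset Site) := fun y => (Cn L y).filter (fun W => (cols W).card ≤ r ∧ r ≤ 5 * (cols W).card)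
    have hcov := sum_cover (f := w β L) (fun η => (w_pos _ _ η).le)
      (F := D.filter (fun η => ∃ x ∈ box L, ∃ v : ℤ, 0 ≤ v ∧ v ≤ N ∧ up η x v ∉ D)) (T := (box L).sigma T)
      (D := fun W => D.filter (EW j W.2)) (by
        intro η hη
        rw [Finset.mem_filter] at hη
        obtain ⟨hη, x, hx, v, h1, h2, h3⟩ := hη
        obtain ⟨y, hy, hyc⟩ := escape hr6 hη hx h1 h2 h3
        obtain ⟨W, h4, h5, h6⟩ := ctr_exists hL hη hy
        rw [Finset.mem_filter] at h4
        exact ⟨⟨y, W⟩, Finset.mem_sigma.2 ⟨hy.1, Finset.mem_filter.2 ⟨h4.1, h4.2, by dsimp only; omega⟩⟩,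
          Finset.mem_filter.2 ⟨hη, h5⟩⟩)
    refine hcov.trans ?_
    rw [Finset.sum_sigma]
    calc _ ≤ ∑ y ∈ box L, ∑ W ∈ T y, Real.exp (2 - β) ^ per L W * sw β L D := by
          refine Finset.sum_le_sum fun y _ => Finset.sum_le_sum fun W hW => ?_
          rw [Finset.mem_filter, mem_Cn] at hW
          have := tilt_term hβ hN hj hr (θ := 0) le_rfl (by simp) hW.1.1 hW.2.1
          simpa [sw] using this
      _ ≤ ∑ y ∈ box L, 2 * Real.exp (-(r / 5)) * sw β L D := by
          refine Finset.sum_le_sum fun y _ => ?_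
          rw [← Finset.sum_mul]
          refine mul_le_mul_of_nonneg_right ?_ (by linarith)
          have hq := q2_half hβ
          refine (sum_cn (L := L) y ((r + 4) / 5) (Real.exp_pos _).le (by linarith) (fun W hW => ?_)).trans ?_
          · have h3 := (Finset.mem_filter.1 hW)
            have h4 := per_ge (mem_Cn.1 h3.1).1.sub
            exact ⟨h3.1, by omega⟩
          · refine mul_le_mul_of_nonneg_left ?_ (by norm_num)
            have h5 : 1250 * Real.exp (2 - β) ≤ Real.exp (-1) := by
              have := q2_le hβ; have := Real.exp_pos (-1); linarith
            refine (pow_le_pow_left₀ (by positivity) h5 _).trans ?_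
            rw [← Real.exp_nat_mul]
            refine Real.exp_le_exp.2 ?_
            have : r ≤ 5 * ((r + 4) / 5) := by omega
            have h6 : (r : ℝ) ≤ 5 * ((r + 4) / 5 : ℕ) := by exact_mod_cast this
            linarith
      _ = _ := by rw [Finset.sum_const, card_box, nsmul_eq_mul]; push_cast; ring
  have hA : (Pk β L N (box L))^[t] f 0 * sw β L D ≤ ∑ η ∈ D, w β L η * (Pk β L N (box L))^[t] f η := by
    rw [sw, mul_comm, Finset.sum_mul]
    exact Finset.sum_le_sum fun η hη => mul_le_mul_of_nonneg_left
      ((hP t).1 (zero_le_St (hDS hη))) (w_pos _ _ _).le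
  have hC := Dl_few hβ hN hj hL hr (θ := 2 / r) (by positivity) (by rw [div_mul_cancel₀ _ hr0.ne'])
  rw [sw_filter] at hC
  have e1 : -(2 / (r : ℝ) * L ^ 2 / 2) = -(L ^ 2 / r) := by ring
  rw [e1] at hC
  refine le_of_mul_le_mul_right (a := sw β L D) ?_ (by linarith)
  have := hB t
  have h9 := mul_le_mul_of_nonneg_left hE (Nat.cast_nonneg (α := ℝ) t)
  have h10 : ∑ η ∈ D, w β L η * f η ≤ Real.exp (-(L ^ 2 / r)) * sw β L D := hC
  linarith

/-! equilibrium estimates on square tiles -/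
structure Tile (L l : ℕ) (Q : Finset Site) : Prop where
  one : 1 ≤ l
  le : l ≤ L
  cc : Cc L Q
  card : Q.card = l ^ 2
  per : per L Q ≤ 4 * l
  cols : (cols Q).card ≤ l

lemma tile_rect {L l : ℕ} {a b : ℤ} (hl : 1 ≤ l) (ha : 0 ≤ a) (ha' : a + l ≤ L) (hb : 0 ≤ b) (hb' : b + l ≤ L) :
    Tile L l (rect (a + 1) (a + l) (b + 1) (b + l)) := by
  have e1 : (a + l + 1 - (a + 1)).toNat = l := by omega
  have e2 : (b + l + 1 - (b + 1)).toNat = l := by omega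
  refine ⟨hl, by omega, cc_rect (by omega) (by omega) (by omega) (by omega) (by omega) (by omega), ?_, ?_, ?_⟩
  · rw [card_rect, e1, e2]; ring
  · have := per_rect_le (L := L) (a1 := a + 1) (a2 := a + l) (b1 := b + 1) (b2 := b + l)
    omega
  · have : cols (rect (a + 1) (a + l) (b + 1) (b + l)) ⊆ Finset.Icc (a + 1) (a + l) := by
      intro c hc
      obtain ⟨y, hy, rfl⟩ := Finset.mem_image.1 hc
      rw [mem_rect] at hy
      exact Finset.mem_Icc.2 hy.1
    have := Finset.card_le_card this
    rw [Int.card_Icc] at this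
    omega

lemma box_rect (L : ℕ) : box L = rect (0 + 1) (0 + L) (0 + 1) (0 + L) := by
  ext x; rw [mem_box, mem_rect]; omega

lemma tile_box {L : ℕ} (hL : 0 < L) : Tile L L (box L) := by
  rw [box_rect]; exact tile_rect hL le_rfl (by omega) le_rfl (by omega)

lemma big_exists {β : ℝ} (hβ : 60 ≤ β) (L K n0 : ℕ) : ∃ N, n0 ≤ N ∧ Big β L K N := by
  have h1 : Tendsto (fun x : ℝ => x ^ (L ^ 2) * Real.exp (-x)) atTop (nhds 0) := Real.tendsto_pow_mul_exp_neg_atTop_nhds_zero _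
  have h2 : Tendsto (fun N : ℕ => (N : ℝ) + 1) atTop atTop :=
    tendsto_atTop_add_const_right _ _ tendsto_natCast_atTop_atTop
  have h3 := (h1.comp h2).eventually (gt_mem_nhds (show (0 : ℝ) < Real.exp (-(1 + β * K)) / 4 by positivity))
  obtain ⟨N, h4, h5, h6⟩ := (h3.and ((eventually_ge_atTop n0).and (eventually_ge_atTop K))).exists
  refine ⟨N, h5, h6, ?_⟩
  simp only [Function.comp] at h4
  have hN : (0 : ℝ) ≤ N := Nat.cast_nonneg _
  have e : Real.exp (-β * ((N : ℝ) - K)) ≤ Real.exp (-((N : ℝ) + 1)) * Real.exp (1 + β * K) := by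
    rw [← Real.exp_add]; apply Real.exp_le_exp.2; nlinarith
  calc _ ≤ ((N : ℝ) + 1) ^ (L ^ 2) * (Real.exp (-((N : ℝ) + 1)) * Real.exp (1 + β * K)) := by gcongr
    _ = ((N : ℝ) + 1) ^ (L ^ 2) * Real.exp (-((N : ℝ) + 1)) * Real.exp (1 + β * K) := by ring
    _ ≤ Real.exp (-(1 + β * K)) / 4 * Real.exp (1 + β * K) := by gcongr
    _ = 1 / 4 := by rw [Real.exp_neg]; field_simp

lemma up_eq {β : ℝ} (hβ : 60 ≤ β) {L l : ℕ} {Q : Finset Site} (hQ : Tile L l Q) {j : ℕ}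
    (hl : 2 * Real.exp (-4 * β * ((j + 1 : ℕ) : ℝ)) * l ≤ 1) (n m : ℕ) {x : Site} (hx : x ∈ Q) :
    sw β L ((St Q 0 n).filter (fun η : Config => ((j + m : ℕ) : ℤ) ≤ η x)) ≤
      Real.exp (-(3 * β)) ^ m * sw β L (St Q 0 n) := by
  obtain ⟨N, h1, h2⟩ := big_exists hβ L (j + m) n
  have h3 := up_tail hβ h2 m j le_rfl hl Q hQ.cc hQ.cols x hx
  have hd := dom (by linarith : 0 ≤ β) (L := L) (S1 := St Q 0 n) (S2 := St Q (j : ℤ) N)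
    (f := fun η : Config => if ((j + m : ℕ) : ℤ) ≤ η x then 1 else 0) (by
      intro a ha b hb
      rw [mem_St] at ha hb
      refine ⟨mem_St.2 ⟨fun y hy => ?_, fun y hy => ?_⟩, mem_St.2 ⟨fun y hy => ?_, fun y hy => ?_⟩⟩
      · have := ha.1 y hy; have := hb.1 y hy; simp only [Pi.inf_apply]; omega
      · have := ha.2 y hy; have := hb.2 y hy; simp only [Pi.inf_apply]; omega
      · have := ha.1 y hy; have := hb.1 y hy; simp only [Pi.sup_apply]; omega
      · have := ha.2 y hy; have := hb.2 y hy; simp only [Pi.sup_apply]; omega) (fun a => by positivity) (by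
      intro a _ b _ hab
      have : a x ≤ b x := hab x
      split_ifs <;> first | omega | norm_num)
  rw [← sw_filter, ← sw_filter] at hd
  have hjN : j ≤ N := by have := h2.1; omega
  have hZ : 1 ≤ sw β L (St Q (j : ℤ) N) := one_le_sw (by positivity) (by exact_mod_cast hjN)
  refine le_of_mul_le_mul_right (hd.trans ((mul_le_mul_of_nonneg_left h3 (sw_nonneg _ _ _)).trans (le_of_eq ?_)))
    (by linarith : 0 < sw β L (St Q (j : ℤ) N))
  ring

def lo (k : ℕ) (v : ℤ) : ℝ := ((max (k - v) 0 : ℤ) : ℝ) ^ 4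
def hi (k : ℕ) (v : ℤ) : ℝ := ((max (v - k) 0 : ℤ) : ℝ) ^ 4

lemma hi_eq {β : ℝ} (hβ : 60 ≤ β) {L l : ℕ} {Q : Finset Site} (hQ : Tile L l Q) {k : ℕ}
    (hl : 2 * Real.exp (-4 * β * ((k + 1 + 1 : ℕ) : ℝ)) * l ≤ 1) (n : ℕ) :
    ∑ η ∈ St Q 0 n, w β L η * ∑ x ∈ Q, hi k (η x) ≤ 2 * l ^ 2 * sw β L (St Q 0 n) := by
  have hq : 16 * Real.exp (-(3 * β)) ≤ 1 / 2 := by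
    have := q_le hβ
    have h2 : Real.exp (-(3 * β)) ≤ Real.exp (-β) := Real.exp_le_exp.2 (by linarith)
    have : ((1 : ℝ) / 2) ^ 60 ≤ 1 / 32 := by norm_num
    linarith
  have hZ := sw_nonneg β L (St Q 0 n)
  have key : ∀ x ∈ Q, ∑ η ∈ St Q 0 n, w β L η * hi k (η x) ≤ 2 * sw β L (St Q 0 n) := by
    intro x hx
    calc _ ≤ ∑ η ∈ St Q 0 n, w β L η * ∑ m ∈ Finset.range (n + 1),
            (16 : ℝ) ^ m * (if ((k + 1 + m : ℕ) : ℤ) ≤ η x then 1 else 0) := by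
          refine Finset.sum_le_sum fun η hη => mul_le_mul_of_nonneg_left ?_ (w_pos _ _ _).le
          have hη := (mem_St.1 hη).1 x hx
          by_cases h : η x ≤ k
          · rw [hi, max_eq_right (by omega)]; norm_num; positivity
          · push Not at h
            obtain ⟨u, hu⟩ := Int.eq_ofNat_of_zero_le (show 0 ≤ η x - k - 1 by omega)
            refine le_trans ?_ (Finset.single_le_sum (f := fun m => (16 : ℝ) ^ m *
              (if ((k + 1 + m : ℕ) : ℤ) ≤ η x then 1 else 0)) (fun m _ => by positivity)
              (Finset.mem_range.2 (show u < n + 1 by omega)))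
            rw [if_pos (by push_cast; omega), mul_one, hi, max_eq_left (by omega), show η x - k = ((u + 1 : ℕ) : ℤ) by push_cast; omega]
            have h2 : u + 1 ≤ 2 ^ u := Nat.lt_two_pow_self
            have h3 : (((u + 1 : ℕ) : ℤ) : ℝ) ≤ 2 ^ u := by exact_mod_cast h2
            calc _ ≤ ((2 : ℝ) ^ u) ^ 4 := by gcongr
              _ = 16 ^ u := by rw [← pow_mul, mul_comm, pow_mul]; norm_num
      _ = ∑ m ∈ Finset.range (n + 1), 16 ^ m * sw β L ((St Q 0 n).filter (fun η : Config => ((k + 1 + m : ℕ) : ℤ) ≤ η x)) := by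
          simp only [sw_filter, Finset.mul_sum]
          rw [Finset.sum_comm]
          exact Finset.sum_congr rfl fun m _ => Finset.sum_congr rfl fun η _ => by ring
      _ ≤ ∑ m ∈ Finset.range (n + 1), (1 / 2) ^ m * sw β L (St Q 0 n) := by
          refine Finset.sum_le_sum fun m _ => ?_
          refine (mul_le_mul_of_nonneg_left (up_eq hβ hQ hl n m hx) (by positivity)).trans ?_
          rw [← mul_assoc, ← mul_pow]
          exact mul_le_mul_of_nonneg_right (pow_le_pow_left₀ (by positivity) hq _) hZ
      _ ≤ _ := by
          rw [← Finset.sum_mul]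
          refine mul_le_mul_of_nonneg_right ?_ hZ
          have := sum_geometric_two_le (n + 1)
          simpa using this
  calc _ = ∑ x ∈ Q, ∑ η ∈ St Q 0 n, w β L η * hi k (η x) := by simp only [Finset.mul_sum]; rw [Finset.sum_comm]
    _ ≤ ∑ x ∈ Q, 2 * sw β L (St Q 0 n) := Finset.sum_le_sum key
    _ = _ := by rw [Finset.sum_const, hQ.card, nsmul_eq_mul]; push_cast; ring

/-- threshold on the number of sites at height j -/
def yy (β : ℝ) (l j : ℕ) : ℝ := 16 * β * l * Real.exp (4 * β * ((j : ℝ) + 1))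
def Nj (Q : Finset Site) (j : ℕ) (η : Config) : ℕ := (Q.filter (fun x => η x = j)).card
def pbad (β : ℝ) (k l n j0 : ℕ) : ℝ := k * Real.exp (-(4 * β * l)) + l ^ 2 * Real.exp (-(3 * β)) ^ (n - j0)

lemma low_eq {β : ℝ} (hβ : 60 ≤ β) {L l : ℕ} {Q : Finset Site} (hQ : Tile L l Q) {j0 n : ℕ}
    (hl : 2 * Real.exp (-4 * β * ((j0 + 1 : ℕ) : ℝ)) * l ≤ 1) (hn : j0 ≤ n) (k : ℕ) :
    sw β L ((St Q 0 n).filter (fun η => ∃ j < k, yy β l j ≤ Nj Q j η)) ≤ pbad β k l n j0 * sw β L (St Q 0 n) := by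
  have hc := sum_cover (f := w β L) (fun η => (w_pos _ _ η).le)
    (F := (St Q 0 n).filter (fun η => ∃ j < k, yy β l j ≤ Nj Q j η))
    (T := (Finset.range k).disjSum Q)
    (D := fun i => i.elim (fun j => (St Q 0 n).filter (fun η => (∀ x ∈ Q, η x < (n : ℤ)) ∧ yy β l j ≤ (Q.filter (fun x => η x = j)).card))
      (fun x => (St Q 0 n).filter (fun η : Config => ((j0 + (n - j0) : ℕ) : ℤ) ≤ η x))) (by
      intro η hη
      obtain ⟨h1, j, hj, h2⟩ := Finset.mem_filter.1 hη
      by_cases h : ∀ x ∈ Q, η x < (n : ℤ)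
      · exact ⟨Sum.inl j, Finset.inl_mem_disjSum.2 (Finset.mem_range.2 hj), Finset.mem_filter.2 ⟨h1, h, h2⟩⟩
      · push Not at h
        obtain ⟨x, hx, h3⟩ := h
        exact ⟨Sum.inr x, Finset.inr_mem_disjSum.2 hx, Finset.mem_filter.2 ⟨h1, by omega⟩⟩)
  refine hc.trans ?_
  rw [Finset.sum_disjSum, pbad, add_mul]
  refine add_le_add ?_ ?_
  · calc _ ≤ ∑ j ∈ Finset.range k, Real.exp (-(4 * β * l)) * sw β L (St Q 0 n) := by
          refine Finset.sum_le_sum fun j _ => ?_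
          refine (E1_tail (by linarith) (yy β l j)).trans (mul_le_mul_of_nonneg_right (Real.exp_le_exp.2 ?_) (sw_nonneg _ _ _))
          have e : Real.exp (4 * β * ((j : ℝ) + 1)) * Real.exp (-4 * β * ((j : ℝ) + 1)) = 1 := by
            rw [← Real.exp_add]; ring_nf; exact Real.exp_zero
          have h2 : (per L Q : ℝ) ≤ 4 * l := by exact_mod_cast hQ.per
          have : yy β l j * Real.exp (-4 * β * ((j : ℝ) + 1)) = 16 * β * l := by
            rw [yy, mul_assoc, e, mul_one]
          rw [this]
          nlinarith
      _ = _ := by rw [Finset.sum_const, Finset.card_range, nsmul_eq_mul]; ring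
  · calc _ ≤ ∑ x ∈ Q, Real.exp (-(3 * β)) ^ (n - j0) * sw β L (St Q 0 n) :=
          Finset.sum_le_sum fun x hx => up_eq hβ hQ hl n (n - j0) hx
      _ = _ := by rw [Finset.sum_const, hQ.card, nsmul_eq_mul]; push_cast; ring

lemma layer {Q : Finset Site} {n : ℤ} {η : Config} (hη : η ∈ St Q 0 n) (k : ℕ) (c : ℕ → ℝ) :
    ∑ x ∈ Q, (if η x < k then c (η x).toNat else 0) = ∑ j ∈ Finset.range k, c j * Nj Q j η := by
  calc _ = ∑ x ∈ Q, ∑ j ∈ Finset.range k, if η x = j then c j else 0 := by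
        refine Finset.sum_congr rfl fun x hx => ?_
        obtain ⟨u, hu⟩ := Int.eq_ofNat_of_zero_le ((mem_St.1 hη).1 x hx).1
        simp [hu]
    _ = _ := by
        rw [Finset.sum_comm]
        refine Finset.sum_congr rfl fun j _ => ?_
        rw [← Finset.sum_filter, Finset.sum_const, Nj, nsmul_eq_mul, mul_comm]

lemma cnt_low {β : ℝ} (hβ : 60 ≤ β) {Q : Finset Site} {n : ℤ} {η : Config} (hη : η ∈ St Q 0 n) {k l : ℕ}
    (h : ¬ ∃ j < k, yy β l j ≤ Nj Q j η) :
    ((Q.filter (fun x => η x < (k : ℤ))).card : ℝ) ≤ 32 * β * l * Real.exp (4 * β * k) := by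
  push Not at h
  have h1 := layer hη k (fun _ => 1)
  rw [← Finset.sum_filter, Finset.sum_const, nsmul_eq_mul, mul_one] at h1
  rw [h1]
  clear h1
  induction k with
  | zero => simp; positivity
  | succ k ih =>
    rw [Finset.sum_range_succ, one_mul]
    have h3 := ih fun j hj => h j (by omega)
    have h4 := h k (by omega)
    rw [yy] at h4
    push_cast
    have e : Real.exp (4 * β * (k : ℝ)) * 2 ≤ Real.exp (4 * β * ((k : ℝ) + 1)) := by
      rw [mul_add, Real.exp_add, mul_one]
      have := Real.add_one_le_exp (4 * β)
      refine mul_le_mul_of_nonneg_left (by linarith) (Real.exp_pos _).le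
    have : 0 ≤ 16 * β * (l : ℝ) := by positivity
    nlinarith [mul_le_mul_of_nonneg_left e this]

lemma lo_low {β : ℝ} (hβ : 60 ≤ β) {Q : Finset Site} {n : ℤ} {η : Config} (hη : η ∈ St Q 0 n) {k l : ℕ}
    (hl : Real.exp (4 * β * k) ≤ l) (h : ¬ ∃ j < k, yy β l j ≤ Nj Q j η) :
    ∑ x ∈ Q, lo k (η x) ≤ 32 * β * l ^ 2 := by
  push Not at h
  have hq : 16 * Real.exp (-(4 * β)) ≤ 1 / 2 := by
    have := q_le hβ
    have h2 : Real.exp (-(4 * β)) ≤ Real.exp (-β) := Real.exp_le_exp.2 (by linarith)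
    have : ((1 : ℝ) / 2) ^ 60 ≤ 1 / 32 := by norm_num
    linarith
  have h1 := layer hη k (fun j => lo k j)
  calc _ = ∑ x ∈ Q, (if η x < k then lo k (η x).toNat else 0) := by
        refine Finset.sum_congr rfl fun x hx => ?_
        have := ((mem_St.1 hη).1 x hx).1
        split_ifs with hc
        · rw [Int.toNat_of_nonneg this]
        · rw [lo, max_eq_right (by omega)]; norm_num
    _ = _ := h1
    _ ≤ ∑ j ∈ Finset.range k, (16 * β * l ^ 2) * (1 / 2) ^ (k - 1 - j) := by
        refine Finset.sum_le_sum fun j hj => ?_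
        rw [Finset.mem_range] at hj
        obtain ⟨u, rfl⟩ : ∃ u, k = j + 1 + u := ⟨k - j - 1, by omega⟩
        refine (mul_le_mul_of_nonneg_left (h j hj).le (by unfold lo; positivity)).trans ?_
        have e1 : lo (j + 1 + u) (j : ℤ) ≤ 16 ^ u := by
          rw [lo, max_eq_left (by push_cast; omega), show ((j + 1 + u : ℕ) : ℤ) - j = ((u + 1 : ℕ) : ℤ) by push_cast; ring]
          have h2 : u + 1 ≤ 2 ^ u := Nat.lt_two_pow_self
          have h3 : (((u + 1 : ℕ) : ℤ) : ℝ) ≤ 2 ^ u := by exact_mod_cast h2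
          calc _ ≤ ((2 : ℝ) ^ u) ^ 4 := by gcongr
            _ = 16 ^ u := by rw [← pow_mul, mul_comm, pow_mul]; norm_num
        have e2 : Real.exp (4 * β * ((j : ℝ) + 1)) ≤ l * Real.exp (-(4 * β)) ^ u := by
          refine le_trans (le_of_eq ?_) (mul_le_mul_of_nonneg_right hl (by positivity))
          rw [← Real.exp_nat_mul, ← Real.exp_add]; push_cast; ring_nf
        rw [show j + 1 + u - 1 - j = u by omega, yy]
        calc _ ≤ 16 ^ u * (16 * β * l * (l * Real.exp (-(4 * β)) ^ u)) := by gcongr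
          _ = 16 * β * l ^ 2 * (16 * Real.exp (-(4 * β))) ^ u := by rw [mul_pow]; ring
          _ ≤ _ := by gcongr
    _ = (16 * β * l ^ 2) * ∑ j ∈ Finset.range k, (1 / 2) ^ j := by
        rw [← Finset.mul_sum, Finset.sum_range_reflect (fun j => ((1 : ℝ) / 2) ^ j)]
    _ ≤ (16 * β * l ^ 2) * 2 := by
        have := sum_geometric_two_le k
        gcongr
    _ = _ := by ring

lemma lo_eq {β : ℝ} (hβ : 60 ≤ β) {L l : ℕ} {Q : Finset Site} (hQ : Tile L l Q) {j0 n k : ℕ}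
    (hl : 2 * Real.exp (-4 * β * ((j0 + 1 : ℕ) : ℝ)) * l ≤ 1) (hn : j0 ≤ n) (hk : Real.exp (4 * β * k) ≤ l)
    (hp : (k : ℝ) ^ 4 * pbad β k l n j0 ≤ 1) :
    ∑ η ∈ St Q 0 n, w β L η * ∑ x ∈ Q, lo k (η x) ≤ (32 * β + 1) * l ^ 2 * sw β L (St Q 0 n) := by
  have h1 := low_eq hβ hQ hl hn k
  rw [sw_filter] at h1
  calc _ ≤ ∑ η ∈ St Q 0 n, (32 * β * l ^ 2 * w β L η + k ^ 4 * l ^ 2 * (w β L η * (if ∃ j < k, yy β l j ≤ Nj Q j η then 1 else 0))) := by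
        refine Finset.sum_le_sum fun η hη => ?_
        have hw := (w_pos β L η).le
        have h3 : ∑ x ∈ Q, lo k (η x) ≤ 32 * β * l ^ 2 + k ^ 4 * l ^ 2 * (if ∃ j < k, yy β l j ≤ Nj Q j η then 1 else 0) := by
          split_ifs with hc
          · have : ∑ x ∈ Q, lo k (η x) ≤ ∑ x ∈ Q, (k : ℝ) ^ 4 := by
              refine Finset.sum_le_sum fun x hx => ?_
              have := ((mem_St.1 hη).1 x hx).1
              have h5 : ((max (k - η x) 0 : ℤ) : ℝ) ≤ k := by
                have : max ((k : ℤ) - η x) 0 ≤ k := by omega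
                exact_mod_cast this
              exact pow_le_pow_left₀ (by positivity) h5 _
            rw [Finset.sum_const, hQ.card, nsmul_eq_mul] at this
            push_cast at this
            have h6 : 0 ≤ 32 * β * (l : ℝ) ^ 2 := by positivity
            linarith
          · have := lo_low hβ hη hk hc
            linarith
        nlinarith [mul_le_mul_of_nonneg_left h3 hw]
    _ = 32 * β * l ^ 2 * sw β L (St Q 0 n) + k ^ 4 * l ^ 2 * ∑ η ∈ St Q 0 n, w β L η * (if ∃ j < k, yy β l j ≤ Nj Q j η then 1 else 0) := by
        rw [Finset.sum_add_distrib, ← Finset.mul_sum, ← Finset.mul_sum, sw]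
    _ ≤ 32 * β * l ^ 2 * sw β L (St Q 0 n) + k ^ 4 * l ^ 2 * (pbad β k l n j0 * sw β L (St Q 0 n)) := by
        exact add_le_add_right (mul_le_mul_of_nonneg_left h1 (by positivity)) _
    _ = (32 * β + k ^ 4 * pbad β k l n j0) * (l ^ 2 * sw β L (St Q 0 n)) := by ring
    _ ≤ (32 * β + 1) * (l ^ 2 * sw β L (St Q 0 n)) :=
        mul_le_mul_of_nonneg_right (by linarith) (mul_nonneg (by positivity) (sw_nonneg _ _ _))
    _ = _ := by ring


end

/-! entropy decay -/
lemma ent_pt {g E : ℝ} (hg : 0 ≤ g) (hE : 0 < E) :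
    (Real.log E + 2) * g + (-2 * √E) * √g ≤ g * Real.log g := by
  rcases hg.eq_or_lt with rfl | hg
  · simp
  have h1 := Real.log_le_sub_one_of_pos (show 0 < √E / √g by positivity)
  rw [Real.log_div (by positivity) (by positivity), Real.log_sqrt hE.le, Real.log_sqrt hg.le] at h1
  have h2 := mul_le_mul_of_nonneg_left h1 (show 0 ≤ 2 * g by positivity)
  have h3 : 2 * g * (√E / √g - 1) = 2 * √E * √g - 2 * g := by
    have hs : 0 < √g := Real.sqrt_pos.2 hg
    have hgs : g = √g * √g := (Real.mul_self_sqrt hg.le).symm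
    generalize √g = s at *
    subst hgs
    field_simp
  rw [h3] at h2
  linarith

lemma ent_step (β : ℝ) {L n : ℕ} {V : Finset Site} (hV : V ⊆ box L) {g : Config → ℝ}
    (hg : ∀ η ∈ St V 0 n, 0 ≤ g η) {η : Config} (hη : η ∈ St V 0 n) :
    Pk β L n V g η * Real.log (Pk β L n V g η) + Pk β L n V g η - (Pk β L n V (fun σ => √(g σ)) η) ^ 2 ≤
      Pk β L n V (fun σ => g σ * Real.log (g σ)) η := by
  have key : ∀ E : ℝ, 0 < E → (Real.log E + 2) * Pk β L n V g η + (-2 * √E) * Pk β L n V (fun σ => √(g σ)) η ≤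
      Pk β L n V (fun σ => g σ * Real.log (g σ)) η := by
    intro E hE
    have h1 := Pk_le (β := β) (n := n) hV (f := fun σ => (Real.log E + 2) * g σ + (-2 * √E) * √(g σ))
      (g := fun σ => g σ * Real.log (g σ)) (η := η) (ent_pt (hg _ hη) hE)
      (fun x hx v h0 h1 => ent_pt (hg _ (up_mem hη hx h0 h1)) hE)
    rwa [Pk_add] at h1
  have h0 : 0 ≤ Pk β L n V g η := by
    have := Pk_le (β := β) (n := n) hV (f := fun _ => 0) (g := g) (hg _ hη) (fun x hx v h0 h1 => hg _ (up_mem hη hx h0 h1))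
    simpa [Pk, Tx] using this
  have h0' : 0 ≤ Pk β L n V (fun σ => √(g σ)) η := by
    have := Pk_le (β := β) (n := n) hV (f := fun _ => 0) (g := fun σ => √(g σ)) (η := η) (Real.sqrt_nonneg _)
      (fun x hx v h0 h1 => Real.sqrt_nonneg _)
    simpa [Pk, Tx] using this
  generalize Pk β L n V (fun σ => g σ * Real.log (g σ)) η = X at *
  generalize Pk β L n V (fun σ => √(g σ)) η = m at *
  generalize Pk β L n V g η = E at *
  rcases h0.eq_or_lt with rfl | hE
  · rcases h0'.eq_or_lt with rfl | hm
    · have := key 1 one_pos; simpa using this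
    · have := key ((m / 2) ^ 2) (by positivity)
      rw [Real.sqrt_sq (by positivity)] at this
      nlinarith
  · have := key E hE
    nlinarith [sq_nonneg (√E - m), Real.sq_sqrt hE.le]

lemma jens (β : ℝ) {L n : ℕ} (hL : 0 < L) {V : Finset Site} (hV : V ⊆ box L) (φ : Config → ℝ) (η : Config) :
    (Pk β L n V φ η) ^ 2 ≤ ((L : ℝ) ^ 2)⁻¹ * (((L : ℝ) ^ 2 - V.card) * φ η ^ 2 + ∑ x ∈ V, Tx β L n x φ η ^ 2) := by
  have hc := card_le_sq hV
  have hM : (0 : ℝ) < (L : ℝ) ^ 2 := by positivity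
  set m := Pk β L n V φ η with hm
  have h1 : (L : ℝ) ^ 2 * m = ((L : ℝ) ^ 2 - V.card) * φ η + ∑ x ∈ V, Tx β L n x φ η := by
    rw [hm, Pk]; field_simp
  have h2 : 0 ≤ ∑ x ∈ V, (Tx β L n x φ η - m) ^ 2 := Finset.sum_nonneg fun _ _ => sq_nonneg _
  have h3 : ∑ x ∈ V, (Tx β L n x φ η - m) ^ 2 = ∑ x ∈ V, Tx β L n x φ η ^ 2 - 2 * m * ∑ x ∈ V, Tx β L n x φ η + V.card * m ^ 2 := by
    rw [Finset.mul_sum, ← Finset.sum_sub_distrib, ← nsmul_eq_mul, ← Finset.sum_const, ← Finset.sum_add_distrib]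
    exact Finset.sum_congr rfl fun _ _ => by ring
  have h4 : 0 ≤ ((L : ℝ) ^ 2 - V.card) * (φ η - m) ^ 2 := mul_nonneg (by linarith) (sq_nonneg _)
  rw [inv_mul_eq_div, le_div_iff₀ hM]
  have h5 : ∑ x ∈ V, Tx β L n x φ η = (L : ℝ) ^ 2 * m - ((L : ℝ) ^ 2 - V.card) * φ η := by linarith
  rw [h5] at h3
  nlinarith

/-- Dirichlet form (times L^2) -/
def DE (β : ℝ) (L n : ℕ) (V : Finset Site) (φ : Config → ℝ) : ℝ :=
  ∑ x ∈ V, ∑ η ∈ St V 0 n, w β L η * (φ η ^ 2 - Tx β L n x φ η ^ 2)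

lemma ent_drop (β : ℝ) {L n : ℕ} (hL : 0 < L) {V : Finset Site} (hV : V ⊆ box L) {g : Config → ℝ}
    (hg : ∀ η ∈ St V 0 n, 0 ≤ g η) :
    ∑ η ∈ St V 0 n, w β L η * (Pk β L n V g η * Real.log (Pk β L n V g η)) +
      ((L : ℝ) ^ 2)⁻¹ * DE β L n V (fun σ => √(g σ)) ≤ ∑ η ∈ St V 0 n, w β L η * (g η * Real.log (g η)) := by
  have hM : (L : ℝ) ^ 2 ≠ 0 := by positivity
  rw [← Pk_iter_stat (β := β) hL 1 (fun η => g η * Real.log (g η)), Function.iterate_one]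
  have h1 := Pk_iter_stat (β := β) (n := n) (V := V) (j := 0) hL 1 g
  rw [Function.iterate_one] at h1
  have h2 : ∑ η ∈ St V 0 n, w β L η * (Pk β L n V g η * Real.log (Pk β L n V g η) + Pk β L n V g η
      - ((L : ℝ) ^ 2)⁻¹ * (((L : ℝ) ^ 2 - V.card) * √(g η) ^ 2 + ∑ x ∈ V, Tx β L n x (fun σ => √(g σ)) η ^ 2)) ≤
      ∑ η ∈ St V 0 n, w β L η * Pk β L n V (fun σ => g σ * Real.log (g σ)) η := by
    refine Finset.sum_le_sum fun η hη => mul_le_mul_of_nonneg_left ?_ (w_pos _ _ _).le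
    have a1 := ent_step β hV hg hη
    have a2 := jens β (n := n) hL hV (fun σ => √(g σ)) η
    linarith
  refine le_trans (le_of_eq ?_) h2
  have e : ((L : ℝ) ^ 2)⁻¹ * DE β L n V (fun σ => √(g σ)) = ∑ η ∈ St V 0 n, w β L η * (√(g η) ^ 2
      - ((L : ℝ) ^ 2)⁻¹ * (((L : ℝ) ^ 2 - V.card) * √(g η) ^ 2 + ∑ x ∈ V, Tx β L n x (fun σ => √(g σ)) η ^ 2)) := by
    rw [DE, Finset.sum_comm, Finset.mul_sum]
    refine Finset.sum_congr rfl fun η _ => ?_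
    rw [← Finset.mul_sum, Finset.sum_sub_distrib, Finset.sum_const, nsmul_eq_mul]
    field_simp; ring
  have e2 : ∑ η ∈ St V 0 n, w β L η * √(g η) ^ 2 = ∑ η ∈ St V 0 n, w β L η * Pk β L n V g η := by
    rw [h1]; exact Finset.sum_congr rfl fun η hη => by rw [Real.sq_sqrt (hg η hη)]
  rw [e]
  simp only [mul_sub, mul_add, Finset.sum_add_distrib, Finset.sum_sub_distrib] at e2 ⊢
  rw [e2]; ring

/-- gradient form -/
lemma DE_grad (β : ℝ) {L n : ℕ} {V : Finset Site} (φ : Config → ℝ) :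
    ∑ x ∈ V, ∑ η ∈ St V 0 n, w β L η * Tx β L n x (fun σ => (φ η - φ σ) ^ 2) η = 2 * DE β L n V φ := by
  rw [DE, Finset.mul_sum]
  refine Finset.sum_congr rfl fun x hx => ?_
  have h1 : ∀ η, Tx β L n x (fun σ => (φ η - φ σ) ^ 2) η =
      φ η ^ 2 - 2 * (φ η * Tx β L n x φ η) + Tx β L n x (fun σ => φ σ ^ 2) η := fun η => by
    have := Tx_add β L n x (fun σ => φ σ) (fun σ => φ σ ^ 2) (-2 * φ η) 1 η
    have h2 := Tx_add β L n x (fun _ => φ η ^ 2) (fun σ => (-2 * φ η) * φ σ + 1 * φ σ ^ 2) 1 1 η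
    rw [this, Tx_const] at h2
    rw [show (fun σ => (φ η - φ σ) ^ 2) = (fun σ => 1 * (fun _ => φ η ^ 2) σ + 1 * ((-2 * φ η) * φ σ + 1 * φ σ ^ 2)) from by
      funext σ; ring]
    rw [h2]; ring
  have h2 : ∑ η ∈ St V 0 n, w β L η * Tx β L n x (fun σ => φ σ ^ 2) η = ∑ η ∈ St V 0 n, w β L η * φ η ^ 2 := by
    have := Tx_rev (β := β) (L := L) (V := V) (j := 0) (n := n) hx (fun σ => φ σ ^ 2) (fun _ => 1)
    simpa [Tx_const] using this
  have h3 : ∑ η ∈ St V 0 n, w β L η * (φ η * Tx β L n x φ η) = ∑ η ∈ St V 0 n, w β L η * Tx β L n x φ η ^ 2 := by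
    have h4 : ∀ η, Tx β L n x (Tx β L n x φ) η = Tx β L n x φ η := fun η => by
      have h5 : ∀ v, Tx β L n x φ (up η x v) = Tx β L n x φ η := fun v => by simp only [Tx, zx_up, up_up]
      have h6 : Tx β L n x (Tx β L n x φ) η = Tx β L n x (fun _ => Tx β L n x φ η) η :=
        le_antisymm (Tx_le fun v _ _ => (h5 v).le) (Tx_le fun v _ _ => (h5 v).ge)
      rw [h6, Tx_const]
    have := Tx_rev (β := β) (L := L) (V := V) (j := 0) (n := n) hx φ (Tx β L n x φ)
    simp only [h4] at this
    simp only [sq]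
    rw [this]
    exact Finset.sum_congr rfl fun η _ => by ring
  simp only [h1, mul_sub, mul_add, Finset.sum_add_distrib, Finset.sum_sub_distrib]
  rw [h2]
  have h5 : ∑ η ∈ St V 0 n, w β L η * (2 * (φ η * Tx β L n x φ η)) = 2 * ∑ η ∈ St V 0 n, w β L η * Tx β L n x φ η ^ 2 := by
    rw [← h3, Finset.mul_sum]; exact Finset.sum_congr rfl fun η _ => by ring
  rw [h5]; ring

lemma DE_nonneg (β : ℝ) {L n : ℕ} {V : Finset Site} (φ : Config → ℝ) : 0 ≤ DE β L n V φ := by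
  have : 0 ≤ 2 * DE β L n V φ := by
    rw [← DE_grad]
    refine Finset.sum_nonneg fun x _ => Finset.sum_nonneg fun η _ => mul_nonneg (w_pos _ _ _).le ?_
    rw [← Tx_const β L n x 0 η]
    exact Tx_le fun _ _ _ => sq_nonneg _
  linarith

lemma gam_nonneg (β : ℝ) {L n : ℕ} {V : Finset Site} (hV : V ⊆ box L) (t : ℕ) : ∀ η ∈ St V 0 n, 0 ≤ gam β L n V t η :=
  Pk_pair β hV t fun η => by split_ifs <;> norm_num

lemma gam_one (β : ℝ) {L n : ℕ} (hL : 0 < L) {V : Finset Site} (t : ℕ) :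
    ∑ η ∈ St V 0 n, w β L η * gam β L n V t η = 1 := by
  have := gam_sum β L n V t (fun _ => 1)
  rw [Pk_iter_const β hL] at this
  simpa using this.symm

lemma sw_le_card (β : ℝ) (hβ : 0 ≤ β) {L n : ℕ} {V : Finset Site} (hV : V ⊆ box L) :
    Real.log (sw β L (St V 0 n)) ≤ L ^ 2 * Real.log (n + 1) := by
  have h1 : (1 : ℝ) ≤ sw β L (St V 0 n) := one_le_sw le_rfl (by positivity)
  have h2 : sw β L (St V 0 n) ≤ ((n : ℝ) + 1) ^ (L ^ 2) := by
    have h3 : sw β L (St V 0 n) ≤ ((St V 0 n).card : ℝ) := by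
      have h4 : sw β L (St V 0 n) ≤ ∑ η ∈ St V 0 n, (1 : ℝ) := by
        refine Finset.sum_le_sum fun η _ => Real.exp_le_one_iff.2 ?_
        have : (0 : ℝ) ≤ en L η := by exact_mod_cast en_nonneg _ _
        nlinarith
      simpa using h4
    refine h3.trans ((Nat.cast_le.2 (card_St_le (V := V) (j := 0) (n := n))).trans ?_)
    push_cast
    refine pow_le_pow_right₀ (by linarith [(Nat.cast_nonneg n : (0 : ℝ) ≤ n)]) ?_
    rw [← card_box]; exact Finset.card_le_card hV
  calc _ ≤ Real.log (((n : ℝ) + 1) ^ (L ^ 2)) := Real.log_le_log (by linarith) h2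
    _ = _ := by rw [Real.log_pow]; push_cast; ring

lemma good_time (β : ℝ) (hβ : 0 ≤ β) {L n : ℕ} (hL : 0 < L) {V : Finset Site} (hV : V ⊆ box L) (T0 : ℕ) {T : ℕ} (hT : 0 < T) :
    ∃ t, T0 ≤ t ∧ t < T0 + T ∧ T * DE β L n V (fun η => √(gam β L n V t η)) ≤ L ^ 4 * Real.log (n + 1) := by
  set S := St V 0 (n : ℤ) with hS
  set F : ℕ → ℝ := fun t => ∑ η ∈ S, w β L η * (gam β L n V t η * Real.log (gam β L n V t η)) with hF
  set e : ℕ → ℝ := fun t => ((L : ℝ) ^ 2)⁻¹ * DE β L n V (fun η => √(gam β L n V t η)) with he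
  have he0 : ∀ t, 0 ≤ e t := fun t => mul_nonneg (by positivity) (DE_nonneg _ _)
  have hstep : ∀ t, F (t + 1) + e t ≤ F t := fun t => by
    have := ent_drop β (n := n) hL hV (g := gam β L n V t) (gam_nonneg β (n := n) hV t)
    have h2 : gam β L n V (t + 1) = Pk β L n V (gam β L n V t) := Function.iterate_succ_apply' _ _ _
    simp only [hF, h2]; exact this
  have hsum : ∀ T0 T, F (T0 + T) + ∑ i ∈ Finset.range T, e (T0 + i) ≤ F T0 := by
    intro T0 T
    induction T with
    | zero => simp
    | succ T ih => rw [Finset.sum_range_succ, show T0 + (T + 1) = T0 + T + 1 from rfl]; have := hstep (T0 + T); linarith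
  have hF0 : F T0 ≤ 0 := by
    have h1 := hsum 0 T0
    have h2 : 0 ≤ ∑ i ∈ Finset.range T0, e (0 + i) := Finset.sum_nonneg fun _ _ => he0 _
    have h3 : F 0 = 0 := by
      refine Finset.sum_eq_zero fun η _ => ?_
      simp only [gam, Function.iterate_zero, id]
      split_ifs <;> simp
    rw [zero_add] at h1; linarith
  have h1 : (1 : ℝ) ≤ sw β L S := one_le_sw le_rfl (by positivity)
  have hlow : -(L ^ 2 * Real.log (n + 1)) ≤ F (T0 + T) := by
    refine (neg_le_neg (sw_le_card β hβ hV)).trans ?_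
    rw [← hS]
    set Z := sw β L S with hZ
    have h2 : ∑ η ∈ S, w β L η * (-Real.log Z * gam β L n V (T0 + T) η + (gam β L n V (T0 + T) η - Z⁻¹)) ≤ F (T0 + T) := by
      refine Finset.sum_le_sum fun η hη => mul_le_mul_of_nonneg_left ?_ (w_pos _ _ _).le
      have hg := gam_nonneg β hV (T0 + T) η hη
      rcases hg.eq_or_lt with h0 | h0
      · rw [← h0]; simp; linarith
      · generalize gam β L n V (T0 + T) η = g at *
        have := Real.log_le_sub_one_of_pos (show 0 < (g * Z)⁻¹ by positivity)
        rw [Real.log_inv, Real.log_mul h0.ne' (by linarith)] at this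
        have h3 := mul_le_mul_of_nonneg_left this h0.le
        have h4 : g * ((g * Z)⁻¹ - 1) = Z⁻¹ - g := by field_simp
        rw [h4] at h3; linarith
    have h3 := gam_one β (n := n) hL (V := V) (T0 + T)
    simp only [mul_add, mul_sub, Finset.sum_add_distrib, Finset.sum_sub_distrib, ← Finset.sum_mul] at h2
    have h4 : ∑ η ∈ S, w β L η * (-Real.log Z * gam β L n V (T0 + T) η) = -Real.log Z := by
      have h5 : ∑ η ∈ S, w β L η * (-Real.log Z * gam β L n V (T0 + T) η) = -Real.log Z * ∑ η ∈ S, w β L η * gam β L n V (T0 + T) η := by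
        rw [Finset.mul_sum]; exact Finset.sum_congr rfl fun η _ => by ring
      rw [h5, h3, mul_one]
    rw [h4, h3, show ∑ η ∈ S, w β L η = Z from rfl, mul_inv_cancel₀ (by linarith)] at h2
    linarith
  have h5 := hsum T0 T
  have h6 : ∑ i ∈ Finset.range T, e (T0 + i) ≤ ∑ i ∈ Finset.range T, (L ^ 2 * Real.log (n + 1)) / T := by
    rw [Finset.sum_const, Finset.card_range, nsmul_eq_mul, mul_div_cancel₀ _ (by positivity)]; linarith
  obtain ⟨i, hi, h7⟩ := Finset.exists_le_of_sum_le (Finset.nonempty_range_iff.2 hT.ne') h6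
  refine ⟨T0 + i, by omega, by have := Finset.mem_range.1 hi; omega, ?_⟩
  rw [le_div_iff₀ (by positivity)] at h7
  simp only [he] at h7
  have hM : (0 : ℝ) < (L : ℝ) ^ 2 := by positivity
  have h8 := mul_le_mul_of_nonneg_left h7 hM.le
  calc _ = (L : ℝ) ^ 2 * (((L : ℝ) ^ 2)⁻¹ * DE β L n V (fun η => √(gam β L n V (T0 + i) η)) * T) := by field_simp
    _ ≤ _ := h8
    _ = _ := by ring

lemma Tx_pmin {β : ℝ} (hβ : 0 ≤ β) {L n : ℕ} {x : Site} {f : Config → ℝ} (hf : ∀ σ, 0 ≤ f σ) (η : Config) :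
    ∑ v ∈ Finset.Icc (0 : ℤ) n, f (up η x v) ≤ (n + 1) * Real.exp (4 * β * n) * Tx β L n x f η := by
  rw [Tx, ← mul_div_assoc, le_div_iff₀ (zx_pos ..), Finset.sum_mul, Finset.mul_sum]
  refine Finset.sum_le_sum fun v hv => ?_
  rw [Finset.mem_Icc] at hv
  have h1 : zx β L n x η ≤ (n + 1) * Real.exp (4 * β * n) * w β L (up η x v) := by
    calc zx β L n x η ≤ ∑ u ∈ Finset.Icc (0 : ℤ) n, Real.exp (4 * β * n) * w β L (up η x v) := by
          refine Finset.sum_le_sum fun u hu => ?_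
          rw [Finset.mem_Icc] at hu
          rw [w, w, ← Real.exp_add]
          refine Real.exp_le_exp.2 ?_
          have := en_mod (L := L) (A := {x}) (σ := up η x v) (η := up η x u) (k := n) (by omega)
            (fun y hy => by rw [up_ne _ _ (by simpa using hy), up_ne _ _ (by simpa using hy)])
            (fun y hy => by
              rw [Finset.mem_singleton] at hy; subst hy
              rw [up_at, up_at, abs_le]; omega)
          rw [Finset.card_singleton] at this
          have h2 : (en L (up η x v) : ℝ) ≤ en L (up η x u) + 4 * n := by exact_mod_cast (by simpa using this)
          nlinarith
      _ = _ := by rw [Finset.sum_const, Int.card_Icc, nsmul_eq_mul]; simp; ring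
  have h2 := mul_le_mul_of_nonneg_right h1 (hf (up η x v))
  linarith

section
attribute [local irreducible] w St

/-! orderings of a rectangle with small interface cost -/
def cost (L : ℕ) (R A : Finset Site) (d : Site → ℝ) : ℝ :=
  ∑ e ∈ eds L, if e.1 ∈ R ∧ nb e.1 e.2 ∈ R ∧ ¬ (e.1 ∈ A ↔ nb e.1 e.2 ∈ A) then 2 * min (d e.1) (d (nb e.1 e.2)) else 0

def Ord (L : ℕ) (R : Finset Site) (d : Site → ℝ) (M : ℝ) : Prop :=
  ∃ l : List Site, l.Nodup ∧ l.toFinset = R ∧ ∀ i, cost L R (l.take i).toFinset d ≤ M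

lemma cost_congr {L : ℕ} {R A A' : Finset Site} (d : Site → ℝ) (h : ∀ x ∈ R, x ∈ A ↔ x ∈ A') :
    cost L R A d = cost L R A' d := by
  refine Finset.sum_congr rfl fun e _ => ?_
  by_cases h1 : e.1 ∈ R
  · by_cases h2 : nb e.1 e.2 ∈ R
    · simp only [h _ h1, h _ h2]
    · simp [h2]
  · simp [h1]

lemma cost_empty (L : ℕ) (R : Finset Site) (d : Site → ℝ) : cost L R ∅ d = 0 :=
  Finset.sum_eq_zero fun e _ => by simp

lemma cost_full (L : ℕ) {R A : Finset Site} (h : R ⊆ A) (d : Site → ℝ) : cost L R A d = 0 := by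
  rw [cost_congr d (A' := R) fun x hx => ⟨fun _ => hx, fun _ => h hx⟩]
  exact Finset.sum_eq_zero fun e _ => by rw [if_neg]; tauto

lemma cost_split {L : ℕ} {R R1 R2 C : Finset Site} {b : Bool} {d : Site → ℝ} (hd : ∀ x, 0 ≤ d x) (hR : R = R1 ∪ R2)
    (hC : ∀ x c, x ∈ R1 ∧ nb x c ∈ R2 ∨ x ∈ R2 ∧ nb x c ∈ R1 → x ∈ C ∧ c = b) (A : Finset Site) :
    cost L R A d ≤ cost L R1 A d + cost L R2 A d + 2 * ∑ x ∈ C, d x := by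
  have h1 : ∑ e ∈ eds L, (if e.1 ∈ C ∧ e.2 = b then 2 * d e.1 else 0) ≤ 2 * ∑ x ∈ C, d x := by
    rw [← Finset.sum_filter, Finset.mul_sum]
    refine sum_inj_le (fun e => e.1) (fun e he => ?_) (fun e he e' he' h => ?_) (fun e _ => le_rfl) (fun x _ => by have := hd x; linarith)
    · exact (Finset.mem_filter.1 he).2.1
    · exact Prod.ext h ((Finset.mem_filter.1 he).2.2.trans (Finset.mem_filter.1 he').2.2.symm)
  refine le_trans ?_ (add_le_add_right h1 _)
  rw [cost, cost, cost, ← Finset.sum_add_distrib, ← Finset.sum_add_distrib]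
  refine Finset.sum_le_sum fun e _ => ?_
  have m0 : 0 ≤ min (d e.1) (d (nb e.1 e.2)) := le_min (hd _) (hd _)
  have m1 : min (d e.1) (d (nb e.1 e.2)) ≤ d e.1 := min_le_left _ _
  have := hC e.1 e.2
  subst hR
  generalize min (d e.1) (d (nb e.1 e.2)) = m at *
  have nn : ∀ (P : Prop) [Decidable P] (z : ℝ), 0 ≤ z → 0 ≤ if P then z else 0 := fun P _ z hz => by
    split_ifs <;> linarith
  have hd1 := hd e.1
  by_cases hc : e.1 ∈ R1 ∪ R2 ∧ nb e.1 e.2 ∈ R1 ∪ R2 ∧ ¬ (e.1 ∈ A ↔ nb e.1 e.2 ∈ A)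
  · rw [if_pos hc]
    obtain ⟨h1, h2, h3⟩ := hc
    have g0 := nn (e.1 ∈ C ∧ e.2 = b) (2 * d e.1) (by linarith)
    have g1 := nn (e.1 ∈ R1 ∧ nb e.1 e.2 ∈ R1 ∧ ¬ (e.1 ∈ A ↔ nb e.1 e.2 ∈ A)) (2 * m) (by linarith)
    have g2 := nn (e.1 ∈ R2 ∧ nb e.1 e.2 ∈ R2 ∧ ¬ (e.1 ∈ A ↔ nb e.1 e.2 ∈ A)) (2 * m) (by linarith)
    rcases Finset.mem_union.1 h1 with h1 | h1 <;> rcases Finset.mem_union.1 h2 with h2 | h2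
    · rw [if_pos (show e.1 ∈ R1 ∧ nb e.1 e.2 ∈ R1 ∧ ¬ (e.1 ∈ A ↔ nb e.1 e.2 ∈ A) from ⟨h1, h2, h3⟩)]; linarith
    · rw [if_pos (this (Or.inl ⟨h1, h2⟩))]; linarith
    · rw [if_pos (this (Or.inr ⟨h1, h2⟩))]; linarith
    · rw [if_pos (show e.1 ∈ R2 ∧ nb e.1 e.2 ∈ R2 ∧ ¬ (e.1 ∈ A ↔ nb e.1 e.2 ∈ A) from ⟨h1, h2, h3⟩)]; linarith
  · rw [if_neg hc]
    exact add_nonneg (add_nonneg (nn _ _ (by linarith)) (nn _ _ (by linarith))) (nn _ _ (by linarith))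

lemma ord_split {L : ℕ} {R R1 R2 C : Finset Site} {b : Bool} {d : Site → ℝ} {M : ℝ} (hd : ∀ x, 0 ≤ d x) (hR : R = R1 ∪ R2)
    (hdj : Disjoint R1 R2)
    (hC : ∀ x c, x ∈ R1 ∧ nb x c ∈ R2 ∨ x ∈ R2 ∧ nb x c ∈ R1 → x ∈ C ∧ c = b)
    (h1 : Ord L R1 d M) (h2 : Ord L R2 d M) : Ord L R d (M + 2 * ∑ x ∈ C, d x) := by
  obtain ⟨l1, n1, e1, c1⟩ := h1
  obtain ⟨l2, n2, e2, c2⟩ := h2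
  have m1 : ∀ x, x ∈ l1 ↔ x ∈ R1 := fun x => by rw [← e1, List.mem_toFinset]
  have m2 : ∀ x, x ∈ l2 ↔ x ∈ R2 := fun x => by rw [← e2, List.mem_toFinset]
  have dj := Finset.disjoint_left.1 hdj
  refine ⟨l1 ++ l2, ?_, ?_, fun i => ?_⟩
  · rw [List.nodup_append']
    refine ⟨n1, n2, fun x hx hx' => dj ((m1 x).1 hx) ((m2 x).1 hx')⟩
  · rw [List.toFinset_append, e1, e2, hR]
  · refine (cost_split hd hR hC _).trans (add_le_add_left ?_ _)
    rw [List.take_append]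
    rcases le_total i l1.length with hi | hi
    · rw [Nat.sub_eq_zero_of_le hi, List.take_zero, List.append_nil]
      have : cost L R2 (l1.take i).toFinset d = 0 := by
        rw [cost_congr d (A' := ∅), cost_empty]
        intro x hx
        simp only [List.mem_toFinset, Finset.notMem_empty, iff_false]
        exact fun h => dj ((m1 x).1 (List.mem_of_mem_take h)) hx
      rw [this, add_zero]; exact c1 i
    · have h3 : cost L R1 (l1.take i ++ l2.take (i - l1.length)).toFinset d = 0 := by
        refine cost_full L (fun x hx => ?_) d
        rw [List.take_of_length_le hi, List.mem_toFinset]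
        exact List.mem_append_left _ ((m1 x).2 hx)
      rw [h3, zero_add]
      refine le_trans (le_of_eq (cost_congr d fun x hx => ?_)) (c2 (i - l1.length))
      simp only [List.mem_toFinset, List.mem_append]
      refine ⟨fun h => h.resolve_left fun h => dj ((m1 x).1 (List.mem_of_mem_take h)) hx, Or.inr⟩

lemma ord_mono {L : ℕ} {R : Finset Site} {d : Site → ℝ} {M M' : ℝ} (h : M ≤ M') (h1 : Ord L R d M) : Ord L R d M' := by
  obtain ⟨l, a, b, c⟩ := h1
  exact ⟨l, a, b, fun i => (c i).trans h⟩

lemma pig {A : ℕ} (hA : 2 ≤ A) {f : ℕ → ℝ} (hf : ∀ i, 0 ≤ f i) {S : ℝ} (h : ∑ i ∈ Finset.range A, f i ≤ S) :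
    ∃ m, 1 ≤ m ∧ m < A ∧ 4 * m ≤ 3 * A ∧ 4 * (A - m) ≤ 3 * A ∧ A * f (m - 1) ≤ 4 * S := by
  by_contra! hc
  have h0 : 0 ≤ S := (Finset.sum_nonneg fun i _ => hf i).trans h
  have h1 : ∀ m ∈ Finset.Icc ((A + 3) / 4) (3 * A / 4), 4 * S / A < f (m - 1) := by
    intro m hm
    rw [Finset.mem_Icc] at hm
    have := hc m (by omega) (by omega) (by omega) (by omega)
    rw [div_lt_iff₀ (by positivity)]; linarith
  have hne : (Finset.Icc ((A + 3) / 4) (3 * A / 4)).Nonempty := ⟨(A + 3) / 4, by rw [Finset.mem_Icc]; omega⟩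
  have h2 := Finset.sum_lt_sum_of_nonempty hne h1
  rw [Finset.sum_const, nsmul_eq_mul, Nat.card_Icc] at h2
  have h3 : ∑ m ∈ Finset.Icc ((A + 3) / 4) (3 * A / 4), f (m - 1) ≤ ∑ i ∈ Finset.range A, f i := by
    refine sum_inj_le (fun m => m - 1) (fun m hm => ?_) (fun m hm m' hm' hh => ?_) (fun _ _ => le_rfl) (fun _ _ => hf _)
    · rw [Finset.mem_Icc] at hm; rw [Finset.mem_range]; omega
    · simp only [Finset.coe_Icc, Set.mem_Icc, Finset.mem_Icc] at hm hm'
      simp only at hh; omega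
  have h4 : A ≤ 4 * (3 * A / 4 + 1 - (A + 3) / 4) := by omega
  have h5 : (A : ℝ) ≤ 4 * ((3 * A / 4 + 1 - (A + 3) / 4 : ℕ) : ℝ) := by exact_mod_cast h4
  have hA' : (0 : ℝ) < A := by positivity
  have h6 : S ≤ ((3 * A / 4 + 1 - (A + 3) / 4 : ℕ) : ℝ) * (4 * S / A) := by
    rw [← mul_div_assoc, le_div_iff₀ hA']; nlinarith
  linarith

lemma cut_arith {A m : ℝ} (hA : 0 ≤ A) (hm : 4 * m ≤ 3 * A) : √m ≤ 7 / 8 * √A := by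
  rw [show (7 / 8 : ℝ) = √((7 / 8) ^ 2) from (Real.sqrt_sq (by norm_num)).symm, ← Real.sqrt_mul (by positivity)]
  exact Real.sqrt_le_sqrt (by nlinarith)

lemma col_arith {C : Finset Site} {d : Site → ℝ} (hd : ∀ x, 0 ≤ d x) {A B : ℕ} (hA : 0 < A) (hBA : B ≤ A) (hC : C.card ≤ B)
    {Θ : ℝ} (hΘ : 0 ≤ Θ) (h : A * ∑ x ∈ C, d x ^ 4 ≤ 4 * Θ ^ 4) : ∑ x ∈ C, d x ≤ 3 / 2 * Θ * √A := by
  have hA' : (0 : ℝ) < A := by positivity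
  have h0 : 0 ≤ ∑ x ∈ C, d x ^ 4 := Finset.sum_nonneg fun x _ => by have := hd x; positivity
  have h1 : (∑ x ∈ C, d x) ^ 4 ≤ (C.card : ℝ) ^ 3 * ∑ x ∈ C, d x ^ 4 := by
    rcases C.eq_empty_or_nonempty with rfl | hne
    · simp
    have := pow_sum_div_card_le_sum_pow (s := C) (f := d) (n := 3) (fun x _ => hd x)
    have hc : (0 : ℝ) < C.card := by exact_mod_cast hne.card_pos
    rw [div_le_iff₀ (by positivity)] at this
    norm_num at this; linarith
  have h2 : (C.card : ℝ) ^ 3 ≤ (A : ℝ) ^ 3 := by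
    have : (C.card : ℝ) ≤ A := by exact_mod_cast hC.trans hBA
    exact pow_le_pow_left₀ (by positivity) this 3
  have h3 : (∑ x ∈ C, d x) ^ 4 ≤ (3 / 2 * Θ * √A) ^ 4 := by
    have h4 : (√(A : ℝ)) ^ 4 = (A : ℝ) ^ 2 := by
      rw [show (√(A : ℝ)) ^ 4 = (√(A : ℝ) ^ 2) ^ 2 by ring, Real.sq_sqrt hA'.le]
    rw [mul_pow, mul_pow, h4]
    calc _ ≤ (A : ℝ) ^ 3 * ∑ x ∈ C, d x ^ 4 := h1.trans (mul_le_mul_of_nonneg_right h2 h0)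
      _ = (A : ℝ) ^ 2 * (A * ∑ x ∈ C, d x ^ 4) := by ring
      _ ≤ (A : ℝ) ^ 2 * (4 * Θ ^ 4) := mul_le_mul_of_nonneg_left h (by positivity)
      _ ≤ _ := by nlinarith [show (0:ℝ) ≤ (A : ℝ) ^ 2 * Θ ^ 4 by positivity]
  exact le_of_pow_le_pow_left₀ (by norm_num) (by positivity) h3

lemma ord_rect (L : ℕ) {d : Site → ℝ} (hd : ∀ x, 0 ≤ d x) {Θ : ℝ} (hΘ : 0 ≤ Θ) : ∀ (s A B : ℕ), A + B ≤ s → 1 ≤ A → 1 ≤ B → ∀ a b : ℤ,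
    ∑ x ∈ rect (a + 1) (a + A) (b + 1) (b + B), d x ^ 4 ≤ Θ ^ 4 →
    Ord L (rect (a + 1) (a + A) (b + 1) (b + B)) d (24 * Θ * (√A + √B)) := by
  intro s
  induction s with
  | zero => intro A B h h1 h2; omega
  | succ s ih =>
  intro A B hs hA hB a b hsum
  have hd4 : ∀ x, 0 ≤ d x ^ 4 := fun x => by have := hd x; positivity
  have key : ∀ R' ⊆ rect (a + 1) (a + A) (b + 1) (b + B), ∑ x ∈ R', d x ^ 4 ≤ Θ ^ 4 := fun R' h =>
    (Finset.sum_le_sum_of_subset_of_nonneg h fun x _ _ => hd4 x).trans hsum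
  rcases Nat.lt_or_ge (max A B) 2 with hlt | hge
  · have hA1 : A = 1 := by omega
    have hB1 : B = 1 := by omega
    subst hA1; subst hB1
    refine ⟨[(a + 1, b + 1)], by simp, ?_, fun i => ?_⟩
    · ext x
      simp only [List.toFinset_cons, List.toFinset_nil, mem_rect, insert_empty_eq, Finset.mem_singleton, Prod.ext_iff]
      push_cast; omega
    · have : cost L (rect (a + 1) (a + (1 : ℕ)) (b + 1) (b + (1 : ℕ))) ([(a + 1, b + 1)].take i).toFinset d = 0 := by
        refine Finset.sum_eq_zero fun e _ => ?_
        rw [if_neg]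
        rintro ⟨h1, h2, -⟩
        rw [mem_rect] at h1 h2
        obtain ⟨x, c⟩ := e
        cases c <;> simp [nb] at h1 h2 <;> omega
      rw [this]; positivity
  rcases le_total B A with hBA | hAB
  · have hA2 : 2 ≤ A := by omega
    obtain ⟨m, m1, m2, m3, m4, hm⟩ := pig hA2 (f := fun i => ∑ x ∈ rect (a + i + 1) (a + i + 1) (b + 1) (b + B), d x ^ 4)
      (fun i => Finset.sum_nonneg fun x _ => hd4 x) (S := Θ ^ 4) (by
        rw [← Finset.sum_biUnion]
        · refine key _ fun x hx => ?_
          rw [Finset.mem_biUnion] at hx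
          obtain ⟨i, hi, hx⟩ := hx
          rw [Finset.mem_range] at hi
          rw [mem_rect] at hx ⊢; omega
        · intro i _ j _ hij
          refine Finset.disjoint_left.2 fun x hx hx' => hij ?_
          rw [mem_rect] at hx hx'; omega)
    have hcol := col_arith hd (by omega) hBA (C := rect (a + m) (a + m) (b + 1) (b + B)) (by
      rw [card_rect]; simp) hΘ (by
      rw [show a + ((m - 1 : ℕ) : ℤ) + 1 = a + m by omega] at hm; exact hm)
    have s1 := ih m B (by omega) m1 hB a b (key _ fun x hx => by rw [mem_rect] at hx ⊢; omega)
    have s2 := ih (A - m) B (by omega) (by omega) hB (a + m) b (key _ fun x hx => by rw [mem_rect] at hx ⊢; omega)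
    have r1 := cut_arith (A := A) (m := m) (by positivity) (by exact_mod_cast m3)
    have r2 := cut_arith (A := A) (m := (A - m : ℕ)) (by positivity) (by exact_mod_cast m4)
    have r3 : ∀ q : ℝ, q ≤ 7 / 8 * √A → 24 * Θ * (q + √B) ≤ 24 * Θ * (7 / 8 * √A + √B) := fun q hq =>
      mul_le_mul_of_nonneg_left (by linarith) (by positivity)
    have := ord_split (R := rect (a + 1) (a + A) (b + 1) (b + B)) (C := rect (a + m) (a + m) (b + 1) (b + B)) (b := false) hd
      (by ext x; rw [Finset.mem_union, mem_rect, mem_rect, mem_rect]; omega)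
      (by refine Finset.disjoint_left.2 fun x hx hx' => ?_
          rw [mem_rect] at hx hx'; omega)
      (by intro x c h
          rw [mem_rect, mem_rect, mem_rect, mem_rect] at h
          rw [mem_rect]
          cases c <;> simp [nb] at h ⊢ <;> omega)
      (ord_mono (r3 _ r1) s1) (ord_mono (r3 _ r2) s2)
    refine ord_mono ?_ this
    linarith
  · have hB2 : 2 ≤ B := by omega
    obtain ⟨m, m1, m2, m3, m4, hm⟩ := pig hB2 (f := fun i => ∑ x ∈ rect (a + 1) (a + A) (b + i + 1) (b + i + 1), d x ^ 4)
      (fun i => Finset.sum_nonneg fun x _ => hd4 x) (S := Θ ^ 4) (by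
        rw [← Finset.sum_biUnion]
        · refine key _ fun x hx => ?_
          rw [Finset.mem_biUnion] at hx
          obtain ⟨i, hi, hx⟩ := hx
          rw [Finset.mem_range] at hi
          rw [mem_rect] at hx ⊢; omega
        · intro i _ j _ hij
          refine Finset.disjoint_left.2 fun x hx hx' => hij ?_
          rw [mem_rect] at hx hx'; omega)
    have hcol := col_arith hd (by omega) hAB (C := rect (a + 1) (a + A) (b + m) (b + m)) (by
      rw [card_rect]; simp) hΘ (by
      rw [show b + ((m - 1 : ℕ) : ℤ) + 1 = b + m by omega] at hm; exact hm)
    have s1 := ih A m (by omega) hA m1 a b (key _ fun x hx => by rw [mem_rect] at hx ⊢; omega)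
    have s2 := ih A (B - m) (by omega) hA (by omega) a (b + m) (key _ fun x hx => by rw [mem_rect] at hx ⊢; omega)
    have r1 := cut_arith (A := B) (m := m) (by positivity) (by exact_mod_cast m3)
    have r2 := cut_arith (A := B) (m := (B - m : ℕ)) (by positivity) (by exact_mod_cast m4)
    have r3 : ∀ q : ℝ, q ≤ 7 / 8 * √B → 24 * Θ * (√A + q) ≤ 24 * Θ * (√A + 7 / 8 * √B) := fun q hq =>
      mul_le_mul_of_nonneg_left (by linarith) (by positivity)
    have := ord_split (R := rect (a + 1) (a + A) (b + 1) (b + B)) (C := rect (a + 1) (a + A) (b + m) (b + m)) (b := true) hd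
      (by ext x; rw [Finset.mem_union, mem_rect, mem_rect, mem_rect]; omega)
      (by refine Finset.disjoint_left.2 fun x hx hx' => ?_
          rw [mem_rect] at hx hx'; omega)
      (by intro x c h
          rw [mem_rect, mem_rect, mem_rect, mem_rect] at h
          rw [mem_rect]
          cases c <;> simp [nb] at h ⊢ <;> omega)
      (ord_mono (r3 _ r1) s1) (ord_mono (r3 _ r2) s2)
    refine ord_mono ?_ this
    linarith

lemma abs_swap (a b c d : ℤ) : |a - d| + |c - b| ≤ |a - b| + |c - d| + 2 * min |a - c| |b - d| := by
  rcases le_total |a - c| |b - d| with h | h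
  · rw [min_eq_left h]
    have h1 : |a - d| ≤ |a - c| + |c - d| := abs_sub_le _ _ _
    have h2 : |c - b| ≤ |c - a| + |a - b| := abs_sub_le _ _ _
    rw [abs_sub_comm c a] at h2; linarith
  · rw [min_eq_right h]
    have h1 : |a - d| ≤ |a - b| + |b - d| := abs_sub_le _ _ _
    have h2 : |c - b| ≤ |c - d| + |d - b| := abs_sub_le _ _ _
    rw [abs_sub_comm d b] at h2; linarith

lemma en_glue {L : ℕ} {Q A : Finset Site} {η σ : Config} (h : ∀ x ∉ Q, η x = σ x) :
    (en L (glue A σ η) : ℝ) + en L (glue A η σ) ≤ en L η + en L σ + cost L Q A (fun x => ((|η x - σ x| : ℤ) : ℝ)) := by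
  rw [en, en, en, en, cost]
  push_cast
  rw [← Finset.sum_add_distrib, ← Finset.sum_add_distrib, ← Finset.sum_add_distrib]
  refine Finset.sum_le_sum fun e _ => ?_
  have hx := h e.1
  have hy := h (nb e.1 e.2)
  simp only [glue]
  generalize nb e.1 e.2 = y at *
  generalize e.1 = x at *
  have s1 := abs_swap (σ x) (σ y) (η x) (η y)
  have s2 := abs_swap (η x) (η y) (σ x) (σ y)
  rw [abs_sub_comm (σ x) (η x), abs_sub_comm (σ y) (η y)] at s1
  have s1' : ((|σ x - η y| + |η x - σ y| : ℤ) : ℝ) ≤ _ := Int.cast_le.2 s1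
  have s2' : ((|η x - σ y| + |σ x - η y| : ℤ) : ℝ) ≤ _ := Int.cast_le.2 s2
  push_cast at s1' s2'
  have mn : (0 : ℝ) ≤ 2 * min |(η x : ℝ) - σ x| |(η y : ℝ) - σ y| :=
    mul_nonneg (by norm_num) (le_min (abs_nonneg _) (abs_nonneg _))
  have hM : ∀ M : ℝ, M = (if x ∈ Q ∧ y ∈ Q ∧ ¬ (x ∈ A ↔ y ∈ A) then 2 * min |(η x : ℝ) - σ x| |(η y : ℝ) - σ y| else 0) →
      0 ≤ M ∧ (¬ (x ∈ A ↔ y ∈ A) → |(η x : ℝ) - σ y| + |(σ x : ℝ) - η y| ≤ |(η x : ℝ) - η y| + |(σ x : ℝ) - σ y| + M) := by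
    rintro M rfl
    refine ⟨by split_ifs <;> linarith, fun hA => ?_⟩
    by_cases hq : x ∈ Q ∧ y ∈ Q
    · rw [if_pos ⟨hq.1, hq.2, hA⟩]; linarith
    · rw [if_neg (fun h => hq ⟨h.1, h.2.1⟩)]
      by_cases hxq : x ∈ Q
      · rw [hy (fun h => hq ⟨hxq, h⟩)]; linarith
      · rw [hx hxq]; linarith
  obtain ⟨q1, q2⟩ := hM _ rfl
  generalize (if x ∈ Q ∧ y ∈ Q ∧ ¬ (x ∈ A ↔ y ∈ A) then 2 * min |(η x : ℝ) - σ x| |(η y : ℝ) - σ y| else 0) = M at *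
  by_cases h1 : x ∈ A <;> by_cases h2 : y ∈ A
  · simp only [h1, h2, if_true]; linarith
  · have := q2 (fun h => h2 (h.1 h1)); simp only [h1, h2, if_true, if_false]; linarith
  · have := q2 (fun h => h1 (h.2 h2)); simp only [h1, h2, if_true, if_false]; linarith
  · simp only [h1, h2, if_false]; linarith

def ordl (L : ℕ) (Q : Finset Site) (κ : ℝ) (d : Site → ℝ) : List Site :=
  if h : Ord L Q d κ then h.choose else []

lemma sq_sum_le' (m : ℕ) (f : ℕ → ℝ) : (∑ i ∈ Finset.range m, f i) ^ 2 ≤ m * ∑ i ∈ Finset.range m, f i ^ 2 := by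
  have := sq_sum_le_card_mul_sum_sq (s := Finset.range m) (f := f)
  rwa [Finset.card_range] at this

lemma canon {β : ℝ} (hβ : 0 ≤ β) {L n : ℕ} {Q : Finset Site} {G : Finset Config} {κ : ℝ} (hG : G ⊆ St Q 0 n)
    (hO : ∀ η ∈ G, ∀ σ ∈ G, Ord L Q (fun x => ((|η x - σ x| : ℤ) : ℝ)) κ) (φ : Config → ℝ) :
    ∑ p ∈ G ×ˢ G, w β L p.1 * w β L p.2 * (φ p.1 - φ p.2) ^ 2 ≤
      (Q.card : ℝ) ^ 2 * Real.exp (β * κ) * sw β L (St Q 0 n) * ((n + 1) * Real.exp (4 * β * n)) * (2 * DE β L n Q φ) := by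
  set S := St Q 0 (n : ℤ) with hS
  set m := Q.card with hm
  set K : ℝ := (n + 1) * Real.exp (4 * β * n) with hK
  let D : Config → Config → Site → ℝ := fun η σ x => ((|η x - σ x| : ℤ) : ℝ)
  let A : ℕ → Config × Config → Finset Site := fun i p => ((ordl L Q κ (D p.1 p.2)).take i).toFinset
  let Z : ℕ → Config × Config → Config := fun i p => glue (A i p) p.2 p.1
  let Z' : ℕ → Config × Config → Config := fun i p => glue (A i p) p.1 p.2
  have hl : ∀ p ∈ G ×ˢ G, (ordl L Q κ (D p.1 p.2)).Nodup ∧ (ordl L Q κ (D p.1 p.2)).toFinset = Q ∧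
      ∀ i, cost L Q (A i p) (D p.1 p.2) ≤ κ := fun p hp => by
    have h := hO p.1 (Finset.mem_product.1 hp).1 p.2 (Finset.mem_product.1 hp).2
    have : ordl L Q κ (D p.1 p.2) = h.choose := dif_pos h
    simp only [A]
    rw [this]; exact h.choose_spec
  have hmem : ∀ p ∈ G ×ˢ G, p.1 ∈ S ∧ p.2 ∈ S := fun p hp =>
    ⟨hG (Finset.mem_product.1 hp).1, hG (Finset.mem_product.1 hp).2⟩
  have hgl : ∀ (A : Finset Site) (η σ : Config), η ∈ S → σ ∈ S → glue A η σ ∈ S := fun A η σ h1 h2 => by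
    rw [hS, mem_St] at *
    refine ⟨fun x hx => ?_, fun x hx => ?_⟩ <;> simp only [glue] <;> split_ifs
    exacts [h1.1 x hx, h2.1 x hx, h1.2 x hx, h2.2 x hx]
  let g : Config → ℝ := fun ζ => ∑ x ∈ Q, ∑ v ∈ Finset.Icc (0 : ℤ) n, (φ ζ - φ (up ζ x v)) ^ 2
  have hg0 : ∀ ζ, 0 ≤ g ζ := fun ζ => Finset.sum_nonneg fun x _ => Finset.sum_nonneg fun v _ => sq_nonneg _
  -- one step
  have hstep : ∀ p ∈ G ×ˢ G, ∀ i < m, (φ (Z (i + 1) p) - φ (Z i p)) ^ 2 ≤ g (Z i p) := by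
    intro p hp i hi
    obtain ⟨l1, l2, -⟩ := hl p hp
    have hlen : (ordl L Q κ (D p.1 p.2)).length = m := by
      have := List.toFinset_card_of_nodup l1; rw [l2] at this; exact this.symm
    have hi' : i < (ordl L Q κ (D p.1 p.2)).length := hlen ▸ hi
    set x := (ordl L Q κ (D p.1 p.2))[i] with hx
    have hxQ : x ∈ Q := by rw [← l2, List.mem_toFinset]; exact List.getElem_mem _
    have hA : ∀ y, y ∈ A (i + 1) p ↔ y ∈ A i p ∨ y = x := fun y => by
      simp only [A]
      rw [List.mem_toFinset, List.mem_toFinset, List.take_succ_eq_append_getElem hi', List.mem_append, List.mem_singleton]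
    have hZ : Z (i + 1) p = up (Z i p) x (p.2 x) := by
      funext y
      by_cases hy : y = x
      · subst hy; rw [up_at]; simp only [Z, glue]; rw [if_pos ((hA x).2 (Or.inr rfl))]
      · rw [up_ne _ _ hy]; simp only [Z, glue, hA, hy, or_false]
    have h2 := (mem_St.1 (hmem p hp).2).1 x hxQ
    rw [hZ, ← neg_sq, neg_sub]
    refine le_trans ?_ (Finset.single_le_sum (f := fun x => ∑ v ∈ Finset.Icc (0 : ℤ) n, (φ (Z i p) - φ (up (Z i p) x v)) ^ 2)
      (fun x _ => Finset.sum_nonneg fun v _ => sq_nonneg _) hxQ)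
    exact Finset.single_le_sum (f := fun v => (φ (Z i p) - φ (up (Z i p) x v)) ^ 2)
      (fun v _ => sq_nonneg _) (Finset.mem_Icc.2 h2)
  have hpath : ∀ p ∈ G ×ˢ G, (φ p.1 - φ p.2) ^ 2 ≤ m * ∑ i ∈ Finset.range m, g (Z i p) := by
    intro p hp
    obtain ⟨l1, l2, -⟩ := hl p hp
    have hlen : (ordl L Q κ (D p.1 p.2)).length = m := by
      have := List.toFinset_card_of_nodup l1; rw [l2] at this; exact this.symm
    have h0 : Z 0 p = p.1 := by funext y; simp [Z, A, glue]
    have h1 : Z m p = p.2 := by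
      funext y
      simp only [Z, A, glue]
      rw [List.take_of_length_le hlen.le, l2]
      split_ifs with hy
      · rfl
      · rw [(mem_St.1 (hmem p hp).1).2 y hy, (mem_St.1 (hmem p hp).2).2 y hy]
    have h2 := Finset.sum_range_sub (fun i => φ (Z i p)) m
    rw [h0, h1] at h2
    rw [← neg_sq, neg_sub, ← h2]
    refine (sq_sum_le' _ _).trans (mul_le_mul_of_nonneg_left ?_ (Nat.cast_nonneg _))
    exact Finset.sum_le_sum fun i hi => hstep p hp i (Finset.mem_range.1 hi)
  have hw : ∀ p ∈ G ×ˢ G, ∀ i, w β L p.1 * w β L p.2 ≤ Real.exp (β * κ) * (w β L (Z i p) * w β L (Z' i p)) := by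
    intro p hp i
    have h1 := en_glue (L := L) (Q := Q) (A := A i p) (η := p.1) (σ := p.2) (fun x hx => by
      rw [(mem_St.1 (hmem p hp).1).2 x hx, (mem_St.1 (hmem p hp).2).2 x hx])
    have h2 : cost L Q (A i p) (fun x => ((|p.1 x - p.2 x| : ℤ) : ℝ)) ≤ κ := (hl p hp).2.2 i
    simp only [w, ← Real.exp_add]
    refine Real.exp_le_exp.2 ?_
    have h3 : (en L (Z i p) : ℝ) + en L (Z' i p) ≤ en L p.1 + en L p.2 + κ := by simp only [Z, Z']; linarith
    nlinarith
  have hsum : ∀ i, ∑ p ∈ G ×ˢ G, w β L (Z i p) * w β L (Z' i p) * g (Z i p) ≤ sw β L S * (K * (2 * DE β L n Q φ)) := by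
    intro i
    calc _ ≤ ∑ q ∈ S ×ˢ S, w β L q.1 * w β L q.2 * g q.1 := by
          refine sum_inj_le (fun p => (Z i p, Z' i p)) (fun p hp => ?_) (fun p hp p' hp' hh => ?_) (fun _ _ => le_rfl)
            (fun q _ => mul_nonneg (mul_nonneg (w_pos _ _ _).le (w_pos _ _ _).le) (hg0 _))
          · exact Finset.mem_product.2 ⟨hgl _ _ _ (hmem p hp).2 (hmem p hp).1, hgl _ _ _ (hmem p hp).1 (hmem p hp).2⟩
          · obtain ⟨e1, e2⟩ := Prod.ext_iff.1 hh
            have hd : ∀ q : Config × Config, D (Z i q) (Z' i q) = D q.1 q.2 := fun q => by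
              funext x
              simp only [D, Z, Z', glue]
              split_ifs
              · rw [abs_sub_comm]
              · rfl
            have hD : D p.1 p.2 = D p'.1 p'.2 := by
              rw [← hd p, ← hd p']; simp only at e1 e2; rw [e1, e2]
            have hA : A i p = A i p' := by simp only [A, hD]
            refine Prod.ext ?_ ?_ <;> funext x <;> have f1 := congrFun e1 x <;> have f2 := congrFun e2 x <;>
              simp only [Z, Z', glue, hA] at f1 f2 <;> split_ifs at f1 f2 <;> assumption
      _ = sw β L S * ∑ ζ ∈ S, w β L ζ * g ζ := by
          rw [Finset.sum_product, mul_comm, sw, Finset.sum_mul]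
          refine Finset.sum_congr rfl fun ζ _ => ?_
          rw [Finset.mul_sum]
          exact Finset.sum_congr rfl fun ζ' _ => by simp only []; ring
      _ ≤ sw β L S * (K * (2 * DE β L n Q φ)) := by
          refine mul_le_mul_of_nonneg_left ?_ (sw_nonneg _ _ _)
          rw [← DE_grad, Finset.mul_sum]
          calc _ = ∑ x ∈ Q, ∑ ζ ∈ S, w β L ζ * ∑ v ∈ Finset.Icc (0 : ℤ) n, (φ ζ - φ (up ζ x v)) ^ 2 := by
                rw [Finset.sum_comm]; exact Finset.sum_congr rfl fun ζ _ => Finset.mul_sum _ _ _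
            _ ≤ _ := by
                refine Finset.sum_le_sum fun x _ => ?_
                rw [Finset.mul_sum]
                refine Finset.sum_le_sum fun ζ _ => ?_
                have := mul_le_mul_of_nonneg_left (Tx_pmin hβ (L := L) (n := n) (x := x) (f := fun σ => (φ ζ - φ σ) ^ 2)
                  (fun σ => sq_nonneg _) ζ) (w_pos β L ζ).le
                rw [← hK] at this
                linarith
  calc _ ≤ ∑ p ∈ G ×ˢ G, ∑ i ∈ Finset.range m, m * Real.exp (β * κ) * (w β L (Z i p) * w β L (Z' i p) * g (Z i p)) := by
        refine Finset.sum_le_sum fun p hp => ?_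
        refine (mul_le_mul_of_nonneg_left (hpath p hp) (mul_nonneg (w_pos _ _ _).le (w_pos _ _ _).le)).trans ?_
        rw [← mul_assoc, Finset.mul_sum]
        refine Finset.sum_le_sum fun i _ => ?_
        have := mul_le_mul_of_nonneg_right (hw p hp i) (mul_nonneg (Nat.cast_nonneg (α := ℝ) m) (hg0 (Z i p)))
        linarith
    _ = ∑ i ∈ Finset.range m, m * Real.exp (β * κ) * ∑ p ∈ G ×ˢ G, (w β L (Z i p) * w β L (Z' i p) * g (Z i p)) := by
        rw [Finset.sum_comm]; exact Finset.sum_congr rfl fun i _ => (Finset.mul_sum _ _ _).symm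
    _ ≤ ∑ i ∈ Finset.range m, m * Real.exp (β * κ) * (sw β L S * (K * (2 * DE β L n Q φ))) :=
        Finset.sum_le_sum fun i _ => mul_le_mul_of_nonneg_left (hsum i) (mul_nonneg (Nat.cast_nonneg _) (Real.exp_nonneg _))
    _ = _ := by rw [Finset.sum_const, Finset.card_range, nsmul_eq_mul]; ring

lemma aff_id {α : Type*} (G : Finset α) (w φ : α → ℝ) :
    ∑ p ∈ G ×ˢ G, w p.1 * w p.2 * (φ p.1 - φ p.2) ^ 2 =
      2 * (∑ x ∈ G, w x) * (∑ x ∈ G, w x * φ x ^ 2) - 2 * (∑ x ∈ G, w x * φ x) ^ 2 := by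
  have e : ∀ p : α × α, w p.1 * w p.2 * (φ p.1 - φ p.2) ^ 2 = (w p.1 * φ p.1 ^ 2) * w p.2 + w p.1 * (w p.2 * φ p.2 ^ 2)
      - 2 * ((w p.1 * φ p.1) * (w p.2 * φ p.2)) := fun p => by ring
  simp only [e, Finset.sum_sub_distrib, Finset.sum_add_distrib, ← Finset.mul_sum]
  rw [Finset.sum_product, Finset.sum_product, Finset.sum_product]
  simp only [← Finset.sum_mul, ← Finset.mul_sum]
  ring

lemma aff_bound {α : Type*} {S G : Finset α} (hGS : G ⊆ S) {w g u : α → ℝ} (hw : ∀ x ∈ S, 0 ≤ w x) (hg : ∀ x ∈ S, 0 ≤ g x)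
    (hg1 : ∑ x ∈ S, w x * g x = 1) {Z : ℝ} (hZ : 0 < Z) (hZe : ∑ x ∈ S, w x = Z) (hG : 19 / 20 * Z ≤ ∑ x ∈ G, w x)
    (hGg : 19 / 20 ≤ ∑ x ∈ G, w x * g x)
    (hR : ∑ p ∈ G ×ˢ G, w p.1 * w p.2 * (√(g p.1) - √(g p.2)) ^ 2 ≤ Z / 50) {D : ℝ} (hD : 0 ≤ D)
    (hu : ∀ x ∈ S, 1 - D ≤ u x) (hu1 : ∀ x ∈ S, u x ≤ 1) :
    (∑ x ∈ S, w x * u x) / Z - D / 2 ≤ ∑ x ∈ S, w x * (g x * u x) := by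
  set φ : α → ℝ := fun x => √(g x) with hφ
  have hφ2 : ∀ x ∈ S, φ x ^ 2 = g x := fun x hx => Real.sq_sqrt (hg x hx)
  have hid := aff_id G w φ
  rw [Finset.sum_congr rfl (fun x hx => by rw [hφ2 x (hGS hx)] : ∀ x ∈ G, w x * φ x ^ 2 = w x * g x)] at hid
  have hA0 : 0 ≤ ∑ x ∈ G, w x * φ x := Finset.sum_nonneg fun x hx => mul_nonneg (hw x (hGS hx)) (Real.sqrt_nonneg _)
  have hAB : ∑ x ∈ G, w x * φ x ≤ ∑ x ∈ S, w x * φ x :=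
    Finset.sum_le_sum_of_subset_of_nonneg hGS fun x hx _ => mul_nonneg (hw x hx) (Real.sqrt_nonneg _)
  set A := ∑ x ∈ G, w x * φ x
  set B := ∑ x ∈ S, w x * φ x with hB
  have hA2 : 0.8925 * Z ≤ A ^ 2 := by
    have : 19 / 20 * Z * (19 / 20) ≤ (∑ x ∈ G, w x) * (∑ x ∈ G, w x * g x) :=
      mul_le_mul hG hGg (by norm_num) (le_trans (by positivity) hG)
    nlinarith [hid, hR]
  have hB2 : 0.8925 * Z ≤ B ^ 2 := hA2.trans (by nlinarith)
  set p := (√Z)⁻¹ with hp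
  have hsZ : 0 < √Z := Real.sqrt_pos.2 hZ
  have hp0 : 0 < p := inv_pos.2 hsZ
  have hp2 : p ^ 2 * Z = 1 := by rw [hp, inv_pow, Real.sq_sqrt hZ.le]; field_simp
  have ha : 0.94 ≤ p * B := by
    by_contra h
    push Not at h
    have h0 : 0 ≤ p * B := mul_nonneg hp0.le (hA0.trans hAB)
    have : (p * B) ^ 2 < 0.94 ^ 2 := by nlinarith
    have h3 : p ^ 2 * (0.8925 * Z) ≤ (p * B) ^ 2 := by rw [mul_pow]; exact mul_le_mul_of_nonneg_left hB2 (sq_nonneg _)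
    nlinarith
  have key : ∑ x ∈ S, w x * ((p ^ 2 - g x) * (u x - 1 + D / 2)) ≤
      ∑ x ∈ S, (D / 4) * (w x * (4 * (p - φ x) ^ 2 + (p + φ x) ^ 2 / 4)) := by
    refine Finset.sum_le_sum fun x hx => ?_
    have h1 : (p ^ 2 - g x) * (u x - 1 + D / 2) ≤ D / 4 * (4 * (p - φ x) ^ 2 + (p + φ x) ^ 2 / 4) := by
      have hs : |u x - 1 + D / 2| ≤ D / 2 := abs_le.2 ⟨by linarith [hu x hx], by linarith [hu1 x hx]⟩
      have h2 : |p ^ 2 - g x| ≤ (4 * (p - φ x) ^ 2 + (p + φ x) ^ 2 / 4) / 2 := by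
        rw [← hφ2 x hx]
        refine abs_le.2 ⟨by nlinarith [sq_nonneg (2 * (p - φ x) + (p + φ x) / 2)], by nlinarith [sq_nonneg (2 * (p - φ x) - (p + φ x) / 2)]⟩
      refine (le_abs_self _).trans ?_
      rw [abs_mul]
      refine (mul_le_mul h2 hs (abs_nonneg _) (by positivity)).trans (le_of_eq (by ring))
    have := mul_le_mul_of_nonneg_left h1 (hw x hx)
    linarith
  have e1 : ∑ x ∈ S, w x * ((p ^ 2 - g x) * (u x - 1 + D / 2)) = p ^ 2 * (∑ x ∈ S, w x * u x) - ∑ x ∈ S, w x * (g x * u x) := by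
    have : ∀ x, w x * ((p ^ 2 - g x) * (u x - 1 + D / 2)) =
        p ^ 2 * (w x * u x) - w x * (g x * u x) + (D / 2 - 1) * (p ^ 2 * w x - w x * g x) := fun x => by ring
    simp only [this, Finset.sum_sub_distrib, Finset.sum_add_distrib, ← Finset.mul_sum]
    rw [hZe, hg1, hp2]; ring
  have e2 : ∑ x ∈ S, (D / 4) * (w x * (4 * (p - φ x) ^ 2 + (p + φ x) ^ 2 / 4)) = D / 2 * (4 * (1 - p * B) + (1 + p * B) / 4) := by
    have : ∀ x ∈ S, (D / 4) * (w x * (4 * (p - φ x) ^ 2 + (p + φ x) ^ 2 / 4)) =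
        D / 4 * ((4 + 1 / 4) * (p ^ 2 * w x + w x * g x) - (8 - 1 / 2) * (p * (w x * φ x))) := fun x hx => by
      rw [← hφ2 x hx]; ring
    rw [Finset.sum_congr rfl this]
    simp only [Finset.sum_sub_distrib, Finset.sum_add_distrib, ← Finset.mul_sum]
    rw [hZe, hg1, hp2, ← hB]; ring
  rw [e1, e2] at key
  have e3 : p ^ 2 = 1 / Z := by field_simp; exact hp2
  rw [e3] at key
  have : D / 2 * (4 * (1 - p * B) + (1 + p * B) / 4) ≤ D / 2 * 1 := mul_le_mul_of_nonneg_left (by linarith) (by linarith)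
  rw [div_mul_eq_mul_div, one_mul] at key
  linarith

def tl (l : ℕ) (a b : ℤ) : Finset Site := rect (a + 1) (a + l) (b + 1) (b + l)
def inB (L l : ℕ) (a b : ℤ) : Prop := 1 ≤ l ∧ 0 ≤ a ∧ a + l ≤ L ∧ 0 ≤ b ∧ b + l ≤ L

lemma tile_tl {L l : ℕ} {a b : ℤ} (h : inB L l a b) : Tile L l (tl l a b) := tile_rect h.1 h.2.1 h.2.2.1 h.2.2.2.1 h.2.2.2.2

def e4 (Q : Finset Site) (k : ℕ) (η : Config) : ℝ := ∑ x ∈ Q, ((η x - k : ℤ) : ℝ) ^ 4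

lemma e4_nonneg (Q : Finset Site) (k : ℕ) (η : Config) : 0 ≤ e4 Q k η := Finset.sum_nonneg fun x _ => by positivity

lemma four_abs (x y : ℤ) : ((|x - y| : ℤ) : ℝ) ^ 4 ≤ 8 * ((x : ℝ) ^ 4 + (y : ℝ) ^ 4) := by
  push_cast
  rw [Even.pow_abs (by decide)]
  nlinarith [sq_nonneg ((x : ℝ) ^ 2 - y ^ 2), sq_nonneg ((x : ℝ) + y), sq_nonneg (((x : ℝ) + y) ^ 2), sq_nonneg ((x : ℝ) * (x + y)), sq_nonneg ((y : ℝ) * (x + y)),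
    sq_nonneg ((x : ℝ) ^ 2 + y ^ 2 - (x - y) ^ 2), sq_nonneg ((x : ℝ) ^ 2 + y ^ 2 + 2 * x * y)]

lemma mk_bound {α : Type*} (S : Finset α) {w e : α → ℝ} (hw : ∀ x ∈ S, 0 ≤ w x) (he : ∀ x, 0 ≤ e x) {M Z : ℝ} (hM : 0 < M)
    (h : ∑ x ∈ S, w x * e x ≤ M / 20 * Z) (hZ : ∑ x ∈ S, w x = Z) : 19 / 20 * Z ≤ ∑ x ∈ S.filter (fun x => e x ≤ M), w x := by
  have h1 := Finset.sum_filter_add_sum_filter_not S (fun x => e x ≤ M) w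
  have h2 : (∑ x ∈ S.filter (fun x => ¬ e x ≤ M), w x) * M ≤ ∑ x ∈ S, w x * e x := by
    rw [Finset.sum_mul]
    refine (Finset.sum_le_sum fun x hx => ?_).trans (Finset.sum_le_sum_of_subset_of_nonneg (Finset.filter_subset (fun x => ¬ e x ≤ M) S)
      fun x hx _ => mul_nonneg (hw x hx) (he x))
    rw [Finset.mem_filter] at hx
    exact mul_le_mul_of_nonneg_left (not_le.1 hx.2).le (hw x hx.1)
  have h3 : ∑ x ∈ S.filter (fun x => ¬ e x ≤ M), w x ≤ Z / 20 := by
    refine le_of_mul_le_mul_right (h2.trans (h.trans (le_of_eq ?_))) hM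
    ring
  linarith

lemma ord_tl {L l : ℕ} {a b : ℤ} (h : inB L l a b) {B : ℝ} (hB : 0 ≤ B) {k : ℕ} {η σ : Config} (h1 : e4 (tl l a b) k η ≤ B ^ 4 * l ^ 2)
    (h2 : e4 (tl l a b) k σ ≤ B ^ 4 * l ^ 2) : Ord L (tl l a b) (fun x => ((|η x - σ x| : ℤ) : ℝ)) (96 * B * l) := by
  have hs : √(l : ℝ) ^ 2 = l := Real.sq_sqrt (Nat.cast_nonneg _)
  have := ord_rect L (d := fun x => ((|η x - σ x| : ℤ) : ℝ)) (fun x => by positivity) (Θ := 2 * B * √l) (by positivity)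
    (l + l) l l le_rfl h.1 h.1 a b ?_
  · refine ord_mono (le_of_eq ?_) this
    linear_combination 96 * B * hs
  · have e : (2 * B * √(l : ℝ)) ^ 4 = 16 * (B ^ 4 * l ^ 2) := by
      calc _ = 16 * (B ^ 4 * (√(l : ℝ) ^ 2) ^ 2) := by ring
        _ = _ := by rw [hs]
    rw [e]
    calc _ ≤ ∑ x ∈ tl l a b, 8 * (((η x - k : ℤ) : ℝ) ^ 4 + ((σ x - k : ℤ) : ℝ) ^ 4) := by
          refine Finset.sum_le_sum fun x _ => ?_
          have := four_abs (η x - k) (σ x - k)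
          rwa [sub_sub_sub_cancel_right] at this
      _ = 8 * (e4 (tl l a b) k η + e4 (tl l a b) k σ) := by rw [← Finset.mul_sum, Finset.sum_add_distrib]; rfl
      _ ≤ _ := by linarith

lemma boost_one {β : ℝ} (hβ : 0 ≤ β) {L n l k : ℕ} {a b : ℤ} (hQ : inB L l a b) {B : ℝ} (hB : 0 < B) {T0 T : ℕ}
    (hπ : ∑ η ∈ St (tl l a b) 0 n, w β L η * e4 (tl l a b) k η ≤ B ^ 4 * l ^ 2 / 20 * sw β L (St (tl l a b) 0 n))
    (hν : ∀ t, T0 ≤ t → (Pk β L n (tl l a b))^[t] (e4 (tl l a b) k) 0 ≤ B ^ 4 * l ^ 2 / 20) (hT : 0 < T)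
    (hTb : 100 * (l : ℝ) ^ 4 * Real.exp (β * (96 * B * l)) * ((n + 1) * Real.exp (4 * β * n)) * (L ^ 4 * Real.log (n + 1)) ≤ T) :
    ∃ t, t < T0 + T ∧ ∀ u : Config → ℝ, Monotone u → (∀ η ∈ St (tl l a b) 0 (n : ℤ), u η ≤ 1) →
      1 - (Pk β L n (tl l a b))^[t] u 0 ≤
        (1 - (∑ η ∈ St (tl l a b) 0 n, w β L η * u η) / sw β L (St (tl l a b) 0 n)) + (1 - u 0) / 2 := by
  have hti := tile_tl hQ
  have hL : 0 < L := lt_of_lt_of_le hti.one hti.le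
  have hl : (0 : ℝ) < l := by exact_mod_cast hti.one
  set Q := tl l a b with hQd
  have hV := hti.cc.sub
  obtain ⟨t, ht0, ht1, htD⟩ := good_time β hβ (n := n) hL hV T0 hT
  refine ⟨t, ht1, fun u hu hu1 => ?_⟩
  set S := St Q 0 (n : ℤ) with hS
  set M := B ^ 4 * (l : ℝ) ^ 2 with hM
  have hM0 : 0 < M := by positivity
  set G := S.filter (fun η => e4 Q k η ≤ M) with hG
  set g := gam β L n Q t with hg
  have hZ : 0 < sw β L S := lt_of_lt_of_le one_pos (one_le_sw le_rfl (by positivity))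
  have hgn := gam_nonneg (n := n) β hV t
  have hR := canon hβ (L := L) (n := n) (Q := Q) (G := G) (κ := 96 * B * l) (Finset.filter_subset _ _)
    (fun η hη σ hσ => ord_tl hQ hB.le (Finset.mem_filter.1 hη).2 (Finset.mem_filter.1 hσ).2) (fun η => √(g η))
  have hR2 : ∑ p ∈ G ×ˢ G, w β L p.1 * w β L p.2 * (√(g p.1) - √(g p.2)) ^ 2 ≤ sw β L S / 50 := by
    refine hR.trans ?_
    rw [hti.card]
    set D := DE β L n Q (fun η => √(g η)) with hD
    have hT0 : (0 : ℝ) < T := by exact_mod_cast hT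
    refine le_of_mul_le_mul_right ?_ hT0
    set c := (l : ℝ) ^ 4 * Real.exp (β * (96 * B * l)) * ((n + 1) * Real.exp (4 * β * n)) with hc
    have hc0 : 0 ≤ c := by positivity
    calc _ = 2 * c * sw β L S * (T * D) := by rw [hc]; push_cast; ring
      _ ≤ 2 * c * sw β L S * (L ^ 4 * Real.log (n + 1)) :=
          mul_le_mul_of_nonneg_left htD (mul_nonneg (by linarith) hZ.le)
      _ = sw β L S / 50 * (100 * c * (L ^ 4 * Real.log (n + 1))) := by ring
      _ ≤ sw β L S / 50 * T := by
          refine mul_le_mul_of_nonneg_left ?_ (by linarith)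
          rw [hc]
          refine le_trans (le_of_eq ?_) hTb
          ring
  have h0 : 1 - u 0 ≥ 0 := by linarith [hu1 0 (zero_mem_St _ _)]
  have := aff_bound (S := S) (G := G) (w := w β L) (g := g) (u := u) (Finset.filter_subset _ _) (fun η _ => (w_pos _ _ _).le) hgn
    (gam_one β hL t) hZ rfl (mk_bound S (fun η _ => (w_pos _ _ _).le) (e4_nonneg Q k) hM0 hπ rfl) ?_ hR2 h0
    (fun η hη => by have := hu (zero_le_St hη); linarith) hu1
  · rw [gam_sum]
    linarith
  · have := mk_bound S (w := fun η => w β L η * g η) (e := e4 Q k) (fun η hη => mul_nonneg (w_pos _ _ _).le (hgn η hη)) (e4_nonneg Q k) hM0 (Z := 1) ?_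
      (gam_one β hL t)
    · linarith
    · have := hν t ht0
      rw [gam_sum] at this
      refine le_trans (le_of_eq ?_) (this.trans (le_of_eq (mul_one _).symm))
      exact Finset.sum_congr rfl fun η _ => by ring

lemma boost {β : ℝ} (hβ : 0 ≤ β) {L n l k : ℕ} {a b : ℤ} (hQ : inB L l a b) {B : ℝ} (hB : 0 < B) {T0 T : ℕ}
    (hπ : ∑ η ∈ St (tl l a b) 0 n, w β L η * e4 (tl l a b) k η ≤ B ^ 4 * l ^ 2 / 20 * sw β L (St (tl l a b) 0 n))
    (hν : ∀ t, T0 ≤ t → (Pk β L n (tl l a b))^[t] (e4 (tl l a b) k) 0 ≤ B ^ 4 * l ^ 2 / 20) (hT : 0 < T)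
    (hTb : 100 * (l : ℝ) ^ 4 * Real.exp (β * (96 * B * l)) * ((n + 1) * Real.exp (4 * β * n)) * (L ^ 4 * Real.log (n + 1)) ≤ T)
    {f : Config → ℝ} (hf : Monotone f) (hf0 : ∀ η, 0 ≤ f η) (hf1 : ∀ η, f η ≤ 1) (m : ℕ) : ∀ t, m * (T0 + T) ≤ t →
      1 - (Pk β L n (tl l a b))^[t] f 0 ≤
        2 * (1 - (∑ η ∈ St (tl l a b) 0 n, w β L η * f η) / sw β L (St (tl l a b) 0 n)) + (1 / 2) ^ m := by
  have hti := tile_tl hQ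
  have hL : 0 < L := lt_of_lt_of_le hti.one hti.le
  obtain ⟨t0, ht0, hs⟩ := boost_one hβ hQ hB hπ hν hT hTb
  set Q := tl l a b with hQd
  have hV := hti.cc.sub
  have hZ : 0 < sw β L (St Q 0 n) := lt_of_lt_of_le one_pos (one_le_sw le_rfl (by positivity))
  have hδ : (∑ η ∈ St Q 0 n, w β L η * f η) / sw β L (St Q 0 n) ≤ 1 := by
    rw [div_le_one hZ, sw]
    exact Finset.sum_le_sum fun η _ => mul_le_of_le_one_right (w_pos _ _ _).le (hf1 η)
  induction m with
  | zero =>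
    intro t _
    have := (Pk_mono (n := n) hβ hV hf hf0 t).2 0
    simp only [pow_zero]
    linarith
  | succ m ih =>
    intro t ht
    have h2 : t0 + (t - t0) = t := by
      have : T0 + T ≤ (m + 1) * (T0 + T) := Nat.le_mul_of_pos_left _ (by omega)
      omega
    have h3 : m * (T0 + T) ≤ t - t0 := by
      have : (m + 1) * (T0 + T) = m * (T0 + T) + (T0 + T) := by ring
      omega
    have h4 := ih _ h3
    have h5 := hs ((Pk β L n Q)^[t - t0] f) (Pk_mono hβ hV hf hf0 _).1 (fun η hη => by
      have := Pk_iter_le hV (β := β) (g := fun _ => 1) (fun η (_ : η ∈ St Q 0 (n : ℤ)) => hf1 η) (t - t0) η hη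
      rwa [Pk_iter_const β hL] at this)
    rw [Pk_iter_stat hL, ← Function.iterate_add_apply, h2] at h5
    rw [pow_succ]
    linarith

def flo (k : ℕ) (v : ℤ) : ℝ := (k : ℝ) ^ 4 - lo k (max v 0)
def Fl (Q : Finset Site) (k : ℕ) (η : Config) : ℝ := ∑ x ∈ Q, flo k (η x)
def Hi (Q : Finset Site) (k : ℕ) (η : Config) : ℝ := ∑ x ∈ Q, hi k (η x)

lemma lo_anti (k : ℕ) {u v : ℤ} (h : u ≤ v) : lo k v ≤ lo k u := by
  unfold lo
  refine pow_le_pow_left₀ (by exact_mod_cast le_max_right _ _) ?_ 4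
  exact_mod_cast max_le_max (by omega) le_rfl

lemma hi_mono (k : ℕ) {u v : ℤ} (h : u ≤ v) : hi k u ≤ hi k v := by
  unfold hi
  refine pow_le_pow_left₀ (by exact_mod_cast le_max_right _ _) ?_ 4
  exact_mod_cast max_le_max (by omega) le_rfl

lemma flo_mono (k : ℕ) {u v : ℤ} (h : u ≤ v) : flo k u ≤ flo k v :=
  sub_le_sub_left (lo_anti k (max_le_max h le_rfl)) _

lemma lo_zero (k : ℕ) : lo k 0 = (k : ℝ) ^ 4 := by simp [lo]
lemma lo_nonneg (k : ℕ) (v : ℤ) : 0 ≤ lo k v := by unfold lo; positivity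
lemma hi_nonneg (k : ℕ) (v : ℤ) : 0 ≤ hi k v := by unfold hi; positivity

lemma flo_nonneg (k : ℕ) (v : ℤ) : 0 ≤ flo k v := by
  have := lo_anti k (le_max_right v 0)
  rw [lo_zero] at this
  unfold flo
  linarith

lemma flo_le (k : ℕ) (v : ℤ) : flo k v ≤ (k : ℝ) ^ 4 := by
  have := lo_nonneg k (max v 0)
  unfold flo
  linarith

lemma lo_flo (k : ℕ) {v : ℤ} (h : 0 ≤ v) : lo k v = (k : ℝ) ^ 4 - flo k v := by
  unfold flo
  rw [max_eq_left h]; ring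

lemma four_eq (k : ℕ) (v : ℤ) : ((v - k : ℤ) : ℝ) ^ 4 = lo k v + hi k v := by
  unfold lo hi
  rcases le_total v k with h | h
  · rw [max_eq_left (by omega : (0 : ℤ) ≤ k - v), max_eq_right (by omega : v - (k : ℤ) ≤ 0)]
    push_cast; ring
  · rw [max_eq_right (by omega : (k : ℤ) - v ≤ 0), max_eq_left (by omega : (0 : ℤ) ≤ v - k)]
    push_cast; ring

lemma lo_succ (k : ℕ) (v : ℤ) : lo (k + 1) v ≤ 8 * lo k v + 8 := by
  unfold lo
  set y : ℤ := max (k - v) 0 with hy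
  have h1 : max (((k + 1 : ℕ) : ℤ) - v) 0 ≤ y + 1 := by push_cast; omega
  have h0 : (0 : ℝ) ≤ y := by exact_mod_cast le_max_right _ _
  have h2 : ((max (((k + 1 : ℕ) : ℤ) - v) 0 : ℤ) : ℝ) ≤ (y : ℝ) + 1 := by exact_mod_cast h1
  have h3 := pow_le_pow_left₀ (by exact_mod_cast le_max_right _ _) h2 4
  have : ((y : ℝ) + 1) ^ 4 ≤ 8 * (y : ℝ) ^ 4 + 8 := by
    nlinarith [sq_nonneg ((y : ℝ) ^ 2 - 1), sq_nonneg ((y : ℝ) - 1), mul_nonneg h0 (sq_nonneg ((y : ℝ) - 1)), sq_nonneg ((y : ℝ) * (y - 1))]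
  linarith

lemma Fl_mono (Q : Finset Site) (k : ℕ) : Monotone (Fl Q k) := fun _ _ h => Finset.sum_le_sum fun x _ => flo_mono k (h x)
lemma Fl_nonneg (Q : Finset Site) (k : ℕ) (η : Config) : 0 ≤ Fl Q k η := Finset.sum_nonneg fun x _ => flo_nonneg k _
lemma Fl_le (Q : Finset Site) (k : ℕ) (η : Config) : Fl Q k η ≤ Q.card * (k : ℝ) ^ 4 := by
  rw [← nsmul_eq_mul]; exact Finset.sum_le_card_nsmul _ _ _ fun x _ => flo_le k _
lemma Hi_mono (Q : Finset Site) (k : ℕ) : Monotone (Hi Q k) := fun _ _ h => Finset.sum_le_sum fun x _ => hi_mono k (h x)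
lemma Hi_nonneg (Q : Finset Site) (k : ℕ) (η : Config) : 0 ≤ Hi Q k η := Finset.sum_nonneg fun x _ => hi_nonneg k _

lemma sum_lo {Q : Finset Site} {n k : ℕ} {η : Config} (h : η ∈ St Q 0 (n : ℤ)) :
    ∑ x ∈ Q, lo k (η x) = Q.card * (k : ℝ) ^ 4 - Fl Q k η := by
  rw [Finset.sum_congr rfl fun x hx => lo_flo k ((mem_St.1 h).1 x hx).1, Finset.sum_sub_distrib, Finset.sum_const, nsmul_eq_mul]
  rfl

def Stg (β : ℝ) (L n k l T : ℕ) : Prop := ∀ a b : ℤ, inB L l a b → ∀ t, T ≤ t →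
  ((k : ℝ) ^ 4 - (64 * β + 3)) * l ^ 2 ≤ (Pk β L n (tl l a b))^[t] (Fl (tl l a b) k) 0

lemma quad {β : ℝ} (hβ : 0 ≤ β) {L n k l T : ℕ} (hl : 1 ≤ l) (h : Stg β L n k l T) : Stg β L n k (2 * l) T := by
  intro a b hB t ht
  have hti := (tile_tl hB).cc.sub
  obtain ⟨_, h1, h2, h3, h4⟩ := hB
  push_cast at h2 h4
  set Q := tl (2 * l) a b with hQ
  have hmem : ∀ (l : ℕ) (a b : ℤ) (x : Site), x ∈ tl l a b ↔ (a + 1 ≤ x.1 ∧ x.1 ≤ a + l) ∧ b + 1 ≤ x.2 ∧ x.2 ≤ b + l := fun l a b x => mem_rect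
  have hs : ∀ a' b', (a' = a ∨ a' = a + l) → (b' = b ∨ b' = b + l) → ((k : ℝ) ^ 4 - (64 * β + 3)) * l ^ 2 ≤ (Pk β L n Q)^[t] (Fl (tl l a' b') k) 0 := by
    intro a' b' ha hb
    refine (h a' b' ⟨hl, by omega, by omega, by omega, by omega⟩ t ht).trans
      (Pk_comp hβ le_rfl ?_ hti (Fl_mono _ _) (Fl_nonneg _ _) t 0 (zero_mem_St _ _))
    intro x hx
    rw [hmem] at hx
    rw [hQ, hmem]
    push_cast
    omega
  have e : Fl Q k = fun η => 1 * (fun η => 1 * Fl (tl l a b) k η + 1 * Fl (tl l (a + l) b) k η) η +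
      1 * (fun η => 1 * Fl (tl l a (b + l)) k η + 1 * Fl (tl l (a + l) (b + l)) k η) η := by
    funext η
    have hd : Q = (tl l a b ∪ tl l (a + l) b) ∪ (tl l a (b + l) ∪ tl l (a + l) (b + l)) := by
      ext x
      simp only [hQ, Finset.mem_union, hmem]
      push_cast
      omega
    have d1 : Disjoint (tl l a b) (tl l (a + l) b) := Finset.disjoint_left.2 fun x h1 h2 => by rw [hmem] at h1 h2; omega
    have d2 : Disjoint (tl l a (b + l)) (tl l (a + l) (b + l)) := Finset.disjoint_left.2 fun x h1 h2 => by rw [hmem] at h1 h2; omega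
    have d3 : Disjoint (tl l a b ∪ tl l (a + l) b) (tl l a (b + l) ∪ tl l (a + l) (b + l)) := Finset.disjoint_left.2 fun x h1 h2 => by
      simp only [Finset.mem_union, hmem] at h1 h2; omega
    simp only [one_mul]
    unfold Fl
    rw [hd, Finset.sum_union d3, Finset.sum_union d1, Finset.sum_union d2]
  rw [e, Pk_iter_add, Pk_iter_add, Pk_iter_add]
  have g1 := hs a b (Or.inl rfl) (Or.inl rfl)
  have g2 := hs (a + l) b (Or.inr rfl) (Or.inl rfl)
  have g3 := hs a (b + l) (Or.inl rfl) (Or.inr rfl)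
  have g4 := hs (a + l) (b + l) (Or.inr rfl) (Or.inr rfl)
  push_cast
  linarith

lemma quad_iter {β : ℝ} (hβ : 0 ≤ β) {L n k l T : ℕ} (hl : 1 ≤ l) (h : Stg β L n k l T) (i : ℕ) : Stg β L n k (2 ^ i * l) T := by
  induction i with
  | zero => simpa using h
  | succ i ih =>
    rw [pow_succ, mul_comm (2 ^ i) 2, mul_assoc]
    exact quad hβ (Nat.mul_pos (by positivity) hl) ih

lemma exp_half {β : ℝ} (hβ : 60 ≤ β) : 64 * Real.exp (-(4 * β)) ≤ 1 := by
  have h1 : (4 * β + 1) ≤ Real.exp (4 * β) := Real.add_one_le_exp _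
  rw [Real.exp_neg, ← div_eq_mul_inv, div_le_one (Real.exp_pos _)]
  linarith

lemma l_cond {β : ℝ} (hβ : 60 ≤ β) {k l j : ℕ} (hl : (l : ℝ) ≤ 2 * Real.exp (4 * β * k)) (hj : k + 1 ≤ j) :
    2 * Real.exp (-4 * β * (j : ℝ)) * l ≤ 1 := by
  have h1 : Real.exp (-4 * β * (j : ℝ)) ≤ Real.exp (-(4 * β)) * Real.exp (-(4 * β * k)) := by
    rw [← Real.exp_add]
    refine Real.exp_le_exp.2 ?_
    have : (k : ℝ) + 1 ≤ j := by exact_mod_cast hj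
    nlinarith
  have h2 := exp_half hβ
  have h3 : Real.exp (-(4 * β * k)) * Real.exp (4 * β * k) = 1 := by rw [← Real.exp_add]; simp
  have h0 := Real.exp_pos (-(4 * β))
  calc _ ≤ 2 * (Real.exp (-(4 * β)) * Real.exp (-(4 * β * k))) * (2 * Real.exp (4 * β * k)) := by
        refine mul_le_mul (by linarith) hl (Nat.cast_nonneg _) (by positivity)
    _ = 4 * Real.exp (-(4 * β)) := by linear_combination 4 * Real.exp (-(4 * β)) * h3
    _ ≤ 1 := by linarith

/-- moment bounds at level `k+1`. -/
lemma moments {β : ℝ} (hβ : 60 ≤ β) {L n k l T0 : ℕ} (hS : Stg β L n k l T0) (hl1 : Real.exp (4 * β * (k + 1 : ℕ)) ≤ l)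
    (hl2 : (l : ℝ) ≤ 2 * Real.exp (4 * β * (k + 1 : ℕ))) (hn : k + 1 ≤ n)
    (hp : ((k + 1 : ℕ) : ℝ) ^ 4 * pbad β (k + 1) l n (k + 1) ≤ 1) {a b : ℤ} (hQ : inB L l a b) :
    (∑ η ∈ St (tl l a b) 0 n, w β L η * (∑ x ∈ tl l a b, lo (k + 1) (η x)) ≤ (32 * β + 1) * l ^ 2 * sw β L (St (tl l a b) 0 n)) ∧
    (∑ η ∈ St (tl l a b) 0 n, w β L η * e4 (tl l a b) (k + 1) η ≤ (10 * β) ^ 4 * l ^ 2 / 20 * sw β L (St (tl l a b) 0 n)) ∧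
    (∀ t, T0 ≤ t → (Pk β L n (tl l a b))^[t] (e4 (tl l a b) (k + 1)) 0 ≤ (10 * β) ^ 4 * l ^ 2 / 20) := by
  have hti := tile_tl hQ
  have hL : 0 < L := lt_of_lt_of_le hti.one hti.le
  have hst := hS a b hQ
  set Q := tl l a b with hQd
  have hV := hti.cc.sub
  have hlo := lo_eq hβ hti (k := k + 1) (l_cond hβ hl2 le_rfl) hn hl1 hp
  have hhi := hi_eq hβ hti (k := k + 1) (l_cond hβ hl2 (by omega)) n
  have hZ : 0 < sw β L (St Q 0 n) := lt_of_lt_of_le one_pos (one_le_sw le_rfl (by positivity))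
  have hb3 : 60 ^ 3 ≤ β ^ 3 := pow_le_pow_left₀ (by norm_num) hβ 3
  have hb4 : 216000 * β ≤ β ^ 4 := by
    have := mul_le_mul_of_nonneg_right hb3 (by linarith : 0 ≤ β)
    calc _ = 60 ^ 3 * β := by norm_num
      _ ≤ _ := this
      _ = _ := by ring
  refine ⟨hlo, ?_, fun t ht => ?_⟩
  · have e : ∀ η, w β L η * e4 Q (k + 1) η = w β L η * (∑ x ∈ Q, lo (k + 1) (η x)) + w β L η * ∑ x ∈ Q, hi (k + 1) (η x) := fun η => by
      rw [← mul_add, ← Finset.sum_add_distrib]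
      simp only [e4, four_eq]
    simp only [e, Finset.sum_add_distrib]
    have : ((32 * β + 1) * (l : ℝ) ^ 2 + 2 * l ^ 2) * sw β L (St Q 0 n) ≤ (10 * β) ^ 4 * l ^ 2 / 20 * sw β L (St Q 0 n) := by
      refine mul_le_mul_of_nonneg_right ?_ hZ.le
      have : (32 * β + 3) * (l : ℝ) ^ 2 ≤ (500 * β ^ 4) * l ^ 2 := mul_le_mul_of_nonneg_right (by linarith) (sq_nonneg _)
      linarith
    linarith
  · have h1 : ∀ η ∈ St Q 0 (n : ℤ), e4 Q (k + 1) η ≤ (8 * l ^ 2 * (k : ℝ) ^ 4 + 8 * l ^ 2) * (fun _ => (1 : ℝ)) η +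
        1 * (fun η => (-8) * Fl Q k η + 1 * Hi Q (k + 1) η) η := by
      intro η hη
      have h2 := sum_lo (k := k) hη
      have h3 : ∑ x ∈ Q, lo (k + 1) (η x) ≤ ∑ x ∈ Q, (8 * lo k (η x) + 8) := Finset.sum_le_sum fun x _ => lo_succ k _
      rw [Finset.sum_add_distrib, ← Finset.mul_sum, h2, Finset.sum_const, nsmul_eq_mul, hti.card] at h3
      simp only [e4, four_eq, Finset.sum_add_distrib]
      have : Hi Q (k + 1) η = ∑ x ∈ Q, hi (k + 1) (η x) := rfl
      rw [this]
      push_cast at h3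
      linarith
    have h2 := Pk_iter_le (β := β) hV h1 t 0 (zero_mem_St _ _)
    rw [Pk_iter_add, Pk_iter_add, Pk_iter_const β hL] at h2
    have h3 := hst t ht
    have h4 := law_le_eq (by linarith) hL hV (Hi_mono Q (k + 1)) (Hi_nonneg Q (k + 1)) t (β := β) (n := n)
    have h5 : (Pk β L n Q)^[t] (Hi Q (k + 1)) 0 ≤ 2 * l ^ 2 := le_of_mul_le_mul_right (h4.trans hhi) hZ
    have : (8 * (64 * β + 3) + 10) * (l : ℝ) ^ 2 ≤ (500 * β ^ 4) * l ^ 2 := mul_le_mul_of_nonneg_right (by linarith) (sq_nonneg _)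
    simp only at h2
    linarith

lemma stage {β : ℝ} (hβ : 60 ≤ β) {L n k l T0 T : ℕ} (hS : Stg β L n k l T0) (hl1 : Real.exp (4 * β * (k + 1 : ℕ)) ≤ l)
    (hl2 : (l : ℝ) ≤ 2 * Real.exp (4 * β * (k + 1 : ℕ))) (hn : k + 1 ≤ n)
    (hp : ((k + 1 : ℕ) : ℝ) ^ 4 * pbad β (k + 1) l n (k + 1) ≤ 1) (hT : 0 < T)
    (hTb : 100 * (l : ℝ) ^ 4 * Real.exp (β * (96 * (10 * β) * l)) * ((n + 1) * Real.exp (4 * β * n)) * (L ^ 4 * Real.log (n + 1)) ≤ T)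
    (hk : ((k + 1 : ℕ) : ℝ) ^ 4 ≤ 2 ^ L) : Stg β L n (k + 1) l (L * (T0 + T)) := by
  intro a b hQ t ht
  obtain ⟨hlo, hπ, hν⟩ := moments hβ hS hl1 hl2 hn hp hQ
  have hti := tile_tl hQ
  have hl : (0 : ℝ) < l := by exact_mod_cast hti.one
  have hL : 0 < L := lt_of_lt_of_le hti.one hti.le
  set Q := tl l a b with hQd
  set M : ℝ := (l : ℝ) ^ 2 * ((k + 1 : ℕ) : ℝ) ^ 4 with hM
  have hM0 : 0 < M := by positivity
  have hZ : 0 < sw β L (St Q 0 n) := lt_of_lt_of_le one_pos (one_le_sw le_rfl (by positivity))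
  have hb := boost (by linarith : 0 ≤ β) hQ (by linarith : 0 < 10 * β) hπ hν hT hTb (f := fun η => M⁻¹ * Fl Q (k + 1) η + 0 * Fl Q (k + 1) η)
    (fun η σ h => by
      simp only [zero_mul, add_zero]
      exact mul_le_mul_of_nonneg_left (Fl_mono _ _ h) (inv_nonneg.2 hM0.le))
    (fun η => by simp only [zero_mul, add_zero]; exact mul_nonneg (inv_nonneg.2 hM0.le) (Fl_nonneg _ _ _))
    (fun η => by
      simp only [zero_mul, add_zero]
      rw [inv_mul_le_one₀ hM0]
      refine (Fl_le _ _ _).trans (le_of_eq ?_)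
      rw [hti.card, hM]; push_cast; rfl) L t ht
  rw [Pk_iter_add] at hb
  simp only [zero_mul, add_zero] at hb
  have e : ∑ η ∈ St Q 0 n, w β L η * (∑ x ∈ Q, lo (k + 1) (η x)) = M * sw β L (St Q 0 n) - ∑ η ∈ St Q 0 n, w β L η * Fl Q (k + 1) η := by
    rw [sw, Finset.mul_sum, ← Finset.sum_sub_distrib]
    refine Finset.sum_congr rfl fun η hη => ?_
    rw [sum_lo hη, hti.card, hM]; push_cast; ring
  have e2 : ∑ η ∈ St Q 0 n, w β L η * (M⁻¹ * Fl Q (k + 1) η) = M⁻¹ * ∑ η ∈ St Q 0 n, w β L η * Fl Q (k + 1) η := by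
    rw [Finset.mul_sum]; exact Finset.sum_congr rfl fun η _ => by ring
  rw [e] at hlo
  rw [← hQd, e2] at hb
  set X := ∑ η ∈ St Q 0 n, w β L η * Fl Q (k + 1) η
  set Z := sw β L (St Q 0 n)
  set Y := (Pk β L n Q)^[t] (Fl Q (k + 1)) 0
  have h1 : M - (32 * β + 1) * l ^ 2 ≤ X / Z := by rw [le_div_iff₀ hZ]; linarith
  have h2 : M * (1 - M⁻¹ * Y) ≤ M * (2 * (1 - M⁻¹ * X / Z) + (1 / 2) ^ L) := mul_le_mul_of_nonneg_left hb hM0.le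
  have e3 : M * (1 - M⁻¹ * Y) = M - Y := by field_simp
  have e4 : M * (2 * (1 - M⁻¹ * X / Z) + (1 / 2) ^ L) = 2 * M - 2 * (X / Z) + M * (1 / 2) ^ L := by field_simp
  have h3 : M * (1 / 2) ^ L ≤ l ^ 2 := by
    rw [hM, one_div, inv_pow, mul_assoc]
    refine mul_le_of_le_one_right (sq_nonneg _) ?_
    rw [← div_eq_mul_inv, div_le_one (by positivity)]
    exact hk
  rw [e3, e4] at h2
  have : ((k + 1 : ℕ) : ℝ) ^ 4 * l ^ 2 = M := by rw [hM]; ring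
  linarith

def pw (β : ℝ) (k : ℕ) : ℕ := ⌈4 * β * k / Real.log 2⌉₊
def ll (β : ℝ) (k : ℕ) : ℕ := 2 ^ pw β k

lemma ll_eq (β : ℝ) (k : ℕ) : (ll β k : ℝ) = Real.exp (pw β k * Real.log 2) := by
  rw [ll, Nat.cast_pow, Nat.cast_ofNat, mul_comm, Real.exp_mul, Real.exp_log (by norm_num), Real.rpow_natCast]

lemma ll_lb (β : ℝ) (k : ℕ) : Real.exp (4 * β * k) ≤ ll β k := by
  rw [ll_eq]
  have := Nat.le_ceil (4 * β * k / Real.log 2)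
  rw [div_le_iff₀ (Real.log_pos (by norm_num))] at this
  exact Real.exp_le_exp.2 this

lemma ll_ub {β : ℝ} (hβ : 0 ≤ β) (k : ℕ) : (ll β k : ℝ) ≤ 2 * Real.exp (4 * β * k) := by
  rw [ll_eq]
  have h2 : 0 < Real.log 2 := Real.log_pos (by norm_num)
  have := Nat.ceil_lt_add_one (a := 4 * β * k / Real.log 2) (by positivity)
  have h3 : (pw β k : ℝ) * Real.log 2 ≤ Real.log 2 + 4 * β * k := by
    have := mul_le_mul_of_nonneg_right this.le h2.le
    rw [add_mul, div_mul_cancel₀ _ h2.ne'] at this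
    unfold pw
    linarith
  calc _ ≤ Real.exp (Real.log 2 + 4 * β * k) := Real.exp_le_exp.2 h3
    _ = _ := by rw [Real.exp_add, Real.exp_log (by norm_num)]

lemma ll_pos (β : ℝ) (k : ℕ) : 1 ≤ ll β k := Nat.one_le_two_pow

lemma Stg_up {β : ℝ} (hβ : 0 ≤ β) {L n k T : ℕ} (h : Stg β L n k (ll β k) T) : Stg β L n k (ll β (k + 1)) T := by
  have hm : pw β k ≤ pw β (k + 1) := by
    refine Nat.ceil_mono (div_le_div_of_nonneg_right ?_ (Real.log_nonneg (by norm_num)))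
    push_cast; nlinarith
  have := quad_iter hβ (ll_pos β k) h (pw β (k + 1) - pw β k)
  rwa [ll, ← pow_add, Nat.sub_add_cancel hm] at this

lemma ladder {β : ℝ} (hβ : 60 ≤ β) {L n ks T : ℕ} (hL : 0 < L) (hn : ks ≤ n) (hp : ∀ k ≤ ks, (k : ℝ) ^ 4 * pbad β k (ll β k) n k ≤ 1) (hT : 0 < T)
    (hTb : ∀ k ≤ ks, 100 * (ll β k : ℝ) ^ 4 * Real.exp (β * (96 * (10 * β) * ll β k)) * ((n + 1) * Real.exp (4 * β * n)) * (L ^ 4 * Real.log (n + 1)) ≤ T)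
    (hk : ∀ k ≤ ks, (k : ℝ) ^ 4 ≤ 2 ^ L) : ∀ k ≤ ks, Stg β L n k (ll β k) ((2 * L) ^ k * T) := by
  intro k
  induction k with
  | zero =>
    intro _ a b hQ t _
    refine le_trans ?_ ((Pk_mono (by linarith) (tile_tl hQ).cc.sub (Fl_mono _ _) (Fl_nonneg _ _) t).2 0)
    have : 0 ≤ (64 * β + 3) * (ll β 0 : ℝ) ^ 2 := mul_nonneg (by linarith) (sq_nonneg _)
    push_cast
    linarith
  | succ k ih =>
    intro hks
    have h1 := stage hβ (Stg_up (by linarith) (ih (by omega))) (ll_lb β _) (ll_ub (by linarith) _) (by omega) (hp _ hks) hT (hTb _ hks) (hk _ hks)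
    intro a b hQ t ht
    refine h1 a b hQ t (le_trans ?_ ht)
    have : 1 ≤ (2 * L) ^ k := Nat.one_le_pow _ _ (by omega)
    calc L * ((2 * L) ^ k * T + T) ≤ L * ((2 * L) ^ k * T + (2 * L) ^ k * T) := by
          refine Nat.mul_le_mul_left _ (Nat.add_le_add_left ?_ _)
          exact Nat.le_mul_of_pos_left _ this
      _ = _ := by ring

def lowc (Q : Finset Site) (h : ℕ) (η : Config) : ℕ := (Q.filter (fun x => η x < (h : ℤ))).card
def ft (Q : Finset Site) (h l : ℕ) (η : Config) : ℝ := if (lowc Q h η : ℝ) ≤ 0.02 * (l : ℝ) ^ 2 then 1 else 0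

lemma lowc_anti (Q : Finset Site) (h : ℕ) {η σ : Config} (hs : η ≤ σ) : lowc Q h σ ≤ lowc Q h η :=
  Finset.card_le_card fun x hx => by
    rw [Finset.mem_filter] at hx ⊢
    exact ⟨hx.1, lt_of_le_of_lt (hs x) hx.2⟩

lemma ft_mono (Q : Finset Site) (h l : ℕ) : Monotone (ft Q h l) := fun η σ hs => by
  unfold ft
  have : (lowc Q h σ : ℝ) ≤ lowc Q h η := by exact_mod_cast lowc_anti Q h hs
  by_cases h1 : (lowc Q h η : ℝ) ≤ 0.02 * (l : ℝ) ^ 2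
  · rw [if_pos h1, if_pos (this.trans h1)]
  · rw [if_neg h1]; split_ifs <;> norm_num

lemma ft_nonneg (Q : Finset Site) (h l : ℕ) (η : Config) : 0 ≤ ft Q h l η := by unfold ft; split_ifs <;> norm_num
lemma ft_le (Q : Finset Site) (h l : ℕ) (η : Config) : ft Q h l η ≤ 1 := by unfold ft; split_ifs <;> norm_num

lemma exp_fifty {β : ℝ} (hβ : 60 ≤ β) : 1600 * β ≤ Real.exp (4 * β) := by
  have := Real.pow_div_factorial_le_exp (4 * β) (by linarith) 3
  have h2 : (Nat.factorial 3 : ℝ) = 6 := by norm_num [Nat.factorial]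
  rw [h2] at this
  nlinarith [mul_nonneg (by linarith : 0 ≤ β) (by nlinarith : 0 ≤ β ^ 2 - 3600)]

lemma ft_eq {β : ℝ} (hβ : 60 ≤ β) {L l h n j0 : ℕ} {Q : Finset Site} (hQ : Tile L l Q)
    (hl1 : Real.exp (4 * β * (h + 1 : ℕ)) ≤ l) (hl2 : 2 * Real.exp (-4 * β * ((j0 + 1 : ℕ) : ℝ)) * l ≤ 1) (hn : j0 ≤ n) :
    1 - (∑ η ∈ St Q 0 n, w β L η * ft Q h l η) / sw β L (St Q 0 n) ≤ pbad β h l n j0 := by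
  have hZ : 0 < sw β L (St Q 0 n) := lt_of_lt_of_le one_pos (one_le_sw le_rfl (by positivity))
  have h1 := low_eq hβ hQ hl2 hn h
  have h2 : sw β L (St Q 0 n) - ∑ η ∈ St Q 0 n, w β L η * ft Q h l η ≤ pbad β h l n j0 * sw β L (St Q 0 n) := by
    refine le_trans ?_ h1
    rw [sw_filter, sw, ← Finset.sum_sub_distrib]
    refine Finset.sum_le_sum fun η hη => ?_
    have hw := (w_pos β L η).le
    by_cases hb : ∃ j < h, yy β l j ≤ Nj Q j η
    · rw [if_pos hb]
      have := mul_nonneg hw (ft_nonneg Q h l η)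
      linarith
    · have h3 := cnt_low hβ hη hb
      have h4 : ft Q h l η = 1 := by
        refine if_pos (h3.trans ?_)
        have h5 : Real.exp (4 * β) * Real.exp (4 * β * h) ≤ l := by
          rw [← Real.exp_add]
          refine le_trans (le_of_eq ?_) hl1
          congr 1; push_cast; ring
        have h6 := mul_le_mul_of_nonneg_right (exp_fifty hβ) (Real.exp_nonneg (4 * β * h))
        have h7 : (0 : ℝ) ≤ l := Nat.cast_nonneg _
        have h8 := mul_le_mul_of_nonneg_left (h6.trans h5) h7
        nlinarith
      rw [if_neg hb, h4]; simp
  rw [one_sub_div hZ.ne', div_le_iff₀ hZ]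
  exact h2

lemma tile_fin {β : ℝ} (hβ : 60 ≤ β) {L n h T : ℕ} (hL : 0 < L) (hn : h + 1 ≤ n) (hp : ∀ k ≤ h + 1, (k : ℝ) ^ 4 * pbad β k (ll β k) n k ≤ 1) (hT : 0 < T)
    (hTb : ∀ k ≤ h + 1, 100 * (ll β k : ℝ) ^ 4 * Real.exp (β * (96 * (10 * β) * ll β k)) * ((n + 1) * Real.exp (4 * β * n)) * (L ^ 4 * Real.log (n + 1)) ≤ T)
    (hk : ∀ k ≤ h + 1, (k : ℝ) ^ 4 ≤ 2 ^ L) {a b : ℤ} (hQ : inB L (ll β (h + 1)) a b) {t : ℕ} (ht : (2 * L) ^ (h + 1) * T ≤ t) :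
    1 - (Pk β L n (tl (ll β (h + 1)) a b))^[t] (ft (tl (ll β (h + 1)) a b) h (ll β (h + 1))) 0 ≤
      2 * pbad β h (ll β (h + 1)) n (h + 1) + (1 / 2) ^ L := by
  have hS := Stg_up (by linarith) (ladder hβ hL hn hp hT hTb hk h (by omega))
  have hl2 := ll_ub (by linarith : 0 ≤ β) (h + 1)
  obtain ⟨-, hπ, hν⟩ := moments hβ hS (ll_lb β _) hl2 hn (hp _ le_rfl) hQ
  have hb := boost (by linarith : 0 ≤ β) hQ (by linarith : 0 < 10 * β) hπ hν hT (hTb _ le_rfl) (ft_mono (tl (ll β (h + 1)) a b) h (ll β (h + 1)))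
    (ft_nonneg _ _ _) (ft_le _ _ _) L t (le_trans ?_ ht)
  · have := ft_eq hβ (tile_tl hQ) (ll_lb β (h + 1)) (l_cond hβ hl2 le_rfl) hn
    linarith
  · have : 1 ≤ (2 * L) ^ h := Nat.one_le_pow _ _ (by omega)
    calc L * ((2 * L) ^ h * T + T) ≤ L * ((2 * L) ^ h * T + (2 * L) ^ h * T) := by
          refine Nat.mul_le_mul_left _ (Nat.add_le_add_left ?_ _)
          exact Nat.le_mul_of_pos_left _ this
      _ = _ := by ring

def Oh (L h : ℕ) (η : Config) : ℝ := if (9 / 10 : ℝ) * (L : ℝ) ^ 2 < (((box L).filter (fun x => (h : ℤ) ≤ η x)).card : ℝ) then 1 else 0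

lemma cov1 {L l : ℕ} (hl : 1 ≤ l) (hlL : l ≤ L) {x : ℤ} (h1 : 1 ≤ x) (h2 : x ≤ L) :
    ∃ i ∈ Finset.range (L / l + 1), (min ((i : ℤ) * l) (L - l)) + 1 ≤ x ∧ x ≤ (min ((i : ℤ) * l) (L - l)) + l := by
  have hl0 : (0 : ℤ) < l := by exact_mod_cast hl
  have hq0 : 0 ≤ (x - 1) / l := Int.ediv_nonneg (by omega) (by omega)
  have a1 := Int.ediv_mul_le (x - 1) hl0.ne'
  have a2 := Int.lt_ediv_add_one_mul_self (x - 1) hl0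
  have a3 : (x - 1) / l ≤ (L : ℤ) / l := Int.ediv_le_ediv hl0 (by omega)
  refine ⟨((x - 1) / l).toNat, ?_, ?_⟩
  · rw [Finset.mem_range]
    have : ((L / l : ℕ) : ℤ) = (L : ℤ) / l := by push_cast; rfl
    omega
  · rw [Int.toNat_of_nonneg hq0]
    rw [add_mul, one_mul] at a2
    set y := (x - 1) / (l : ℤ) * l
    omega

lemma tcover {L l h : ℕ} (hl : 1 ≤ l) (hlL : l ≤ L) (η : Config) :
    1 - Oh L h η ≤ ∑ p ∈ Finset.range (L / l + 1) ×ˢ Finset.range (L / l + 1),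
      (1 - ft (tl l (min ((p.1 : ℤ) * l) (L - l)) (min ((p.2 : ℤ) * l) (L - l))) h l η) := by
  set I := Finset.range (L / l + 1) ×ˢ Finset.range (L / l + 1) with hI
  set Q : ℕ × ℕ → Finset Site := fun p => tl l (min ((p.1 : ℤ) * l) (L - l)) (min ((p.2 : ℤ) * l) (L - l)) with hQ
  have hnn : ∀ p ∈ I, 0 ≤ 1 - ft (Q p) h l η := fun p _ => by linarith [ft_le (Q p) h l η]
  by_cases hO : Oh L h η = 1
  · rw [hO, sub_self]; exact Finset.sum_nonneg hnn
  have hO0 : Oh L h η = 0 := by unfold Oh at hO ⊢; split_ifs at hO ⊢ with h1 <;> simp_all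
  by_cases hbad : ∃ p ∈ I, ft (Q p) h l η = 0
  · obtain ⟨p, hp, hp0⟩ := hbad
    have := Finset.single_le_sum (f := fun p => 1 - ft (Q p) h l η) hnn hp
    simp only [hp0] at this
    linarith
  · exfalso
    push Not at hbad
    have hc : ∀ p ∈ I, (lowc (Q p) h η : ℝ) ≤ 0.02 * (l : ℝ) ^ 2 := fun p hp => by
      have := hbad p hp
      unfold ft at this
      by_contra hh
      exact this (if_neg hh)
    have hsub : (box L).filter (fun x => ¬ (h : ℤ) ≤ η x) ⊆ I.biUnion (fun p => (Q p).filter (fun x => η x < (h : ℤ))) := by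
      intro x hx
      rw [Finset.mem_filter, mem_box] at hx
      obtain ⟨i, hi, hi'⟩ := cov1 hl hlL (x := x.1) (by omega) (by omega)
      obtain ⟨j, hj, hj'⟩ := cov1 hl hlL (x := x.2) (by omega) (by omega)
      rw [Finset.mem_biUnion]
      refine ⟨(i, j), Finset.mem_product.2 ⟨hi, hj⟩, Finset.mem_filter.2 ⟨mem_rect.2 ⟨hi', hj'⟩, by omega⟩⟩
    have h1 : ((((box L).filter (fun x => ¬ (h : ℤ) ≤ η x)).card : ℕ) : ℝ) ≤ ∑ p ∈ I, (0.02 * (l : ℝ) ^ 2) := by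
      refine le_trans ?_ (Finset.sum_le_sum hc)
      exact_mod_cast (Finset.card_le_card hsub).trans Finset.card_biUnion_le
    have h2 : I.card = (L / l + 1) ^ 2 := by rw [hI, Finset.card_product, Finset.card_range]; ring
    have h3 : (L / l + 1) * l ≤ 2 * L := by
      have := Nat.div_mul_le_self L l
      rw [add_mul]; omega
    have h4 : ((L / l + 1 : ℕ) : ℝ) * l ≤ 2 * L := by exact_mod_cast h3
    have h5 : (((L / l + 1 : ℕ) : ℝ) * l) ^ 2 ≤ (2 * L) ^ 2 := pow_le_pow_left₀ (mul_nonneg (Nat.cast_nonneg _) (Nat.cast_nonneg _)) h4 2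
    rw [Finset.sum_const, nsmul_eq_mul, h2, Nat.cast_pow] at h1
    have h6 : ((box L).filter (fun x => (h : ℤ) ≤ η x)).card + ((box L).filter (fun x => ¬ (h : ℤ) ≤ η x)).card = L ^ 2 := by
      rw [Finset.card_filter_add_card_filter_not, card_box]
    have h7 : (((box L).filter (fun x => (h : ℤ) ≤ η x)).card : ℝ) + (((box L).filter (fun x => ¬ (h : ℤ) ≤ η x)).card : ℝ) = (L : ℝ) ^ 2 := by
      exact_mod_cast h6
    refine hO (if_pos ?_)
    have : (0 : ℝ) < (L : ℝ) ^ 2 := by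
      have : (0 : ℝ) < L := by exact_mod_cast (by omega : 0 < L)
      positivity
    nlinarith

lemma pbad_nonneg (β : ℝ) (k l n j0 : ℕ) : 0 ≤ pbad β k l n j0 :=
  add_nonneg (mul_nonneg (Nat.cast_nonneg _) (Real.exp_nonneg _)) (mul_nonneg (sq_nonneg _) (pow_nonneg (Real.exp_nonneg _) _))

lemma hit_big {β : ℝ} (hβ : 60 ≤ β) {L n n' h T : ℕ} (hL : 0 < L) (hn' : n ≤ n') (hlL : ll β (h + 1) ≤ L) (hn : h + 1 ≤ n)
    (hp : ∀ k ≤ h + 1, (k : ℝ) ^ 4 * pbad β k (ll β k) n k ≤ 1) (hT : 0 < T)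
    (hTb : ∀ k ≤ h + 1, 100 * (ll β k : ℝ) ^ 4 * Real.exp (β * (96 * (10 * β) * ll β k)) * ((n + 1) * Real.exp (4 * β * n)) * (L ^ 4 * Real.log (n + 1)) ≤ T)
    (hk : ∀ k ≤ h + 1, (k : ℝ) ^ 4 ≤ 2 ^ L) {t : ℕ} (ht : (2 * L) ^ (h + 1) * T ≤ t) :
    1 - (Pk β L n' (box L))^[t] (Oh L h) 0 ≤ (2 * L) ^ 2 * (2 * pbad β h (ll β (h + 1)) n (h + 1) + (1 / 2) ^ L) := by
  set l := ll β (h + 1) with hl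
  have hl1 : 1 ≤ l := ll_pos _ _
  set I := Finset.range (L / l + 1) ×ˢ Finset.range (L / l + 1) with hI
  set Q : ℕ × ℕ → Finset Site := fun p => tl l (min ((p.1 : ℤ) * l) (L - l)) (min ((p.2 : ℤ) * l) (L - l)) with hQ
  set S := St (box L) 0 (n' : ℤ)
  have hgn := gam_nonneg (n := n') β (Finset.Subset.refl (box L)) t
  have hg1 := gam_one (n := n') β hL (V := box L) t
  have e : ∀ f : Config → ℝ, 1 - (Pk β L n' (box L))^[t] f 0 = ∑ η ∈ S, w β L η * gam β L n' (box L) t η * (1 - f η) := fun f => by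
    have e1 : ∀ η ∈ S, w β L η * gam β L n' (box L) t η * (1 - f η) = w β L η * gam β L n' (box L) t η - w β L η * (gam β L n' (box L) t η * f η) :=
      fun η _ => by ring
    rw [gam_sum, Finset.sum_congr rfl e1, Finset.sum_sub_distrib, hg1]
  have h1 : 1 - (Pk β L n' (box L))^[t] (Oh L h) 0 ≤ ∑ p ∈ I, (1 - (Pk β L n' (box L))^[t] (ft (Q p) h l) 0) := by
    simp only [e]
    rw [Finset.sum_comm]
    refine Finset.sum_le_sum fun η hη => ?_
    rw [← Finset.mul_sum]
    exact mul_le_mul_of_nonneg_left (tcover hl1 hlL η) (mul_nonneg (w_pos _ _ _).le (hgn η hη))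
  set δ := 2 * pbad β h l n (h + 1) + (1 / 2) ^ L with hδ
  have hδ0 : 0 ≤ δ := add_nonneg (mul_nonneg zero_le_two (pbad_nonneg _ _ _ _ _)) (pow_nonneg (by norm_num) _)
  have h2 : ∑ p ∈ I, (1 - (Pk β L n' (box L))^[t] (ft (Q p) h l) 0) ≤ ∑ p ∈ I, δ := by
    refine Finset.sum_le_sum fun p _ => ?_
    have hin : inB L l (min ((p.1 : ℤ) * l) (L - l)) (min ((p.2 : ℤ) * l) (L - l)) := by
      have a1 : (0 : ℤ) ≤ (p.1 : ℤ) * l := by positivity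
      have a2 : (0 : ℤ) ≤ (p.2 : ℤ) * l := by positivity
      refine ⟨hl1, by omega, by omega, by omega, by omega⟩
    have h3 := tile_fin hβ hL hn hp hT hTb hk hin ht
    have h4 := Pk_comp (β := β) (by linarith) hn' (tile_tl hin).cc.sub (Finset.Subset.refl _) (ft_mono (Q p) h l) (ft_nonneg _ _ _) t 0 (zero_mem_St _ _)
    linarith
  refine h1.trans (h2.trans ?_)
  rw [Finset.sum_const, nsmul_eq_mul]
  refine mul_le_mul_of_nonneg_right ?_ hδ0
  have h5 : I.card = (L / l + 1) ^ 2 := by rw [hI, Finset.card_product, Finset.card_range]; ring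
  have h6 : L / l + 1 ≤ 2 * L := by
    have := Nat.div_le_self L l
    omega
  rw [h5]
  exact_mod_cast Nat.pow_le_pow_left h6 2


end

def pb (x : Site) (b : Bool) : Site := if b then (x.1, x.2 - 1) else (x.1 - 1, x.2)

lemma nb_pb (x : Site) (b : Bool) : nb (pb x b) b = x := by cases b <;> simp [nb, pb]
lemma pb_nb (x : Site) (b : Bool) : pb (nb x b) b = x := by cases b <;> simp [nb, pb]

lemma sum_nbrs (x : Site) (F : Site → ℝ) : ∑ y ∈ nbrs x, F y = ∑ b : Bool, (F (nb x b) + F (pb x b)) := by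
  rw [nbrs, Finset.sum_insert (by simp [Prod.ext_iff]; omega), Finset.sum_insert (by simp [Prod.ext_iff]),
    Finset.sum_insert (by simp [Prod.ext_iff]; omega), Finset.sum_singleton]
  simp [nb, pb]
  ring

lemma sosH_en {L : ℕ} {η : Config} (h : ∀ x ∉ box L, η x = 0) : sosH (box L) 0 η = (en L η : ℝ) := by
  set Λ := box L with hΛ
  set φ : Site → Site → ℝ := fun x y => if x ∈ Λ then (if y ∈ Λ then 1 / 2 else 1) * ((|η x - η y| : ℤ) : ℝ) else 0 with hφ
  have hs : ∀ x y, φ x y + φ y x = ((|η x - η y| : ℤ) : ℝ) := by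
    intro x y
    have hc : |η y - η x| = |η x - η y| := abs_sub_comm _ _
    simp only [hφ, hc]
    by_cases hx : x ∈ Λ <;> by_cases hy : y ∈ Λ
    · rw [if_pos hx, if_pos hy, if_pos hy, if_pos hx]; ring
    · rw [if_pos hx, if_neg hy, if_neg hy]; ring
    · rw [if_neg hx, if_pos hy, if_neg hx]; ring
    · rw [if_neg hx, if_neg hy, h x hx, h y hy]; simp
  have h1 : sosH Λ 0 η = ∑ x ∈ Λ, ∑ y ∈ nbrs x, φ x y := by
    unfold sosH
    rw [Finset.mul_sum, ← Finset.sum_add_distrib]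
    refine Finset.sum_congr rfl fun x hx => ?_
    rw [← Finset.sum_filter_add_sum_filter_not (nbrs x) (fun y => y ∈ Λ) (φ x), Finset.mul_sum]
    refine congrArg₂ (· + ·) ?_ ?_
    · refine Finset.sum_congr rfl fun y hy => ?_
      simp only [hφ, if_pos hx, if_pos (Finset.mem_filter.1 hy).2]
    · refine Finset.sum_congr rfl fun y hy => ?_
      have hy' := (Finset.mem_filter.1 hy).2
      simp only [hφ, if_pos hx, if_neg hy', h y hy', one_mul, Pi.zero_apply]
  set I := Finset.Icc ((0 : ℤ), (0 : ℤ)) ((L : ℤ), (L : ℤ)) with hI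
  have h2 : (en L η : ℝ) = ∑ b : Bool, (∑ x ∈ I, φ x (nb x b) + ∑ x ∈ I, φ (nb x b) x) := by
    unfold en eds
    rw [Finset.sum_product_right]
    push_cast
    refine Finset.sum_congr rfl fun b _ => ?_
    rw [← Finset.sum_add_distrib]
    refine Finset.sum_congr rfl fun x _ => ?_
    rw [hs]; push_cast; rfl
  have hsub : ∀ x ∈ Λ, ∀ b, x ∈ I ∧ pb x b ∈ I := by
    intro x hx b
    rw [hΛ, mem_box] at hx
    simp only [hI, Finset.mem_Icc, Prod.le_def]
    cases b <;> simp [pb] <;> omega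
  rw [h1, h2]
  simp only [sum_nbrs]
  rw [Finset.sum_comm]
  refine Finset.sum_congr rfl fun b _ => ?_
  rw [Finset.sum_add_distrib]
  refine congrArg₂ (· + ·) ?_ ?_
  · refine Finset.sum_subset (fun x hx => (hsub x hx b).1) fun x _ hx => ?_
    simp only [hφ, if_neg hx]
  · have h3 : ∑ x ∈ I.filter (fun x => nb x b ∈ Λ), φ (nb x b) x = ∑ x ∈ I, φ (nb x b) x := by
      refine Finset.sum_subset (Finset.filter_subset _ _) fun x hx hx' => ?_
      rw [Finset.mem_filter, not_and] at hx'
      simp only [hφ, if_neg (hx' hx)]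
    rw [← h3]
    refine Finset.sum_nbij' (fun x => pb x b) (fun x => nb x b) ?_ ?_ ?_ ?_ ?_
    · intro x hx
      exact Finset.mem_filter.2 ⟨(hsub x hx b).2, by rw [nb_pb]; exact hx⟩
    · intro x hx
      exact (Finset.mem_filter.1 hx).2
    · intro x _; exact nb_pb x b
    · intro x _; exact pb_nb x b
    · intro x _; simp only [nb_pb]

def KI (n : ℕ) : Set ℤ := Set.Icc 0 (n : ℤ)
def gw (β : ℝ) (L n : ℕ) (η : Config) : ℝ := gWeight β (box L) 0 (KI n) (fun _ => 0) η

lemma gw_eq {β : ℝ} {L n : ℕ} {η : Config} (h : ∀ x ∉ box L, η x = 0) : gw β L n η = if η ∈ St (box L) 0 (n : ℤ) then w β L η else 0 := by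
  unfold gw gWeight
  by_cases h1 : ∀ x ∈ box L, η x ∈ KI n
  · rw [if_pos h1, if_pos (mem_St.2 ⟨fun x hx => ⟨(h1 x hx).1, (h1 x hx).2⟩, h⟩), sosH_en h, w, add_zero]
  · rw [if_neg h1, if_neg]
    intro h2
    exact h1 fun x hx => (mem_St.1 h2).1 x hx

lemma tsum_ext {L n : ℕ} (F : Config → ℝ) (hF : ∀ η, (∀ x ∉ box L, η x = 0) → η ∉ St (box L) 0 (n : ℤ) → F η = 0) :
    ∑' g : {x // x ∈ box L} → ℤ, F (extendC (box L) 0 g) = ∑ η ∈ St (box L) 0 (n : ℤ), F η := by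
  have hinj : Function.Injective (extendC (box L) 0) := fun g g' hg => by
    funext x
    have := congrFun hg x.1
    simpa [extendC, x.2] using this
  have hz : ∀ g : {x // x ∈ box L} → ℤ, ∀ x ∉ box L, extendC (box L) 0 g x = 0 := fun g x hx => by simp [extendC, hx]
  rw [tsum_eq_sum (s := Fintype.piFinset (fun _ : {x // x ∈ box L} => Finset.Icc (0 : ℤ) n))]
  · exact (Finset.sum_image (f := F) (fun _ _ _ _ h => hinj h)).symm
  · intro g hg
    refine hF _ (hz g) fun hS => hg ?_
    rw [Fintype.mem_piFinset]
    intro x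
    have := (mem_St.1 hS).1 x.1 x.2
    simp only [extendC, dif_pos x.2] at this
    exact Finset.mem_Icc.2 this

lemma gProb_eq {β : ℝ} {L n : ℕ} (A : Set Config) :
    gProb β (box L) 0 (Set.Icc 0 (n : ℤ)) (fun _ => 0) A =
      (∑ η ∈ St (box L) 0 (n : ℤ), w β L η * (if η ∈ A then 1 else 0)) / sw β L (St (box L) 0 n) := by
  have h0 : ∀ η ∈ St (box L) 0 (n : ℤ), gw β L n η = w β L η := fun η hη => by
    rw [gw_eq (mem_St.1 hη).2, if_pos hη]
  have h00 : ∀ η, (∀ x ∉ box L, η x = 0) → η ∉ St (box L) 0 (n : ℤ) → gw β L n η = 0 := fun η h1 h2 => by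
    rw [gw_eq h1, if_neg h2]
  unfold gProb
  refine congrArg₂ (· / ·) ?_ ?_
  · refine (tsum_ext (n := n) (Set.indicator A (gw β L n)) fun η h1 h2 => ?_).trans ?_
    · by_cases h : η ∈ A
      · rw [Set.indicator_of_mem h, h00 η h1 h2]
      · exact Set.indicator_of_notMem h _
    · refine Finset.sum_congr rfl fun η hη => ?_
      by_cases h : η ∈ A
      · rw [Set.indicator_of_mem h, h0 η hη, if_pos h, mul_one]
      · rw [Set.indicator_of_notMem h, if_neg h, mul_zero]
  · exact (tsum_ext (n := n) (gw β L n) h00).trans (Finset.sum_congr rfl h0)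

def gl (β : ℝ) (L n : ℕ) : Config → Config → ℝ := glauber β (box L) 0 (Set.Icc 0 (n : ℤ)) (fun _ => 0)

lemma up_gw {β : ℝ} {L n : ℕ} {η : Config} (hη : η ∈ St (box L) 0 (n : ℤ)) {x : Site} (hx : x ∈ box L) (v : ℤ) :
    gw β L n (up η x v) = if v ∈ Finset.Icc (0 : ℤ) n then w β L (up η x v) else 0 := by
  have h1 : ∀ y ∉ box L, up η x v y = 0 := fun y hy => by
    have hne : y ≠ x := fun h => hy (by rw [h]; exact hx)
    rw [up_ne _ _ hne]; exact (mem_St.1 hη).2 y hy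
  rw [gw_eq h1]
  suffices hh : up η x v ∈ St (box L) 0 (n : ℤ) ↔ v ∈ Finset.Icc (0 : ℤ) n by simp only [hh]
  rw [mem_St, Finset.mem_Icc]
  constructor
  · intro h; have := h.1 x hx; rwa [up_at] at this
  · intro h
    refine ⟨fun y hy => ?_, h1⟩
    by_cases hxy : y = x
    · subst hxy; rw [up_at]; exact h
    · rw [up_ne _ _ hxy]; exact (mem_St.1 hη).1 y hy

lemma hb_eq {β : ℝ} {L n : ℕ} {η : Config} (hη : η ∈ St (box L) 0 (n : ℤ)) {x : Site} (hx : x ∈ box L) (v : ℤ) :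
    heatBath β (box L) 0 (Set.Icc 0 (n : ℤ)) (fun _ => 0) η x v = (if v ∈ Finset.Icc (0 : ℤ) n then w β L (up η x v) else 0) / zx β L n x η := by
  rw [← up_gw hη hx]
  change gw β L n (up η x v) / (∑' u : ℤ, gw β L n (up η x u)) = _
  refine congrArg (fun z => gw β L n (up η x v) / z) ?_
  rw [tsum_eq_sum (s := Finset.Icc (0 : ℤ) n) fun u hu => by rw [up_gw hη hx, if_neg hu]]
  exact Finset.sum_congr rfl fun u hu => by rw [up_gw hη hx, if_pos hu]

lemma zx_nonneg (β : ℝ) (L n : ℕ) (x : Site) (η : Config) : 0 ≤ zx β L n x η := Finset.sum_nonneg fun _ _ => (w_pos _ _ _).le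

lemma gl_nonneg {β : ℝ} {L n : ℕ} {η : Config} (hη : η ∈ St (box L) 0 (n : ℤ)) (σ : Config) : 0 ≤ gl β L n η σ := by
  unfold gl glauber
  refine mul_nonneg (inv_nonneg.2 (Nat.cast_nonneg _)) (Finset.sum_nonneg fun x hx => ?_)
  rw [hb_eq hη hx]
  split_ifs
  · exact div_nonneg (w_pos _ _ _).le (zx_nonneg _ _ _ _ _)
  · rw [zero_div]
  · exact le_rfl

lemma gl_supp {β : ℝ} {L n : ℕ} {η σ : Config} (hη : η ∈ St (box L) 0 (n : ℤ)) (h : gl β L n η σ ≠ 0) : σ ∈ St (box L) 0 (n : ℤ) := by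
  by_contra hσ
  refine h ?_
  unfold gl glauber
  rw [Finset.sum_eq_zero, mul_zero]
  intro x hx
  by_cases h1 : σ = Function.update η x (σ x)
  · rw [if_pos h1, hb_eq hη hx]
    by_cases h2 : σ x ∈ Finset.Icc (0 : ℤ) n
    · exfalso
      apply hσ
      rw [h1]
      exact up_mem hη hx (Finset.mem_Icc.1 h2).1 (Finset.mem_Icc.1 h2).2
    · rw [if_neg h2, zero_div]
  · rw [if_neg h1]

lemma sum_swap {α ι : Type*} (S : Finset α) (V : Finset ι) (c : ℝ) (H : ι → α → ℝ) (f : α → ℝ) :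
    ∑ σ ∈ S, (c * ∑ x ∈ V, H x σ) * f σ = c * ∑ x ∈ V, ∑ σ ∈ S, H x σ * f σ := by
  rw [Finset.sum_comm, Finset.mul_sum]
  refine Finset.sum_congr rfl fun σ _ => ?_
  rw [← Finset.sum_mul, mul_assoc]

lemma gl_sum {β : ℝ} {L n : ℕ} {η : Config} (hη : η ∈ St (box L) 0 (n : ℤ)) (f : Config → ℝ) :
    ∑ σ ∈ St (box L) 0 (n : ℤ), gl β L n η σ * f σ = Pk β L n (box L) f η := by
  have hc : ((box L).card : ℝ) = (L : ℝ) ^ 2 := by rw [card_box]; push_cast; rfl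
  refine (sum_swap _ _ _ (fun x σ => if σ = Function.update η x (σ x) then
      heatBath β (box L) 0 (Set.Icc 0 (n : ℤ)) (fun _ => 0) η x (σ x) else 0) f).trans ?_
  rw [Pk, hc, sub_self, zero_mul, zero_add]
  refine congrArg (fun z => ((L : ℝ) ^ 2)⁻¹ * z) (Finset.sum_congr rfl fun x hx => ?_)
  rw [Tx, Finset.sum_div]
  have e1 : ∀ σ ∈ St (box L) 0 (n : ℤ), (if σ = Function.update η x (σ x) then
      heatBath β (box L) 0 (Set.Icc 0 (n : ℤ)) (fun _ => 0) η x (σ x) else 0) * f σ =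
      if σ = Function.update η x (σ x) then w β L σ * f σ / zx β L n x η else 0 := by
    intro σ hσ
    by_cases h1 : σ = Function.update η x (σ x)
    · rw [if_pos h1, if_pos h1, hb_eq hη hx, if_pos (Finset.mem_Icc.2 ((mem_St.1 hσ).1 x hx))]
      have : up η x (σ x) = σ := h1.symm
      rw [this]; ring
    · rw [if_neg h1, if_neg h1, zero_mul]
  rw [Finset.sum_congr rfl e1, ← Finset.sum_filter]
  refine Finset.sum_nbij' (fun σ => σ x) (fun v => up η x v) ?_ ?_ ?_ ?_ ?_
  · intro σ hσ
    exact Finset.mem_Icc.2 ((mem_St.1 (Finset.mem_filter.1 hσ).1).1 x hx)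
  · intro v hv
    refine Finset.mem_filter.2 ⟨up_mem hη hx (Finset.mem_Icc.1 hv).1 (Finset.mem_Icc.1 hv).2, ?_⟩
    rw [up_at]; rfl
  · intro σ hσ
    exact (Finset.mem_filter.1 hσ).2.symm
  · intro v _; exact up_at _ _ _
  · intro σ hσ
    have : up η x (σ x) = σ := (Finset.mem_filter.1 hσ).2.symm
    simp only [this]

section
attribute [local irreducible] w St

def tr {α : Type*} {N : ℕ} (x0 : α) (f : Fin N → α) : ℕ → α
  | 0 => x0
  | (t + 1) => if h : t < N then f ⟨t, h⟩ else x0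

lemma tr_cons {α : Type*} {N : ℕ} (x0 y : α) (f : Fin N → α) {t : ℕ} (ht : t ≤ N) :
    tr x0 (Fin.cons y f : Fin (N + 1) → α) (t + 1) = tr y f t := by
  cases t with
  | zero => simp [tr]
  | succ t =>
    have h1 : t < N := by omega
    simp only [tr, dif_pos h1, dif_pos (by omega : t + 1 < N + 1)]
    exact Fin.cons_succ (α := fun _ => α) y f ⟨t, h1⟩

def opP {α : Type*} [Fintype α] (p : α → α → ℝ) (g : α → ℝ) (x : α) : ℝ := ∑ y, p x y * g y

lemma path_sum {α : Type*} [Fintype α] (p : α → α → ℝ) (hp : ∀ x, ∑ y, p x y = 1) (N : ℕ) : ∀ (x0 : α) (t : ℕ), t ≤ N → ∀ g : α → ℝ,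
    ∑ f : Fin N → α, (∏ i ∈ Finset.range N, p (tr x0 f i) (tr x0 f (i + 1))) * g (tr x0 f t) = (opP p)^[t] g x0 := by
  induction N with
  | zero =>
    intro x0 t ht g
    obtain rfl : t = 0 := by omega
    simp [tr]
  | succ N ih =>
    intro x0 t ht g
    have e : ∀ G : (Fin (N + 1) → α) → ℝ, ∑ f, G f = ∑ y, ∑ f : Fin N → α, G (Fin.cons y f) := fun G => by
      rw [← Fintype.sum_prod_type', ← Equiv.sum_comp (Fin.consEquiv (fun _ => α))]
      rfl
    have e2 : ∀ y (f : Fin N → α), ∏ i ∈ Finset.range (N + 1), p (tr x0 (Fin.cons y f : Fin (N + 1) → α) i) (tr x0 (Fin.cons y f : Fin (N + 1) → α) (i + 1)) =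
        (∏ i ∈ Finset.range N, p (tr y f i) (tr y f (i + 1))) * p x0 y := fun y f => by
      rw [Finset.prod_range_succ']
      refine congrArg₂ (· * ·) (Finset.prod_congr rfl fun i hi => ?_) ?_
      · rw [Finset.mem_range] at hi
        rw [tr_cons _ _ _ (by omega), tr_cons _ _ _ (by omega)]
      · rw [tr_cons _ _ _ (by omega)]; rfl
    rw [e]
    simp only [e2]
    cases t with
    | zero =>
      have h1 : ∀ y, ∑ f : Fin N → α, ∏ i ∈ Finset.range N, p (tr y f i) (tr y f (i + 1)) = 1 := fun y => by
        have := ih y 0 (by omega) (fun _ => 1)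
        simpa using this
      have h2 : ∀ y, ∑ f : Fin N → α, (∏ i ∈ Finset.range N, p (tr y f i) (tr y f (i + 1))) * p x0 y * g (tr x0 (Fin.cons y f : Fin (N + 1) → α) 0) = p x0 y * g x0 := fun y => by
        change ∑ f : Fin N → α, (∏ i ∈ Finset.range N, p (tr y f i) (tr y f (i + 1))) * p x0 y * g x0 = _
        rw [← Finset.sum_mul, ← Finset.sum_mul, h1, one_mul]
      rw [Finset.sum_congr rfl fun y _ => h2 y, ← Finset.sum_mul, hp, one_mul]; rfl
    | succ t =>
      rw [Function.iterate_succ_apply']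
      refine Finset.sum_congr rfl fun y _ => ?_
      rw [← ih y t (by omega) g, Finset.mul_sum]
      refine Finset.sum_congr rfl fun f _ => ?_
      rw [tr_cons _ _ _ (by omega)]; ring

/-- restriction of the chain to the finite state space -/
def pS (β : ℝ) (L n : ℕ) (x y : {η // η ∈ St (box L) 0 (n : ℤ)}) : ℝ := gl β L n x.1 y.1

lemma opP_eq {β : ℝ} {L n : ℕ} (g : Config → ℝ) (t : ℕ) (x : {η // η ∈ St (box L) 0 (n : ℤ)}) :
    (opP (pS β L n))^[t] (fun y => g y.1) x = (Pk β L n (box L))^[t] g x.1 := by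
  induction t generalizing x with
  | zero => rfl
  | succ t ih =>
    rw [Function.iterate_succ_apply', Function.iterate_succ_apply', ← gl_sum x.2, opP]
    simp only [ih]
    exact (Finset.sum_coe_sort (St (box L) 0 (n : ℤ)) (fun σ => gl β L n x.1 σ * (Pk β L n (box L))^[t] g σ))

lemma pS_one {β : ℝ} {L n : ℕ} (hL : 0 < L) (x : {η // η ∈ St (box L) 0 (n : ℤ)}) : ∑ y, pS β L n x y = 1 := by
  have := opP_eq (β := β) (fun _ => 1) 1 x
  rw [Pk_iter_const β hL] at this
  simpa [opP] using this

lemma tr_val {L n N : ℕ} (f : Fin N → {η // η ∈ St (box L) 0 (n : ℤ)}) (t : ℕ) :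
    trajOf 0 (extSteps N 0 (fun i => (f i).1)) t = (tr ⟨0, zero_mem_St _ _⟩ f t).1 := by
  cases t with
  | zero => rfl
  | succ t =>
    simp only [trajOf, extSteps, tr]
    split_ifs <;> rfl

lemma path_eq {β : ℝ} {L n N : ℕ} (E : (ℕ → Config) → Prop) :
    pathProb (gl β L n) 0 N E = ∑ f : Fin N → {η // η ∈ St (box L) 0 (n : ℤ)},
      if E (fun t => (tr ⟨0, zero_mem_St _ _⟩ f t).1) then
        ∏ i ∈ Finset.range N, pS β L n (tr ⟨0, zero_mem_St _ _⟩ f i) (tr ⟨0, zero_mem_St _ _⟩ f (i + 1)) else 0 := by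
  unfold pathProb
  have hinj : Function.Injective (fun (f : Fin N → {η // η ∈ St (box L) 0 (n : ℤ)}) (i : Fin N) => (f i).1) := fun f f' h => by
    funext i
    exact Subtype.ext (congrFun h i)
  rw [← hinj.tsum_eq, tsum_fintype]
  · refine Finset.sum_congr rfl fun f _ => ?_
    have h1 : trajOf 0 (extSteps N 0 (fun i => (f i).1)) = fun t => (tr ⟨0, zero_mem_St _ _⟩ f t).1 := funext fun t => tr_val f t
    rw [h1]; rfl
  · intro f hf
    rw [Function.mem_support] at hf
    have hprod : ∏ t ∈ Finset.range N, gl β L n (trajOf 0 (extSteps N 0 f) t) (trajOf 0 (extSteps N 0 f) (t + 1)) ≠ 0 := fun h => hf (by rw [h, ite_self])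
    rw [Finset.prod_ne_zero_iff] at hprod
    have hmem : ∀ t ≤ N, trajOf 0 (extSteps N 0 f) t ∈ St (box L) 0 (n : ℤ) := by
      intro t
      induction t with
      | zero => intro _; exact zero_mem_St _ _
      | succ t ih => intro ht; exact gl_supp (ih (by omega)) (hprod t (Finset.mem_range.2 (by omega)))
    refine ⟨fun i => ⟨f i, ?_⟩, rfl⟩
    have := hmem (i.1 + 1) (by omega)
    simpa [trajOf, extSteps] using this

lemma path_bound {β : ℝ} {L n N T' : ℕ} (hL : 0 < L) (hT : T' ≤ N) {A : Set Config} (h0 : (0 : Config) ∉ A) {x y : ℝ} (hy : (T' : ℝ) ≤ y) :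
    pathProb (gl β L n) 0 N (fun tr => (∀ t : ℕ, (t : ℝ) < x → tr t ∉ A) ∧ ∃ t : ℕ, (t : ℝ) ≤ y ∧ tr t ∈ A) ≤ 1 ∧
    1 - (∑ t ∈ (Finset.range (N + 1)).filter (fun t : ℕ => (t : ℝ) < x), (Pk β L n (box L))^[t] (fun η => if η ∈ A then 1 else 0) 0)
      - (1 - (Pk β L n (box L))^[T'] (fun η => if η ∈ A then 1 else 0) 0) ≤
    pathProb (gl β L n) 0 N (fun tr => (∀ t : ℕ, (t : ℝ) < x → tr t ∉ A) ∧ ∃ t : ℕ, (t : ℝ) ≤ y ∧ tr t ∈ A) := by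
  set o : {η // η ∈ St (box L) 0 (n : ℤ)} := ⟨0, zero_mem_St _ _⟩ with ho
  set W : (Fin N → {η // η ∈ St (box L) 0 (n : ℤ)}) → ℝ := fun f => ∏ i ∈ Finset.range N, pS β L n (tr o f i) (tr o f (i + 1)) with hW
  have hW0 : ∀ f, 0 ≤ W f := fun f => Finset.prod_nonneg fun i _ => gl_nonneg (tr o f i).2 _
  have hs : ∀ t ≤ N, ∀ g : Config → ℝ, (Pk β L n (box L))^[t] g 0 = ∑ f, W f * g (tr o f t).1 := fun t ht g => by
    rw [path_sum (pS β L n) (pS_one hL) N o t ht (fun y => g y.1), opP_eq]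
  have hs1 : ∑ f, W f = 1 := by
    have := hs 0 (by omega) (fun _ => 1)
    simpa using this.symm
  rw [path_eq]
  constructor
  · rw [← hs1]
    refine Finset.sum_le_sum fun f _ => ?_
    split_ifs
    · exact le_rfl
    · exact hW0 f
  · have hq : ∑ t ∈ (Finset.range (N + 1)).filter (fun t : ℕ => (t : ℝ) < x), (Pk β L n (box L))^[t] (fun η => if η ∈ A then 1 else 0) 0 =
        ∑ t ∈ (Finset.range (N + 1)).filter (fun t : ℕ => (t : ℝ) < x), ∑ f, W f * (if (tr o f t).1 ∈ A then (1 : ℝ) else 0) :=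
      Finset.sum_congr rfl fun t ht => hs t (by
        have := Finset.mem_range.1 (Finset.mem_filter.1 ht).1
        omega) _
    rw [hs T' hT, hq, Finset.sum_comm, sub_sub_sub_cancel_left, ← Finset.sum_sub_distrib]
    refine Finset.sum_le_sum fun f _ => ?_
    have hW := hW0 f
    have hnn : ∀ t ∈ (Finset.range (N + 1)).filter (fun t : ℕ => (t : ℝ) < x), 0 ≤ W f * (if (tr o f t).1 ∈ A then (1 : ℝ) else 0) := fun t _ =>
      mul_nonneg hW (by split_ifs <;> norm_num)
    have hsum := Finset.sum_nonneg hnn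
    by_cases hE : (∀ t : ℕ, (t : ℝ) < x → (tr o f t).1 ∉ A) ∧ ∃ t : ℕ, (t : ℝ) ≤ y ∧ (tr o f t).1 ∈ A
    · rw [if_pos hE]
      have : W f * (if (tr o f T').1 ∈ A then (1 : ℝ) else 0) ≤ W f := mul_le_of_le_one_right hW (by split_ifs <;> norm_num)
      change _ ≤ W f
      linarith
    · rw [if_neg hE]
      by_cases h1 : ∀ t : ℕ, (t : ℝ) < x → (tr o f t).1 ∉ A
      · have h2 : (tr o f T').1 ∉ A := fun h => hE ⟨h1, T', hy, h⟩
        rw [if_neg h2, mul_zero]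
        linarith
      · push Not at h1
        obtain ⟨t, ht, htA⟩ := h1
        have htN : t ≤ N := by
          by_contra hc
          obtain ⟨s, rfl⟩ : ∃ s, t = s + 1 := ⟨t - 1, by omega⟩
          have : tr o f (s + 1) = o := dif_neg (by omega)
          rw [this] at htA
          exact h0 htA
        have h3 := Finset.single_le_sum hnn (Finset.mem_filter.2 ⟨Finset.mem_range.2 (by omega), ht⟩ : t ∈ _)
        rw [if_pos htA, mul_one] at h3
        have : W f * (if (tr o f T').1 ∈ A then (1 : ℝ) else 0) ≤ W f := mul_le_of_le_one_right hW (by split_ifs <;> norm_num)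
        linarith

structure Gd (β x : ℝ) (L h : ℕ) : Prop where
  h8 : 8 ≤ Real.log L
  hx : 2 * Real.exp (4 * β) ^ 2 * x ≤ L
  h16 : (L : ℝ) ^ 4 ≤ 2 ^ L
  hlog : 2 * Real.log L ^ 2 + (11 + 4 * β) * Real.log L + 5 ≤ x
  h24 : 24 * Real.exp (4 * β) ≤ x
  up : Real.exp (4 * β * h) ≤ Real.exp (4 * β) * x
  lo : x ≤ Real.exp (4 * β) * Real.exp (4 * β * h)
  hh : (h : ℝ) ≤ Real.log L / 240 + 1

lemma Gd.L9 {β x : ℝ} {L h : ℕ} (g : Gd β x L h) : (9 : ℝ) ≤ L := by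
  have h0 : (0 : ℝ) < L := by
    rcases Nat.eq_zero_or_pos L with rfl | h
    · have := g.h8; norm_num at this
    · exact_mod_cast h
  have := Real.log_le_sub_one_of_pos h0
  linarith [g.h8]

lemma Gd.logL {β x : ℝ} {L h : ℕ} (g : Gd β x L h) : Real.log L ≤ L := by
  have := Real.log_le_sub_one_of_pos (by linarith [g.L9] : (0 : ℝ) < L)
  linarith

lemma Gd.pw {β x : ℝ} {L h : ℕ} (g : Gd β x L h) (hβ : 60 ≤ β) {n m : ℕ} (hnm : (m : ℝ) + Real.log L / 2 ≤ n) :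
    Real.exp (-(3 * β)) ^ (n - m) ≤ ((L : ℝ) ^ 10)⁻¹ := by
  have h8 := g.h8
  have hm : m ≤ n := by
    have : (m : ℝ) ≤ n := by linarith
    exact_mod_cast this
  rw [← Real.exp_nat_mul, Nat.cast_sub hm]
  have h1 : Real.exp (-(10 * Real.log L)) = ((L : ℝ) ^ 10)⁻¹ := by
    rw [Real.exp_neg, show 10 * Real.log L = ((10 : ℕ) : ℝ) * Real.log L by norm_num, Real.exp_nat_mul, Real.exp_log (by linarith [g.L9])]
  rw [← h1]
  refine Real.exp_le_exp.2 ?_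
  nlinarith

lemma hh_facts {β a : ℝ} (hβ : 60 ≤ β) (ha0 : 0 < a) (ha1 : a < 1) {L : ℕ} (hL : 1 ≤ L) :
    Real.exp (4 * β * (⌈a * (eqHt β L : ℝ)⌉₊ : ℕ)) ≤ Real.exp (4 * β) * (L : ℝ) ^ a ∧
    (L : ℝ) ^ a ≤ Real.exp (4 * β) * Real.exp (4 * β * (⌈a * (eqHt β L : ℝ)⌉₊ : ℕ)) ∧
    ((⌈a * (eqHt β L : ℝ)⌉₊ : ℕ) : ℝ) ≤ Real.log L / 240 + 1 ∧ 0 ≤ a * (eqHt β L : ℝ) := by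
  have hlog : 0 ≤ Real.log L := Real.log_nonneg (by exact_mod_cast hL)
  have hL0 : (0 : ℝ) < L := by exact_mod_cast hL
  have h1 : (eqHt β L : ℝ) ≤ Real.log L / (4 * β) := Int.floor_le _
  have h2 : Real.log L / (4 * β) < (eqHt β L : ℝ) + 1 := Int.lt_floor_add_one _
  have h3 : 0 ≤ (eqHt β L : ℝ) := by exact_mod_cast Int.floor_nonneg.2 (div_nonneg hlog (by linarith : 0 ≤ 4 * β))
  have h4 : 0 ≤ a * (eqHt β L : ℝ) := mul_nonneg ha0.le h3
  have h5 := Nat.le_ceil (a * (eqHt β L : ℝ))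
  have h6 := Nat.ceil_lt_add_one h4
  set h := ⌈a * (eqHt β L : ℝ)⌉₊
  set H := (eqHt β L : ℝ)
  rw [le_div_iff₀ (by linarith)] at h1
  rw [div_lt_iff₀ (by linarith)] at h2
  have h7 : a * (H * (4 * β)) ≤ a * Real.log L := mul_le_mul_of_nonneg_left h1 ha0.le
  have h8 : a * Real.log L ≤ a * ((H + 1) * (4 * β)) := mul_le_mul_of_nonneg_left h2.le ha0.le
  have h9 : (h : ℝ) * (4 * β) ≤ (a * H + 1) * (4 * β) := mul_le_mul_of_nonneg_right h6.le (by linarith)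
  have h10 : a * H * (4 * β) ≤ h * (4 * β) := mul_le_mul_of_nonneg_right h5 (by linarith)
  refine ⟨?_, ?_, ?_, h4⟩
  · rw [Real.rpow_def_of_pos hL0, ← Real.exp_add]
    refine Real.exp_le_exp.2 ?_
    nlinarith
  · rw [Real.rpow_def_of_pos hL0, ← Real.exp_add]
    refine Real.exp_le_exp.2 ?_
    nlinarith
  · have : H * 240 ≤ Real.log L := by nlinarith
    nlinarith

lemma mem_Om {β a : ℝ} {L : ℕ} (h0 : 0 ≤ a * (eqHt β L : ℝ)) (η : Config) :
    η ∈ OmegaA β L a ↔ (9 / 10 : ℝ) * (L : ℝ) ^ 2 < (((box L).filter (fun x => ((⌈a * (eqHt β L : ℝ)⌉₊ : ℕ) : ℤ) ≤ η x)).card : ℝ) := by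
  have h1 : (box L).filter (fun x => a * (eqHt β L : ℝ) ≤ (η x : ℝ)) = (box L).filter (fun x => ((⌈a * (eqHt β L : ℝ)⌉₊ : ℕ) : ℤ) ≤ η x) := by
    refine Finset.filter_congr fun x _ => ?_
    rw [Int.natCast_ceil_eq_ceil h0, Int.ceil_le]
  rw [OmegaA, Set.mem_setOf_eq, h1, card_box]
  push_cast
  rfl

lemma ind_Om {β a : ℝ} {L : ℕ} (h0 : 0 ≤ a * (eqHt β L : ℝ)) :
    (fun η => if η ∈ OmegaA β L a then (1 : ℝ) else 0) = Oh L ⌈a * (eqHt β L : ℝ)⌉₊ := by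
  funext η
  simp only [mem_Om h0, Oh]

/-- equilibrium estimate -/
lemma eq_est {β x : ℝ} {L h n : ℕ} (hβ : 60 ≤ β) (g : Gd β x L h) (hn : Real.log L ≤ n) :
    1 - (∑ η ∈ St (box L) 0 n, w β L η * Oh L h η) / sw β L (St (box L) 0 n) ≤ 2 / L := by
  have h8 := g.h8
  have h9 := g.L9
  have hLL := g.logL
  have hL0 : (0 : ℝ) < L := by linarith
  have hB : 1 ≤ Real.exp (4 * β) := Real.one_le_exp (by linarith)
  have hB2 : 2 ≤ Real.exp (4 * β) := by linarith [Real.add_one_le_exp (4 * β)]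
  have hx0 : 0 ≤ x := by linarith [g.h24]
  set j0 := ⌊Real.log L / (4 * β)⌋₊ + 1 with hj
  have hj1 : Real.log L < j0 * (4 * β) := by
    have := Nat.lt_floor_add_one (Real.log L / (4 * β))
    rw [div_lt_iff₀ (by linarith)] at this
    rw [hj]; push_cast; exact this
  have hj2 : (j0 : ℝ) ≤ Real.log L / 240 + 1 := by
    have := Nat.floor_le (div_nonneg (by linarith) (by linarith) : 0 ≤ Real.log L / (4 * β))
    have h2 : Real.log L / (4 * β) ≤ Real.log L / 240 := div_le_div_of_nonneg_left (by linarith) (by norm_num) (by linarith)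
    rw [hj]; push_cast; linarith
  have hjn : (j0 : ℝ) + Real.log L / 2 ≤ n := by linarith
  have hft := ft_eq hβ (tile_box (L := L) (by exact_mod_cast hL0)) (h := h) (n := n) (j0 := j0) (by
      have : Real.exp (4 * β * ((h + 1 : ℕ) : ℝ)) = Real.exp (4 * β * h) * Real.exp (4 * β) := by
        rw [← Real.exp_add]; push_cast; ring_nf
      rw [this]
      have h1 := mul_le_mul_of_nonneg_right g.up (by linarith : 0 ≤ Real.exp (4 * β))
      have h2 : 0 ≤ Real.exp (4 * β) ^ 2 * x := by positivity
      linarith [g.hx]) (by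
      have h1 : Real.exp (-4 * β * ((j0 + 1 : ℕ) : ℝ)) ≤ Real.exp (-(Real.log L + 4 * β)) := Real.exp_le_exp.2 (by push_cast; nlinarith)
      rw [Real.exp_neg, Real.exp_add, Real.exp_log hL0] at h1
      calc 2 * Real.exp (-4 * β * ((j0 + 1 : ℕ) : ℝ)) * L ≤ 2 * ((L : ℝ) * Real.exp (4 * β))⁻¹ * L := by gcongr
        _ = 2 / Real.exp (4 * β) := by field_simp
        _ ≤ 1 := by rw [div_le_one (by linarith)]; exact hB2) (by
      have : (j0 : ℝ) ≤ n := by linarith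
      exact_mod_cast this)
  have hZ : 0 < sw β L (St (box L) 0 n) := lt_of_lt_of_le one_pos (one_le_sw le_rfl (by positivity))
  have hle : (∑ η ∈ St (box L) 0 n, w β L η * ft (box L) h L η) / sw β L (St (box L) 0 n) ≤ (∑ η ∈ St (box L) 0 n, w β L η * Oh L h η) / sw β L (St (box L) 0 n) := by
    refine div_le_div_of_nonneg_right (Finset.sum_le_sum fun η _ => mul_le_mul_of_nonneg_left ?_ (w_pos _ _ _).le) hZ.le
    unfold ft Oh
    by_cases h1 : (lowc (box L) h η : ℝ) ≤ 0.02 * (L : ℝ) ^ 2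
    · rw [if_pos h1, if_pos]
      have h2 := Finset.card_filter_add_card_filter_not (s := box L) (fun x => (h : ℤ) ≤ η x)
      simp only [not_le] at h2
      rw [card_box] at h2
      have h3 : (((box L).filter (fun x => (h : ℤ) ≤ η x)).card : ℝ) + (lowc (box L) h η : ℝ) = (L : ℝ) ^ 2 := by
        unfold lowc; exact_mod_cast h2
      have : 0 < (L : ℝ) ^ 2 := by positivity
      linarith
    · rw [if_neg h1]; split_ifs <;> norm_num
  have hp : pbad β h L n j0 ≤ 2 / L := by
    unfold pbad
    have h1 : (h : ℝ) * Real.exp (-(4 * β * L)) ≤ 1 / L := by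
      have h2 : (L : ℝ) ≤ Real.exp L := by linarith [Real.add_one_le_exp (L : ℝ)]
      have h3 : Real.exp (-(4 * β * L)) ≤ Real.exp (-(L + L)) := Real.exp_le_exp.2 (by nlinarith)
      rw [Real.exp_neg (_ + _), Real.exp_add] at h3
      have h4 : (h : ℝ) ≤ L := by linarith [g.hh]
      calc (h : ℝ) * Real.exp (-(4 * β * L)) ≤ L * (L * L : ℝ)⁻¹ := mul_le_mul h4 (h3.trans (by gcongr)) (Real.exp_nonneg _) hL0.le
        _ = 1 / L := by field_simp
    have h2 : (L : ℝ) ^ 2 * Real.exp (-(3 * β)) ^ (n - j0) ≤ 1 / L := by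
      calc (L : ℝ) ^ 2 * Real.exp (-(3 * β)) ^ (n - j0) ≤ (L : ℝ) ^ 2 * ((L : ℝ) ^ 10)⁻¹ := by
            exact mul_le_mul_of_nonneg_left (g.pw hβ hjn) (by positivity)
        _ ≤ (L : ℝ) ^ 2 * ((L : ℝ) ^ 3)⁻¹ := by
            gcongr
            · linarith
            · norm_num
        _ = 1 / L := by field_simp
    have : (2 : ℝ) / L = 1 / L + 1 / L := by ring
    linarith
  linarith

/-- lower bound on the hitting time -/
lemma low_est {β x c : ℝ} {L h n N : ℕ} (hβ : 60 ≤ β) (g : Gd β x L h) (hc : c * (100 * Real.exp (4 * β)) ≤ 1) (hc0 : 0 < c) :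
    ∑ t ∈ (Finset.range (N + 1)).filter (fun t : ℕ => (t : ℝ) < Real.exp (c * x)), (Pk β L n (box L))^[t] (Oh L h) 0 ≤
      2 * Real.exp (-(L / 2)) + 4 * ((L : ℝ) ^ 2 * Real.exp (-(3 / (100 * Real.exp (4 * β))) * x)) := by
  have h9 := g.L9
  have hL0 : (0 : ℝ) < L := by linarith
  set B := Real.exp (4 * β) with hBd
  have hB : 1 ≤ B := Real.one_le_exp (by linarith)
  have h24 := g.h24
  have hx0 : 0 < x := by linarith
  have hlo := g.lo
  have hup := g.up
  have hxL := g.hx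
  set E := Real.exp (4 * β * h) with hE
  have hE0 : 0 < E := Real.exp_pos _
  have hBx : B * x ≤ L := by nlinarith [mul_le_mul_of_nonneg_right hB (by positivity : 0 ≤ B * x)]
  have hh1 : 1 ≤ h := by
    by_contra hc
    have : h = 0 := by omega
    rw [this] at hE
    norm_num at hE
    rw [hE] at hlo
    linarith
  obtain ⟨j, rfl⟩ : ∃ j, h = j + 1 := ⟨h - 1, by omega⟩
  set r := ⌊E / 2⌋₊ with hr
  have hE24 : 24 ≤ E := by
    by_contra hc
    nlinarith
  have hr1 : (r : ℝ) ≤ E / 2 := Nat.floor_le (by linarith)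
  have hr2 : E / 4 ≤ r := by
    have := Nat.lt_floor_add_one (E / 2)
    linarith
  have hr6 : 6 ≤ r := Nat.le_floor (by push_cast; linarith)
  have hr0 : (0 : ℝ) < r := by linarith
  have hEB : x / B ≤ E := by rw [div_le_iff₀ (by linarith)]; linarith
  obtain ⟨M, hM1, hM2⟩ := big_exists hβ L (j + 1) n
  have hone : ∀ t : ℕ, (t : ℝ) < Real.exp (c * x) → (Pk β L n (box L))^[t] (Oh L (j + 1)) 0 ≤
      Real.exp (-L) + Real.exp (c * x) * (2 * (L : ℝ) ^ 2 * Real.exp (-(x / B / 20))) := fun t ht => by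
    have hOh : Oh L (j + 1) = fun η => if (9 / 10 : ℝ) * L ^ 2 < Nh L j η then 1 else 0 := by
      funext η; unfold Oh Nh; push_cast; rfl
    have hmono : Monotone (Oh L (j + 1)) := fun η σ hs => by
      unfold Oh
      have h1 : (((box L).filter (fun x => ((j + 1 : ℕ) : ℤ) ≤ η x)).card : ℝ) ≤ (((box L).filter (fun x => ((j + 1 : ℕ) : ℤ) ≤ σ x)).card : ℝ) := by
        exact_mod_cast Finset.card_le_card (Finset.monotone_filter_right _ fun x _ hx => le_trans hx (hs x))
      by_cases h2 : (9 / 10 : ℝ) * (L : ℝ) ^ 2 < (((box L).filter (fun x => ((j + 1 : ℕ) : ℤ) ≤ η x)).card : ℝ)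
      · rw [if_pos h2, if_pos (lt_of_lt_of_le h2 h1)]
      · rw [if_neg h2]; split_ifs <;> norm_num
    refine (Pk_comp (by linarith) hM1 (Finset.Subset.refl _) (Finset.Subset.refl _) hmono (fun η => by unfold Oh; split_ifs <;> norm_num) t 0 (zero_mem_St _ _)).trans ?_
    rw [hOh]
    refine (hit_small hβ hM2 le_rfl (by exact_mod_cast hL0) (r := r) ?_ hr6 t).trans ?_
    · have : Real.exp (-4 * β * ((j + 1 : ℕ) : ℝ)) = E⁻¹ := by rw [hE, ← Real.exp_neg]; ring_nf
      rw [this]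
      calc 2 * E⁻¹ * r ≤ 2 * E⁻¹ * (E / 2) := by gcongr
        _ = 1 := by field_simp
    · refine add_le_add (Real.exp_le_exp.2 (neg_le_neg ?_)) (mul_le_mul ht.le (mul_le_mul_of_nonneg_left (Real.exp_le_exp.2 (neg_le_neg ?_)) (by positivity)) (by positivity) (Real.exp_nonneg _))
      · rw [le_div_iff₀ hr0]
        have : (r : ℝ) ≤ L := by linarith
        nlinarith
      · linarith
  have hcard : (((Finset.range (N + 1)).filter (fun t : ℕ => (t : ℝ) < Real.exp (c * x))).card : ℝ) ≤ 2 * Real.exp (c * x) := by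
    have h1 : (Finset.range (N + 1)).filter (fun t : ℕ => (t : ℝ) < Real.exp (c * x)) ⊆ Finset.range ⌈Real.exp (c * x)⌉₊ := fun t ht => by
      rw [Finset.mem_range, Nat.lt_ceil]; exact (Finset.mem_filter.1 ht).2
    have h2 : ((((Finset.range (N + 1)).filter (fun t : ℕ => (t : ℝ) < Real.exp (c * x))).card : ℕ) : ℝ) ≤ (⌈Real.exp (c * x)⌉₊ : ℕ) := by
      have := Finset.card_le_card h1
      rw [Finset.card_range] at this
      exact_mod_cast this
    have h3 := Nat.ceil_lt_add_one (Real.exp_nonneg (c * x))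
    have h4 : 1 ≤ Real.exp (c * x) := Real.one_le_exp (by positivity)
    linarith
  have hcx : c * x ≤ x / (100 * B) := by
    rw [le_div_iff₀ (by positivity)]
    nlinarith
  have hxB : x / (100 * B) ≤ L / 2 := by
    rw [div_le_iff₀ (by positivity)]
    nlinarith
  refine (Finset.sum_le_card_nsmul _ _ _ fun t ht => hone t (Finset.mem_filter.1 ht).2).trans ?_
  rw [nsmul_eq_mul]
  calc _ ≤ 2 * Real.exp (c * x) * (Real.exp (-L) + Real.exp (c * x) * (2 * (L : ℝ) ^ 2 * Real.exp (-(x / B / 20)))) :=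
        mul_le_mul_of_nonneg_right hcard (by positivity)
    _ = 2 * Real.exp (c * x + -L) + 4 * ((L : ℝ) ^ 2 * Real.exp (c * x + c * x + -(x / B / 20))) := by
        rw [Real.exp_add, Real.exp_add, Real.exp_add]; ring
    _ ≤ _ := by
        have e1 : -(3 / (100 * B)) * x = x / (100 * B) + x / (100 * B) + -(x / B / 20) := by field_simp; norm_num
        rw [e1]
        gcongr
        linarith

lemma exp_log_pow {L : ℝ} (hL : 0 < L) (k : ℕ) : Real.exp (k * Real.log L) = L ^ k := by
  rw [Real.exp_nat_mul, Real.exp_log hL]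

set_option maxHeartbeats 1000000 in
lemma up_est {β x : ℝ} {L h n' : ℕ} (hβ : 60 ≤ β) (g : Gd β x L h) (hn' : Real.log L ≤ n') :
    ∃ T' : ℕ, (T' : ℝ) ≤ Real.exp (x * (1920 * β ^ 2 * Real.exp (4 * β) ^ 2 + 1)) ∧
      1 - (Pk β L n' (box L))^[T'] (Oh L h) 0 ≤ 8 * ((L : ℝ) ^ 3 * Real.exp (-1 * x)) + 12 / L := by
  have h8 := g.h8
  have h9 := g.L9
  have hLL := g.logL
  have hL0 : (0 : ℝ) < L := by linarith
  have hhL := g.hh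
  have hxL := g.hx
  have hup := g.up
  set B := Real.exp (4 * β) with hBd
  have hB : 1 ≤ B := Real.one_le_exp (by linarith)
  have hx0 : 0 < x := by linarith [g.h24]
  set u := Real.log L with hu
  set n := ⌊u⌋₊ with hn
  have hn1 : (n : ℝ) ≤ u := Nat.floor_le (by linarith)
  have hn2 : u < n + 1 := Nat.lt_floor_add_one _
  have hkn : ∀ k ≤ h + 1, (k : ℝ) ≤ u / 240 + 2 ∧ (k : ℝ) + u / 2 ≤ n ∧ (ll β k : ℝ) ≤ 2 * B ^ 2 * x ∧ (k : ℝ) ≤ L := fun k hk => by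
    have hk' : (k : ℝ) ≤ h + 1 := by exact_mod_cast hk
    refine ⟨by linarith, by linarith, ?_, by linarith⟩
    have h1 := ll_ub (by linarith : 0 ≤ β) k
    have h2 : Real.exp (4 * β * k) ≤ Real.exp (4 * β * h) * B := by
      rw [hBd, ← Real.exp_add]
      exact Real.exp_le_exp.2 (by nlinarith)
    have h3 := mul_le_mul_of_nonneg_right hup (by linarith : 0 ≤ B)
    nlinarith
  have hnn' : n ≤ n' := by
    have : (n : ℝ) ≤ n' := by linarith
    exact_mod_cast this
  have hp : ∀ k ≤ h + 1, (k : ℝ) ^ 4 * pbad β k (ll β k) n k ≤ 1 := fun k hk => by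
    rcases Nat.eq_zero_or_pos k with rfl | hk0
    · norm_num
    obtain ⟨-, h2, h3, h4⟩ := hkn k hk
    have hk1 : (1 : ℝ) ≤ k := by exact_mod_cast hk0
    have e1 : (k : ℝ) ^ 4 * (k * Real.exp (-(4 * β * ll β k))) ≤ 1 / 2 := by
      have q1 : (k : ℝ) ≤ ll β k := by
        have := ll_lb β k
        have := Real.add_one_le_exp (4 * β * k)
        nlinarith
      have q2 : (k : ℝ) ≤ Real.exp k := by linarith [Real.add_one_le_exp (k : ℝ)]
      have q3 : Real.exp (-(4 * β * ll β k)) ≤ Real.exp (-(5 * k + 1)) := Real.exp_le_exp.2 (by nlinarith)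
      have q4 : Real.exp (-(5 * (k : ℝ) + 1)) = (Real.exp k ^ 5)⁻¹ * (Real.exp 1)⁻¹ := by
        rw [← Real.exp_nat_mul, ← Real.exp_neg, ← Real.exp_neg, ← Real.exp_add]; push_cast; ring_nf
      have q5 : (2 : ℝ) ≤ Real.exp 1 := by linarith [Real.add_one_le_exp (1 : ℝ)]
      calc (k : ℝ) ^ 4 * (k * Real.exp (-(4 * β * ll β k))) = (k : ℝ) ^ 5 * Real.exp (-(4 * β * ll β k)) := by ring
        _ ≤ Real.exp k ^ 5 * ((Real.exp k ^ 5)⁻¹ * (Real.exp 1)⁻¹) := by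
            rw [← q4]; gcongr
        _ = (Real.exp 1)⁻¹ := by field_simp
        _ ≤ 1 / 2 := by rw [one_div]; exact inv_anti₀ (by norm_num) q5
    have e2 : (k : ℝ) ^ 4 * ((ll β k : ℝ) ^ 2 * Real.exp (-(3 * β)) ^ (n - k)) ≤ 1 / 2 := by
      calc (k : ℝ) ^ 4 * ((ll β k : ℝ) ^ 2 * Real.exp (-(3 * β)) ^ (n - k)) ≤ (L : ℝ) ^ 4 * ((L : ℝ) ^ 2 * ((L : ℝ) ^ 10)⁻¹) := by
            refine mul_le_mul (by gcongr) (mul_le_mul ?_ (g.pw hβ h2) (pow_nonneg (Real.exp_nonneg _) _) (by positivity)) (mul_nonneg (sq_nonneg _) (pow_nonneg (Real.exp_nonneg _) _)) (by positivity)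
            exact pow_le_pow_left₀ (Nat.cast_nonneg _) (by linarith) 2
        _ = ((L : ℝ) ^ 4)⁻¹ := by field_simp
        _ ≤ 1 / 2 := by
            rw [one_div]
            refine inv_anti₀ (by norm_num) ?_
            calc (2 : ℝ) ≤ 9 ^ 4 := by norm_num
              _ ≤ _ := by gcongr
    unfold pbad
    rw [mul_add]
    linarith
  set TT : ℝ := 100 * (2 * B ^ 2 * x) ^ 4 * Real.exp (β * (96 * (10 * β) * (2 * B ^ 2 * x))) * ((n + 1) * Real.exp (4 * β * n)) * (L ^ 4 * Real.log (n + 1)) with hTT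
  have hlogn : 0 ≤ Real.log ((n : ℝ) + 1) := Real.log_nonneg (by linarith [Nat.cast_nonneg (α := ℝ) n])
  have hTT0 : 0 ≤ TT := by positivity
  set T := ⌈TT⌉₊ + 1 with hT
  have hTT1 : (T : ℝ) ≤ TT + 2 := by
    have := Nat.ceil_lt_add_one hTT0
    rw [hT]; push_cast; linarith
  refine ⟨(2 * L) ^ (h + 1) * T, ?_, ?_⟩
  · have hlogn2 : Real.log ((n : ℝ) + 1) ≤ L := by
      have := Real.log_le_sub_one_of_pos (by linarith [Nat.cast_nonneg (α := ℝ) n] : 0 < (n : ℝ) + 1)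
      linarith
    have hnL : (n : ℝ) + 1 ≤ 2 * L := by linarith
    have b1 : TT ≤ 100 * (L : ℝ) ^ 4 * Real.exp (1920 * β ^ 2 * B ^ 2 * x) * ((2 * L) * Real.exp (4 * β * u)) * (L ^ 4 * L) := by
      have : β * (96 * (10 * β) * (2 * B ^ 2 * x)) = 1920 * β ^ 2 * B ^ 2 * x := by ring
      rw [hTT, this]
      gcongr
    set X := Real.exp (1920 * β ^ 2 * B ^ 2 * x) with hX
    set U := Real.exp (4 * β * u) with hU
    have hX1 : 1 ≤ X := Real.one_le_exp (by positivity)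
    have hU1 : 1 ≤ U := Real.one_le_exp (by nlinarith)
    have b2 : (T : ℝ) ≤ 202 * ((L : ℝ) ^ 10 * X * U) := by
      have p1 : 1 ≤ (L : ℝ) ^ 10 * X * U := by
        have : 1 ≤ (L : ℝ) ^ 10 := one_le_pow₀ (by linarith)
        exact one_le_mul_of_one_le_of_one_le (one_le_mul_of_one_le_of_one_le this hX1) hU1
      have p2 : 100 * (L : ℝ) ^ 4 * X * ((2 * L) * U) * (L ^ 4 * L) = 200 * ((L : ℝ) ^ 10 * X * U) := by ring
      linarith
    have b3 : ((2 : ℝ) * L) ^ (h + 1) ≤ Real.exp (2 * u ^ 2) := by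
      have q1 : (2 : ℝ) * L ≤ Real.exp (2 * u) := by
        have := exp_log_pow hL0 2
        rw [← hu] at this
        push_cast at this
        rw [this]; nlinarith
      calc ((2 : ℝ) * L) ^ (h + 1) ≤ Real.exp (2 * u) ^ (h + 1) := by gcongr
        _ = Real.exp ((h + 1 : ℕ) * (2 * u)) := (Real.exp_nat_mul _ _).symm
        _ ≤ _ := by
          refine Real.exp_le_exp.2 ?_
          push_cast
          nlinarith
    have b4 : (202 : ℝ) ≤ L ^ 1 * Real.exp 5 := by
      have : (32 : ℝ) ≤ Real.exp 5 := by
        have := Real.add_one_le_exp (1 : ℝ)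
        calc (32 : ℝ) = 2 ^ 5 := by norm_num
          _ ≤ Real.exp 1 ^ 5 := by gcongr; linarith
          _ = Real.exp 5 := by rw [← Real.exp_nat_mul]; norm_num
      rw [pow_one]
      have := mul_le_mul h9 this (by norm_num) hL0.le
      linarith
    push_cast
    calc ((2 : ℝ) * L) ^ (h + 1) * T ≤ Real.exp (2 * u ^ 2) * ((L ^ 1 * Real.exp 5) * ((L : ℝ) ^ 10 * X * U)) := by
          refine mul_le_mul b3 (b2.trans ?_) (Nat.cast_nonneg _) (Real.exp_nonneg _)
          gcongr
      _ = Real.exp (2 * u ^ 2) * (Real.exp 5 * (Real.exp ((11 : ℕ) * u) * X * U)) := by rw [exp_log_pow hL0]; ring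
      _ = Real.exp (2 * u ^ 2 + (5 + ((11 : ℕ) * u + 1920 * β ^ 2 * B ^ 2 * x + 4 * β * u))) := by
          rw [Real.exp_add, Real.exp_add, Real.exp_add, Real.exp_add]
      _ ≤ _ := by
          refine Real.exp_le_exp.2 ?_
          have := g.hlog
          push_cast
          linarith
  · refine (hit_big hβ (n := n) (T := T) (by exact_mod_cast hL0) hnn' ?_ ?_ hp (by omega) ?_ ?_ le_rfl).trans ?_
    · have := (hkn (h + 1) le_rfl).2.2.1
      have : (ll β (h + 1) : ℝ) ≤ L := by linarith
      exact_mod_cast this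
    · have := (hkn (h + 1) le_rfl).2.1
      have : ((h + 1 : ℕ) : ℝ) ≤ n := by linarith
      exact_mod_cast this
    · intro k hk
      have h3 := (hkn k hk).2.2.1
      have h4 : TT ≤ T := by
        rw [hT]; push_cast; linarith [Nat.le_ceil TT]
      refine le_trans ?_ h4
      rw [hTT]
      gcongr
    · intro k hk
      exact (pow_le_pow_left₀ (Nat.cast_nonneg _) (hkn k hk).2.2.2 4).trans g.h16
    · obtain ⟨-, h2, h3, h4⟩ := hkn (h + 1) le_rfl
      have hlL : (ll β (h + 1) : ℝ) ≤ L := by linarith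
      have hl := ll_lb β (h + 1)
      have hlx : x ≤ ll β (h + 1) := by
        have : Real.exp (4 * β * ((h + 1 : ℕ) : ℝ)) = B * Real.exp (4 * β * h) := by
          rw [hBd, ← Real.exp_add]; push_cast; ring_nf
        rw [this] at hl
        exact g.lo.trans hl
      have hhL' : (h : ℝ) ≤ L := by push_cast at h4; linarith
      have c1 : pbad β h (ll β (h + 1)) n (h + 1) ≤ L * Real.exp (-1 * x) + ((L : ℝ) ^ 3)⁻¹ := by
        unfold pbad
        refine add_le_add (mul_le_mul hhL' (Real.exp_le_exp.2 (by nlinarith)) (Real.exp_nonneg _) hL0.le) ?_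
        calc (ll β (h + 1) : ℝ) ^ 2 * Real.exp (-(3 * β)) ^ (n - (h + 1)) ≤ (L : ℝ) ^ 2 * ((L : ℝ) ^ 10)⁻¹ :=
              mul_le_mul (pow_le_pow_left₀ (Nat.cast_nonneg _) hlL 2) (g.pw hβ h2) (pow_nonneg (Real.exp_nonneg _) _) (by positivity)
          _ = ((L : ℝ) ^ 8)⁻¹ := by field_simp
          _ ≤ ((L : ℝ) ^ 3)⁻¹ := inv_anti₀ (by positivity) (pow_le_pow_right₀ (by linarith) (by norm_num))
      have c2 : (1 / 2 : ℝ) ^ L ≤ ((L : ℝ) ^ 3)⁻¹ := by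
        rw [one_div, inv_pow]
        exact inv_anti₀ (by positivity) (le_trans (pow_le_pow_right₀ (by linarith) (by norm_num)) g.h16)
      calc ((2 : ℝ) * L) ^ 2 * (2 * pbad β h (ll β (h + 1)) n (h + 1) + (1 / 2) ^ L)
          ≤ (2 * L) ^ 2 * (2 * (L * Real.exp (-1 * x) + ((L : ℝ) ^ 3)⁻¹) + ((L : ℝ) ^ 3)⁻¹) := by gcongr
        _ = _ := by field_simp; ring

lemma ev_log (r d : ℝ) {s : ℝ} (hs : 0 < s) (hd : 0 < d) (k : ℕ) : ∀ᶠ L : ℕ in atTop, r * Real.log L ^ k ≤ d * (L : ℝ) ^ s := by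
  have h1 := (isLittleO_log_rpow_rpow_atTop (k : ℝ) hs).comp_tendsto tendsto_natCast_atTop_atTop
  have h2 := h1.def (show 0 < d / (|r| + 1) by positivity)
  filter_upwards [h2] with L h
  simp only [Function.comp_apply, Real.rpow_natCast, Real.norm_eq_abs] at h
  rw [abs_of_nonneg (Real.rpow_nonneg (Nat.cast_nonneg L) s)] at h
  have h3 := mul_le_mul_of_nonneg_left h (abs_nonneg r)
  have h4 : r * Real.log L ^ k ≤ |r| * |Real.log L ^ k| := by rw [← abs_mul]; exact le_abs_self _
  have h5 : |r| * (d / (|r| + 1) * (L : ℝ) ^ s) ≤ d * (L : ℝ) ^ s := by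
    have h6 : |r| * (d / (|r| + 1)) ≤ d := by
      rw [← mul_div_assoc, div_le_iff₀ (by positivity)]
      nlinarith [abs_nonneg r]
    rw [← mul_assoc]
    exact mul_le_mul_of_nonneg_right h6 (Real.rpow_nonneg (Nat.cast_nonneg L) s)
  linarith

lemma ev_Gd {β a : ℝ} (hβ : 60 ≤ β) (ha0 : 0 < a) (ha1 : a < 1) :
    ∀ᶠ L : ℕ in atTop, Gd β ((L : ℝ) ^ a) L ⌈a * (eqHt β L : ℝ)⌉₊ ∧ 0 ≤ a * (eqHt β L : ℝ) := by
  have hl : Tendsto (fun L : ℕ => Real.log L) atTop atTop := Real.tendsto_log_atTop.comp tendsto_natCast_atTop_atTop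
  have hx : Tendsto (fun L : ℕ => (L : ℝ) ^ a) atTop atTop := (tendsto_rpow_atTop ha0).comp tendsto_natCast_atTop_atTop
  have hx' : Tendsto (fun L : ℕ => (L : ℝ) ^ (1 - a)) atTop atTop := (tendsto_rpow_atTop (by linarith)).comp tendsto_natCast_atTop_atTop
  have h2 := (isLittleO_pow_const_const_pow_of_one_lt (R := ℝ) 4 (by norm_num : (1 : ℝ) < 2)).def one_pos
  filter_upwards [hl.eventually_ge_atTop 8, hx.eventually_ge_atTop (24 * Real.exp (4 * β)), hx.eventually_ge_atTop 15,
    hx'.eventually_ge_atTop (2 * Real.exp (4 * β) ^ 2), h2, eventually_ge_atTop 1,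
    ev_log 2 (1 / 3) ha0 (by norm_num) 2, ev_log (11 + 4 * β) (1 / 3) ha0 (by norm_num) 1] with L e1 e2 e3 e4 e5 e6 e7 e8
  obtain ⟨f1, f2, f3, f4⟩ := hh_facts hβ ha0 ha1 e6
  have hL0 : (0 : ℝ) < L := by exact_mod_cast e6
  refine ⟨⟨e1, ?_, ?_, ?_, e2, f1, f2, f3⟩, f4⟩
  · have h1 := mul_le_mul_of_nonneg_right e4 (Real.rpow_nonneg hL0.le a)
    rw [← Real.rpow_add hL0, sub_add_cancel, Real.rpow_one] at h1
    exact h1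
  · simpa using e5
  · rw [pow_one] at e8; linarith

lemma tend_pow {a d : ℝ} (ha : 0 < a) (hd : 0 < d) (k : ℕ) : Tendsto (fun L : ℕ => (L : ℝ) ^ k * Real.exp (-d * (L : ℝ) ^ a)) atTop (nhds 0) := by
  have hx : Tendsto (fun L : ℕ => (L : ℝ) ^ a) atTop atTop := (tendsto_rpow_atTop ha).comp tendsto_natCast_atTop_atTop
  refine ((tendsto_rpow_mul_exp_neg_mul_atTop_nhds_zero (k / a) d hd).comp hx).congr fun L => ?_
  simp only [Function.comp_apply]
  rw [← Real.rpow_mul (Nat.cast_nonneg L), mul_div_cancel₀ _ ha.ne', Real.rpow_natCast]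

lemma tend_div (r : ℝ) : Tendsto (fun L : ℕ => r / (L : ℝ)) atTop (nhds 0) := tendsto_const_div_atTop_nhds_zero_nat r


end

/-- Theorem 2 of the paper. Fix `a ∈ (0,1)`. For every sufficiently
large `β` there is `c = c(β) > 0` such that, for the Glauber dynamics on `{1,…,L}²`
with zero boundary conditions, floor at `0` and ceiling at `n⁺` (`log L ≤ n⁺ ≤ L`)
started from the all-zero configuration: `π_Λ^0(Ω_a) → 1` and
`P(e^{c L^a} ≤ τ_a ≤ e^{L^a/c}) → 1` as `L → ∞`, where `τ_a` is the hitting time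
of `Ω_a`. -/
theorem sos_metastable_hitting_time (a : ℝ) (ha0 : 0 < a) (ha1 : a < 1) :
    ∃ β₀ : ℝ, ∀ β : ℝ, β₀ ≤ β → ∃ c : ℝ, 0 < c ∧
      ∀ np : ℕ → ℕ, (∀ L : ℕ, Real.log L ≤ (np L : ℝ) ∧ (np L : ℝ) ≤ (L : ℝ)) →
        Filter.Tendsto
            (fun L : ℕ =>
              gProb β (box L) 0 (Set.Icc 0 (np L : ℤ)) (fun _ => 0) (OmegaA β L a))
            Filter.atTop (nhds 1) ∧
        Filter.Tendsto
            (fun L : ℕ =>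
              pathProb (glauber β (box L) 0 (Set.Icc 0 (np L : ℤ)) (fun _ => 0)) 0
                (Nat.ceil (Real.exp ((L : ℝ) ^ a / c)))
                (fun tr =>
                  (∀ t : ℕ, (t : ℝ) < Real.exp (c * (L : ℝ) ^ a) → tr t ∉ OmegaA β L a) ∧
                  (∃ t : ℕ, (t : ℝ) ≤ Real.exp ((L : ℝ) ^ a / c) ∧ tr t ∈ OmegaA β L a)))
            Filter.atTop (nhds 1) := by
  refine ⟨60, fun β hβ => ?_⟩
  have hB : 1 ≤ Real.exp (4 * β) := Real.one_le_exp (by linarith)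
  set D : ℝ := 1920 * β ^ 2 * Real.exp (4 * β) ^ 2 + 1 with hD
  have hD0 : 0 < D := by positivity
  refine ⟨1 / D, by positivity, fun np hnp => ⟨?_, ?_⟩⟩
  · have ht : Tendsto (fun L : ℕ => 1 - 2 / (L : ℝ)) atTop (nhds 1) := by simpa using (tend_div 2).const_sub 1
    refine tendsto_of_tendsto_of_tendsto_of_le_of_le' ht tendsto_const_nhds ?_ ?_
    · filter_upwards [ev_Gd hβ ha0 ha1] with L hL
      have h1 := eq_est hβ hL.1 (hnp L).1
      rw [← ind_Om hL.2] at h1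
      rw [gProb_eq]
      linarith
    · refine Eventually.of_forall fun L => ?_
      rw [gProb_eq]
      refine div_le_one_of_le₀ ?_ (sw_nonneg _ _ _)
      refine Finset.sum_le_sum fun η _ => mul_le_of_le_one_right (w_pos _ _ _).le ?_
      split_ifs <;> norm_num
  · have ht : Tendsto (fun L : ℕ => 1 - (2 * ((L : ℝ) ^ 0 * Real.exp (-(1 / 2) * (L : ℝ) ^ (1 : ℝ))) + 4 * ((L : ℝ) ^ 2 * Real.exp (-(3 / (100 * Real.exp (4 * β))) * (L : ℝ) ^ a)))
        - (8 * ((L : ℝ) ^ 3 * Real.exp (-1 * (L : ℝ) ^ a)) + 12 / (L : ℝ))) atTop (nhds 1) := by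
      have e1 := (tend_pow one_pos (by norm_num : (0 : ℝ) < 1 / 2) 0).const_mul 2
      have e2 := (tend_pow ha0 (by positivity : 0 < 3 / (100 * Real.exp (4 * β))) 2).const_mul 4
      have e3 := (tend_pow ha0 one_pos 3).const_mul 8
      have := ((e1.add e2).const_sub 1).sub (e3.add (tend_div 12))
      simpa using this
    have key : ∀ L : ℕ, Gd β ((L : ℝ) ^ a) L ⌈a * (eqHt β L : ℝ)⌉₊ ∧ 0 ≤ a * (eqHt β L : ℝ) →
        pathProb (gl β L (np L)) 0 (Nat.ceil (Real.exp ((L : ℝ) ^ a / (1 / D))))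
                (fun tr =>
                  (∀ t : ℕ, (t : ℝ) < Real.exp (1 / D * (L : ℝ) ^ a) → tr t ∉ OmegaA β L a) ∧
                  (∃ t : ℕ, (t : ℝ) ≤ Real.exp ((L : ℝ) ^ a / (1 / D)) ∧ tr t ∈ OmegaA β L a)) ≤ 1 ∧
        1 - (2 * ((L : ℝ) ^ 0 * Real.exp (-(1 / 2) * (L : ℝ) ^ (1 : ℝ))) + 4 * ((L : ℝ) ^ 2 * Real.exp (-(3 / (100 * Real.exp (4 * β))) * (L : ℝ) ^ a)))
        - (8 * ((L : ℝ) ^ 3 * Real.exp (-1 * (L : ℝ) ^ a)) + 12 / (L : ℝ)) ≤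
        pathProb (gl β L (np L)) 0 (Nat.ceil (Real.exp ((L : ℝ) ^ a / (1 / D))))
                (fun tr =>
                  (∀ t : ℕ, (t : ℝ) < Real.exp (1 / D * (L : ℝ) ^ a) → tr t ∉ OmegaA β L a) ∧
                  (∃ t : ℕ, (t : ℝ) ≤ Real.exp ((L : ℝ) ^ a / (1 / D)) ∧ tr t ∈ OmegaA β L a)) := by
      rintro L ⟨g, h0⟩
      have h9 := g.L9
      have hL0 : (0 : ℝ) < L := by linarith
      obtain ⟨T', hT1, hT2⟩ := up_est hβ g (hnp L).1
      have hD1 : (L : ℝ) ^ a / (1 / D) = (L : ℝ) ^ a * D := by rw [div_div_eq_mul_div, div_one]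
      rw [← hD, ← hD1] at hT1
      have hlow := low_est (c := 1 / D) (n := np L) (N := ⌈Real.exp ((L : ℝ) ^ a / (1 / D))⌉₊) hβ g (by
        rw [one_div, inv_mul_le_iff₀ hD0, hD]
        have : 1 * Real.exp (4 * β) ≤ Real.exp (4 * β) ^ 2 := by nlinarith
        have h2 : 100 ≤ 1920 * β ^ 2 := by nlinarith
        nlinarith) (by positivity)
      have hzero : (0 : Config) ∉ OmegaA β L a := by
        rw [mem_Om h0]
        have hlo := g.lo
        have h24 := g.h24
        have hh1 : 1 ≤ ⌈a * (eqHt β L : ℝ)⌉₊ := by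
          by_contra hc
          rw [show ⌈a * (eqHt β L : ℝ)⌉₊ = 0 by omega] at hlo
          norm_num at hlo
          linarith
        rw [Finset.filter_false_of_mem]
        · rw [Finset.card_empty, Nat.cast_zero, not_lt]; exact mul_nonneg (by norm_num) (sq_nonneg _)
        · intro x _ hx
          have : ((⌈a * (eqHt β L : ℝ)⌉₊ : ℕ) : ℤ) ≤ 0 := hx
          omega
      obtain ⟨p1, p2⟩ := path_bound (β := β) (n := np L) (x := Real.exp (1 / D * (L : ℝ) ^ a)) (by exact_mod_cast hL0) (hT := (Nat.cast_le (α := ℝ)).1 (hT1.trans (Nat.le_ceil _))) hzero hT1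
      refine ⟨p1, le_trans ?_ p2⟩
      rw [ind_Om h0]
      rw [Real.rpow_one, pow_zero, one_mul, show -(1 / 2) * (L : ℝ) = -(L / 2) by ring]
      linarith
    refine tendsto_of_tendsto_of_tendsto_of_le_of_le' ht tendsto_const_nhds ?_ ?_
    · filter_upwards [ev_Gd hβ ha0 ha1] with L hL using (key L hL).2
    · filter_upwards [ev_Gd hβ ha0 ha1] with L hL using (key L hL).1

end SOSPaper
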